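/- (Westzynthius, 1931) There is a constant C > 0 such that for all sufficiently large X one has G(X) ≥ C · (log X · log_2 X) / (log_3 X). -/

import Mathlib

open Real Filter

/-- `nthPrime n` is the `n`-th prime number `p_n` (so `p_1 = 2`, `p_2 = 3`, ...). -/
noncomputable def nthPrime (n : ℕ) : ℕ := Nat.nth Nat.Prime (n - 1)

/-- `iterlog k x` is the `k`-fold iterated natural logarithm `log_k x`,
with `iterlog 1 x = log x` and `iterlog (k+1) x = log (iterlog k x)`. -/
noncomputable def iterlog : ℕ → ℝ → ℝ
  | 0, x => x
  | k + 1, x => Real.log (iterlog k x)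

/-- `G X` is the maximal gap between consecutive primes `p_{n+1} ≤ X`. -/
noncomputable def G (X : ℝ) : ℝ :=
  sSup {d : ℝ | ∃ n : ℕ, 1 ≤ n ∧ (nthPrime (n + 1) : ℝ) ≤ X ∧
    d = (nthPrime (n + 1) : ℝ) - nthPrime n}

open Finset
set_option linter.unusedSimpArgs false
set_option linter.unusedSectionVars false
set_option linter.unusedVariables false

section AbsSieve
variable {ι α β : Type} [Fintype ι] [DecidableEq ι] [Fintype α] [DecidableEq α] [Fintype β] [DecidableEq β]

/-- positive semidefinite real kernels -/
def KP (K : β → β → ℝ) : Prop := (∀ a b, K a b = K b a) ∧ ∀ y : β → ℝ, 0 ≤ ∑ a, ∑ b, y a * y b * K a b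

lemma KP_iff (K : β → β → ℝ) : KP K ↔ (Matrix.of K).PosSemidef := by
  rw [Matrix.posSemidef_iff_dotProduct_mulVec]
  have e : ∀ x : β → ℝ, star x ⬝ᵥ (Matrix.of K).mulVec x = ∑ a, ∑ b, x a * x b * K a b := by
    intro x
    simp only [dotProduct, Matrix.mulVec, Finset.mul_sum]
    refine sum_congr rfl fun a _ => sum_congr rfl fun b _ => ?_
    change x a * (K a b * x b) = x a * x b * K a b; ring
  simp only [e]
  constructor
  · rintro ⟨h1, h2⟩
    exact ⟨by ext a b; simp [h1 a b], h2⟩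
  · rintro ⟨h1, h2⟩
    refine ⟨fun a b => ?_, h2⟩
    have := congrFun (congrFun h1 b) a
    simpa using this

lemma KP_prod (K : ι → β → β → ℝ) (h : ∀ s, KP (K s)) (S : Finset ι) :
    KP (fun v v' : ι → β => ∏ s ∈ S, K s (v s) (v' s)) := by
  induction S using Finset.induction_on with
  | empty =>
    refine ⟨fun _ _ => by simp, fun y => ?_⟩
    simp only [prod_empty, mul_one, ← Finset.mul_sum, ← Finset.sum_mul]
    exact mul_self_nonneg _
  | insert a S ha ih =>
    rw [KP_iff] at *
    have h1 := ((KP_iff _).1 (h a)).submatrix (fun v : ι → β => v a)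
    have := h1.hadamard ih
    have e : (Matrix.of fun v v' : ι → β => ∏ s ∈ insert a S, K s (v s) (v' s)) =
      ((Matrix.of (K a)).submatrix (fun v => v a) fun v => v a).hadamard
        (Matrix.of fun v v' => ∏ s ∈ S, K s (v s) (v' s)) := by
      ext v v'
      simp [prod_insert ha, Matrix.hadamard]
    rw [e]; exact this

lemma KP_compare (A B : ι → β → β → ℝ) (hA : ∀ s, KP (A s)) (hB : ∀ s, KP (fun a b => B s a b - A s a b))
    (y : (ι → β) → ℝ) :
    ∑ v, ∑ v', y v * y v' * ∏ s, A s (v s) (v' s) ≤ ∑ v, ∑ v', y v * y v' * ∏ s, B s (v s) (v' s) := by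
  have key : ∀ v v' : ι → β, ∏ s, B s (v s) (v' s) = ∑ t ∈ univ.powerset,
      ∏ s, (if s ∈ t then A s else fun a b => B s a b - A s a b) (v s) (v' s) := by
    intro v v'
    have : ∀ s, B s (v s) (v' s) = A s (v s) (v' s) + (B s (v s) (v' s) - A s (v s) (v' s)) := fun s => by ring
    rw [prod_congr rfl fun s _ => this s, prod_add]
    refine sum_congr rfl fun t _ => ?_
    rw [← Finset.prod_sdiff (subset_univ t), mul_comm]
    congr 1
    · refine prod_congr rfl fun s hs => ?_
      rw [if_neg (by simpa using hs)]
    · refine prod_congr rfl fun s hs => ?_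
      rw [if_pos hs]
  have e1 : ∑ v, ∑ v', y v * y v' * ∏ s, B s (v s) (v' s) = ∑ t ∈ (univ : Finset ι).powerset, ∑ v, ∑ v', y v * y v' *
      ∏ s, (if s ∈ t then A s else fun a b => B s a b - A s a b) (v s) (v' s) := by
    simp only [key, Finset.mul_sum]
    conv_lhs => enter [2, v]; rw [Finset.sum_comm]
    rw [Finset.sum_comm]
  rw [e1]
  have := Finset.single_le_sum (s := (univ : Finset ι).powerset) (a := univ) (f := fun t => ∑ v, ∑ v', y v * y v' *
      ∏ s, (if s ∈ t then A s else fun a b => B s a b - A s a b) (v s) (v' s)) (fun t _ => ?_) (by simp)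
  · simpa using this
  · refine (KP_prod (fun s => (if s ∈ t then A s else fun a b => B s a b - A s a b)) (fun s => ?_) univ).2 y
    by_cases hs : s ∈ t
    · simpa [hs] using hA s
    · simpa [hs] using hB s

lemma sum_prod_pi (f : ι → β → ℝ) : ∑ x : ι → β, ∏ s, f s (x s) = ∏ s, ∑ c, f s c := by
  rw [Finset.prod_univ_sum]; simp

def ee (C : Finset α) (q : ℝ) : Option α → Option α → ℝ
  | none, _ => 1
  | some h, x => if h ∈ C then q - (if x = some h then 1 else 0) else 0

def pr (C : Finset α) (q : ℝ) : Option α → ℝ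
  | none => 1 - #C * q
  | some h => if h ∈ C then q else 0

noncomputable def Lin (C : Finset α) (q : ι → ℝ) (y : (ι → Option α) → ℝ) (x : ι → Option α) : ℝ :=
  ∑ v, y v * ∏ s, ee C (q s) (v s) (x s)

noncomputable def Wt (q : ι → ℝ) (v : ι → Option α) : ℝ := ∏ s, if v s = none then 1 else q s

/-- expectation under product of local measures -/
noncomputable def EE (τ : ι → β → ℝ) (f : (ι → β) → ℝ) : ℝ := ∑ x, (∏ s, τ s (x s)) * f x

lemma EE_prod (τ φ : ι → β → ℝ) : EE τ (fun x => ∏ s, φ s (x s)) = ∏ s, ∑ c, τ s c * φ s c := by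
  simp only [EE, ← prod_mul_distrib]
  exact sum_prod_pi (fun s c => τ s c * φ s c)

lemma EE_lin_sq (C : Finset α) (q : ι → ℝ) (τ : ι → Option α → ℝ) (y : (ι → Option α) → ℝ) :
    EE τ (fun x => (Lin C q y x) ^ 2) = ∑ v, ∑ v', y v * y v' *
      ∏ s, ∑ c, τ s c * (ee C (q s) (v s) c * ee C (q s) (v' s) c) := by
  have : ∀ v v' : ι → Option α, ∏ s, ∑ c, τ s c * (ee C (q s) (v s) c * ee C (q s) (v' s) c) =
      EE τ (fun x => ∏ s, (ee C (q s) (v s) (x s) * ee C (q s) (v' s) (x s))) := fun v v' => 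
        (EE_prod τ (fun s c => ee C (q s) (v s) c * ee C (q s) (v' s) c)).symm
  simp only [this]
  have h2 : ∀ x, (∏ s, τ s (x s)) * Lin C q y x ^ 2 = ∑ v, ∑ v', y v * y v' *
      ((∏ s, τ s (x s)) * ∏ s, (ee C (q s) (v s) (x s) * ee C (q s) (v' s) (x s))) := by
    intro x
    rw [Lin, sq, Finset.sum_mul_sum, Finset.mul_sum]
    refine sum_congr rfl fun v _ => ?_
    rw [Finset.mul_sum]
    refine sum_congr rfl fun v' _ => ?_
    rw [prod_mul_distrib]; ring
  simp only [EE, h2, Finset.mul_sum]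
  rw [Finset.sum_comm]
  refine sum_congr rfl fun v _ => ?_
  rw [Finset.sum_comm]

lemma sum_pr (C : Finset α) (q : ℝ) : ∑ c, pr C q c = 1 := by
  simp [Fintype.sum_option, pr]

lemma pr_nonneg (C : Finset α) {q : ℝ} (hq : 0 ≤ q) (h : #C * q ≤ 1) (c : Option α) : 0 ≤ pr C q c := by
  cases c with
  | none => simp [pr]; linarith
  | some h => simp only [pr]; split_ifs <;> simp [hq]

/-- the Gram kernel -/
def gk (C : Finset α) (q : ℝ) : Option α → Option α → ℝ
  | none, none => 1
  | none, some _ => 0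
  | some _, none => 0
  | some h, some h' => if h ∈ C ∧ h' ∈ C then (if h = h' then q else 0) - q ^ 2 else 0

lemma gram_eq (C : Finset α) (q : ℝ) (a b : Option α) :
    ∑ c, pr C q c * (ee C q a c * ee C q b c) = gk C q a b := by
  have hs : ∀ h, h ∈ C → ∑ x, pr C q x * (if x = some h then 1 else 0) = q := by
    intro h hC
    simp [pr, hC]
  have hn : ∀ h, ∑ c, pr C q c * ee C q (some h) c = 0 := by
    intro h
    by_cases hC : h ∈ C
    · have : ∀ c, pr C q c * ee C q (some h) c =
          q * pr C q c - pr C q c * (if c = some h then 1 else 0) := by intro c; simp only [ee, if_pos hC]; ring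
      simp only [this, sum_sub_distrib, ← Finset.mul_sum, sum_pr, hs h hC]; ring
    · simp [ee, hC]
  cases a with
  | none => cases b with
    | none => simpa [ee, gk] using sum_pr C q
    | some h => simpa [gk, ee] using hn h
  | some h => cases b with
    | none => simpa [gk, ee] using hn h
    | some h' =>
      simp only [gk]
      by_cases hC : h ∈ C
      · by_cases hC' : h' ∈ C
        · have : ∀ c, pr C q c * (ee C q (some h) c * ee C q (some h') c) =
            q ^ 2 * pr C q c - q * (pr C q c * (if c = some h then 1 else 0))
            - q * (pr C q c * (if c = some h' then 1 else 0))
            + (if h = h' then 1 else 0) * (pr C q c * (if c = some h then 1 else 0)) := by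
            intro c; simp only [ee, if_pos hC, if_pos hC']
            have : (if c = some h then (1:ℝ) else 0) * (if c = some h' then 1 else 0) =
              (if h = h' then 1 else 0) * (if c = some h then 1 else 0) := by
              by_cases h1 : c = some h
              · simp [h1]
              · by_cases h2 : h = h'
                · subst h2; simp [h1]
                · simp [h1, h2]
            linear_combination pr C q c * this
          simp only [this, sum_sub_distrib, sum_add_distrib, ← Finset.mul_sum, sum_pr, hs h hC, hs h' hC', hC, hC']
          split_ifs <;> simp_all <;> ring
        · simp [ee, hC']
      · simp [ee, hC]

lemma gk_symm (C : Finset α) (q : ℝ) (a b : Option α) : gk C q a b = gk C q b a := by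
  rw [← gram_eq, ← gram_eq]; exact sum_congr rfl fun c _ => by ring

lemma KP_gram (C : Finset α) {q : ℝ} (hq : 0 ≤ q) (h : #C * q ≤ 1) :
    KP (fun a b => ∑ c, pr C q c * (ee C q a c * ee C q b c)) := by
  refine ⟨fun a b => sum_congr rfl fun c _ => by ring, fun y => ?_⟩
  have : ∑ a, ∑ b, y a * y b * ∑ c, pr C q c * (ee C q a c * ee C q b c) =
      ∑ c, pr C q c * (∑ a, y a * ee C q a c) ^ 2 := by
    have : ∀ c, pr C q c * (∑ a, y a * ee C q a c) ^ 2 = ∑ a, ∑ b, y a * y b * (pr C q c * (ee C q a c * ee C q b c)) := by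
      intro c
      rw [sq, Finset.sum_mul_sum, Finset.mul_sum]
      refine sum_congr rfl fun a _ => ?_
      rw [Finset.mul_sum]
      refine sum_congr rfl fun b _ => by ring
    simp only [this, Finset.mul_sum]
    rw [eq_comm, Finset.sum_comm]
    refine sum_congr rfl fun a _ => ?_
    rw [Finset.sum_comm]
  rw [this]
  exact sum_nonneg fun c _ => mul_nonneg (pr_nonneg C hq h c) (sq_nonneg _)

lemma diag_sum (y : (ι → Option α) → ℝ) (d : ι → Option α → ℝ) :
    ∑ v, ∑ v', y v * y v' * ∏ s, (if v s = v' s then d s (v s) else 0) = ∑ v, y v ^ 2 * ∏ s, d s (v s) := by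
  refine sum_congr rfl fun v _ => ?_
  rw [Finset.sum_eq_single v]
  · simp only [if_true]; ring
  · intro v' _ hv
    obtain ⟨s, hs⟩ := Function.ne_iff.1 (Ne.symm hv)
    rw [prod_eq_zero (mem_univ s) (by simp [hs])]; ring
  · simp

/-- (U) -/
lemma sieve_upper (C : Finset α) (q : ι → ℝ) (hq : ∀ s, 0 ≤ q s) (h : ∀ s, #C * q s ≤ 1)
    (y : (ι → Option α) → ℝ) :
    EE (fun s => pr C (q s)) (fun x => (Lin C q y x) ^ 2) ≤ ∑ v, y v ^ 2 * Wt q v := by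
  rw [EE_lin_sq]
  unfold Wt
  rw [← diag_sum y (fun s a => if a = none then 1 else q s)]
  refine KP_compare _ (fun s a b => if a = b then (if a = none then 1 else q s) else 0)
     (fun s => KP_gram C (hq s) (h s)) (fun s => ?_) y
  simp only [gram_eq]
  refine ⟨fun a b => ?_, fun z => ?_⟩
  · beta_reduce; rw [gk_symm]; by_cases h : a = b
    · simp [h]
    · simp [h, Ne.symm h]
  · simp only [Fintype.sum_option]
    have e : ∀ a b : α, z (some a) * z (some b) * ((if some a = some b then if some a = none then 1 else q s else 0) -
      gk C (q s) (some a) (some b)) =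
      (if a = b then (if a ∈ C then 0 else q s * z (some a) * z (some b)) else 0) +
      (if a ∈ C then q s * z (some a) else 0) * (if b ∈ C then q s * z (some b) else 0) := by
      intro a b
      simp only [gk]
      by_cases ha : a ∈ C <;> by_cases hb : b ∈ C <;> by_cases hab : a = b <;> simp [ha, hb, hab] <;>
        ring1
    simp only [e]
    simp only [sum_add_distrib, ← Finset.mul_sum, ← Finset.sum_mul]
    simp [gk]
    refine add_nonneg (sum_nonneg fun a _ => ?_) (mul_self_nonneg _)
    split_ifs
    · simp
    · rw [mul_assoc]; exact mul_nonneg (hq s) (mul_self_nonneg _)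

/-- (Lw) -/
lemma sieve_lower (C : Finset α) (q : ι → ℝ) (hq : ∀ s, 0 ≤ q s) (k : ℝ) (hk : #C ≤ k) (h : ∀ s, k * q s ≤ 1)
    (y : (ι → Option α) → ℝ) (hy : ∀ v, (∃ s, ∃ a, v s = some a ∧ a ∉ C) → y v = 0) :
    ∑ v, y v ^ 2 * ∏ s, (if v s = none then 1 else q s * (1 - k * q s)) ≤
    EE (fun s => pr C (q s)) (fun x => (Lin C q y x) ^ 2) := by
  rw [EE_lin_sq]
  have e0 : ∑ v, y v ^ 2 * ∏ s, (if v s = none then 1 else q s * (1 - k * q s)) =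
     ∑ v, y v ^ 2 * ∏ s, (v s).elim 1 (fun a => if a ∈ C then q s * (1 - k * q s) else 0) := by
    refine sum_congr rfl fun v _ => ?_
    by_cases hv : ∃ s, ∃ a, v s = some a ∧ a ∉ C
    · simp [hy v hv]
    · push Not at hv
      congr 1
      refine prod_congr rfl fun s _ => ?_
      cases hs : v s with
      | none => simp
      | some a => simp [hv s a hs]
  rw [e0, ← diag_sum y (fun s a => a.elim 1 (fun a => if a ∈ C then q s * (1 - k * q s) else 0))]
  refine KP_compare (fun s a b => if a = b then (a.elim 1 (fun a => if a ∈ C then q s * (1 - k * q s) else 0)) else 0)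
     (fun s a b => ∑ c, pr C (q s) c * (ee C (q s) a c * ee C (q s) b c)) (fun s => ?_) (fun s => ?_) y
  · refine ⟨fun a b => by by_cases h : a = b; { simp [h] }; { simp [h, Ne.symm h] }, fun z => ?_⟩
    simp only [mul_ite, mul_zero, Finset.sum_ite_eq, Finset.mem_univ, if_true]
    refine sum_nonneg fun a _ => mul_nonneg (mul_self_nonneg _) ?_
    cases a with
    | none => simp
    | some a =>
      simp only [Option.elim]; split_ifs
      · exact mul_nonneg (hq s) (by linarith [h s])
      · simp
  · simp only [gram_eq]
    refine ⟨fun a b => ?_, fun z => ?_⟩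
    · beta_reduce; rw [gk_symm]; by_cases h : a = b
      · simp [h]
      · simp [h, Ne.symm h]
    · simp only [Fintype.sum_option]
      have e : ∀ a b : α, z (some a) * z (some b) * (gk C (q s) (some a) (some b) -
       (if some a = some b then (some a).elim 1 (fun a => if a ∈ C then q s * (1 - k * q s) else 0) else 0)) =
        (if a = b then (if a ∈ C then k * (q s * z (some a)) ^ 2 else 0) else 0) -
        (if a ∈ C then q s * z (some a) else 0) * (if b ∈ C then q s * z (some b) else 0) := by
        intro a b
        simp only [gk, Option.elim]
        by_cases ha : a ∈ C <;> by_cases hb : b ∈ C <;> by_cases hab : a = b <;> simp [ha, hb, hab] <;>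
          ring1
      simp only [e]
      simp only [sum_sub_distrib, ← Finset.mul_sum, ← Finset.sum_mul]
      simp [gk]
      have h1 := sq_sum_le_card_mul_sum_sq (s := C) (f := fun a => q s * z (some a))
      have h2 : (0:ℝ) ≤ ∑ a ∈ C, (q s * z (some a)) ^ 2 := sum_nonneg fun _ _ => sq_nonneg _
      have h3 := mul_le_mul_of_nonneg_right hk h2
      rw [← Finset.mul_sum, ← Finset.mul_sum, ← Finset.sum_mul]
      simp only [← Finset.mul_sum] at h1
      rw [← Finset.mul_sum, ← pow_two]
      linarith
end AbsSieve

section AbsSieve2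
variable {ι α β : Type} [Fintype ι] [DecidableEq ι] [Fintype α] [DecidableEq α] [Fintype β] [DecidableEq β]

lemma sum_split (b : ι) (F : (ι → Option α) → ℝ) :
    ∑ v, F v = ∑ v : ι → Option α, if v b = none then ∑ c, F (Function.update v b c) else 0 := by
  have : ∀ v : ι → Option α, (if v b = none then ∑ c, F (Function.update v b c) else 0) =
      ∑ c, if v b = none then F (Function.update v b c) else 0 := by
    intro v; split_ifs <;> simp
  simp only [this]
  rw [← Finset.sum_product' (f := fun (v : ι → Option α) c => if v b = none then F (Function.update v b c) else 0),
    ← Finset.sum_filter]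
  refine Finset.sum_nbij' (fun v => (Function.update v b none, v b)) (fun z => Function.update z.1 b z.2) ?_ ?_ ?_ ?_ ?_
  · intro v _; simp
  · intro v _; simp
  · intro v _; simp
  · intro z hz
    simp at hz
    ext1
    · simp only [Function.update_idem, Function.update_self]
      rw [← hz]; simp
    · simp
  · intro v _; simp

/-- sum of |e_c(x)| -/
lemma sum_abs_ee (C : Finset α) {q : ℝ} (hq : 0 ≤ q) (h : #C * q ≤ 1) (x : Option α) :
    ∑ c, |ee C q c x| ≤ 3 := by
  rw [Fintype.sum_option]
  have h1 : ∀ a : α, |ee C q (some a) x| ≤ (if a ∈ C then q else 0) + (if x = some a then 1 else 0) := by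
    intro a
    simp only [ee]
    split_ifs
    · rw [abs_le]; constructor <;> linarith
    · simp [abs_of_nonneg hq]
    · simp
    · simp
  have h2 : ∑ a : α, (if x = some a then (1:ℝ) else 0) ≤ 1 := by
    cases x with
    | none => simp
    | some a => simp
  have h3 := Finset.sum_le_sum fun a (_ : a ∈ (univ : Finset α)) => h1 a
  rw [sum_add_distrib] at h3
  have h4 : ∑ a : α, (if a ∈ C then q else 0) = #C * q := by simp
  rw [h4] at h3
  have h5 : |ee C q none x| = 1 := by simp [ee]
  linarith

/-- (F) -/
lemma forced_bound (C : Finset α) (q : ι → ℝ) (hq : ∀ s, 0 ≤ q s) (h : ∀ s, #C * q s ≤ 1)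
    (x0 : ι → Option α) (B : Finset ι) : ∀ (y Y : (ι → Option α) → ℝ) (hY : ∀ v, |y v| ≤ Y v)
    (hm : ∀ v s c, Y (Function.update v s c) ≤ Y (Function.update v s none)),
    EE (fun s c => if s ∈ B then (if c = x0 s then 1 else 0) else pr C (q s) c) (fun x => (Lin C q y x) ^ 2)
      ≤ 9 ^ (#B) * ∑ v, Y v ^ 2 * Wt q v := by
  induction B using Finset.induction_on with
  | empty =>
    intro y Y hY hm
    simp only [notMem_empty, if_false, card_empty, pow_zero, one_mul]
    refine (sieve_upper C q hq h y).trans (sum_le_sum fun v _ => ?_)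
    refine mul_le_mul_of_nonneg_right (sq_le_sq' (by linarith [neg_abs_le (y v), hY v]) (by linarith [le_abs_self (y v), hY v])) ?_
    exact prod_nonneg fun s _ => by split_ifs <;> simp [hq s]
  | insert b B hb ih =>
    intro y Y hY hm
    set y' : (ι → Option α) → ℝ := fun v => if v b = none then ∑ c, y (Function.update v b c) * ee C (q b) c (x0 b) else 0
      with hy'
    have e1 : ∀ x : ι → Option α, x b = x0 b → Lin C q y x = Lin C q y' x := by
      intro x hx
      rw [Lin, sum_split b, Lin]
      refine sum_congr rfl fun v _ => ?_
      simp only [hy']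
      split_ifs with hv
      · rw [Finset.sum_mul]
        refine sum_congr rfl fun c _ => ?_
        rw [← Finset.mul_prod_erase univ _ (mem_univ b), ← Finset.mul_prod_erase univ (fun s => ee C (q s) (v s) (x s)) (mem_univ b)]
        rw [Function.update_self, hx, hv]
        have : ∏ s ∈ univ.erase b, ee C (q s) (Function.update v b c s) (x s) = ∏ s ∈ univ.erase b, ee C (q s) (v s) (x s) :=
          prod_congr rfl fun s hs => by rw [Function.update_of_ne (ne_of_mem_erase hs)]
        rw [this]
        simp [ee]; ring
      · simp
    have e2 : EE (fun s c => if s ∈ insert b B then (if c = x0 s then 1 else 0) else pr C (q s) c) (fun x => (Lin C q y x) ^ 2)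
       = EE (fun s c => if s ∈ insert b B then (if c = x0 s then 1 else 0) else pr C (q s) c) (fun x => (Lin C q y' x) ^ 2) := by
      refine sum_congr rfl fun x _ => ?_
      by_cases hx : x b = x0 b
      · simp only [e1 x hx]
      · rw [prod_eq_zero (mem_univ b) (by simp [hx])]; simp
    have e3 : EE (fun s c => if s ∈ insert b B then (if c = x0 s then 1 else 0) else pr C (q s) c) (fun x => (Lin C q y' x) ^ 2)
      = EE (fun s c => if s ∈ B then (if c = x0 s then 1 else 0) else pr C (q s) c) (fun x => (Lin C q y' x) ^ 2) := by
      rw [EE_lin_sq, EE_lin_sq]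
      refine sum_congr rfl fun v _ => sum_congr rfl fun v' _ => ?_
      by_cases hv : v b = none
      · by_cases hv' : v' b = none
        · congr 1
          refine prod_congr rfl fun s _ => ?_
          by_cases hs : s = b
          · subst hs
            have := sum_pr C (q s)
            simp only [hv, hv', ee, hb, mul_one, mem_insert_self, if_true, if_false, this]
            simp
          · simp [hs]
        · simp [hy', hv']
      · simp [hy', hv]
    rw [e2, e3]
    have := ih y' (fun v => 3 * Y v) ?_ ?_
    · rw [card_insert_of_notMem hb]
      refine this.trans (le_of_eq ?_)
      simp only [mul_pow, mul_assoc, ← Finset.mul_sum]; ring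
    · intro v
      have hYv : 0 ≤ Y v := (abs_nonneg _).trans (hY v)
      simp only [hy']
      split_ifs with hv
      · refine (Finset.abs_sum_le_sum_abs _ _).trans ?_
        have h2 : ∀ c ∈ (univ : Finset (Option α)), |y (Function.update v b c) * ee C (q b) c (x0 b)| ≤ Y v * |ee C (q b) c (x0 b)| := by
          intro c _
          rw [abs_mul]
          refine mul_le_mul_of_nonneg_right ((hY _).trans ((hm v b c).trans (le_of_eq ?_))) (abs_nonneg _)
          rw [← hv]; simp
        refine (sum_le_sum h2).trans ?_
        rw [← Finset.mul_sum]
        nlinarith [sum_abs_ee C (hq b) (h b) (x0 b)]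
      · simp; exact hYv
    · intro v s c
      have := hm v s c
      show 3 * _ ≤ 3 * _; linarith

/-- (J) -/
lemma joint_bound (C C' : Finset α) (q : ι → ℝ) (hq : ∀ s, 0 ≤ q s) (h : ∀ s, #C * q s ≤ 1) (h' : ∀ s, #C' * q s ≤ 1)
    (y Y y' Y' : (ι → Option α) → ℝ) (hY : ∀ v, |y v| ≤ Y v) (hY' : ∀ v, |y' v| ≤ Y' v)
    (hm : ∀ v s c, Y (Function.update v s c) ≤ Y (Function.update v s none))
    (hm' : ∀ v s c, Y' (Function.update v s c) ≤ Y' (Function.update v s none))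
    (J ρ : ι → Option α → Option α → ℝ) (r : ι → ℝ) (hJ : ∀ s a b, 0 ≤ J s a b) (hρ : ∀ s a b, 0 ≤ ρ s a b)
    (hJρ : ∀ s a b, J s a b ≤ pr C (q s) a * pr C' (q s) b + ρ s a b)
    (hr : ∀ s, ∑ a, ∑ b, ρ s a b ≤ r s) :
    ∑ x, ∑ x', (∏ s, J s (x s) (x' s)) * (Lin C q y x ^ 2 * Lin C' q y' x' ^ 2) ≤
     EE (fun s => pr C (q s)) (fun x => (Lin C q y x) ^ 2) * EE (fun s => pr C' (q s)) (fun x => (Lin C' q y' x) ^ 2)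
     + (∑ v, Y v ^ 2 * Wt q v) * (∑ v, Y' v ^ 2 * Wt q v) * (∏ s, (1 + 81 * r s) - 1) := by
  set M := ∑ v, Y v ^ 2 * Wt q v
  set M' := ∑ v, Y' v ^ 2 * Wt q v
  have hW : ∀ v : ι → Option α, 0 ≤ Wt q v := fun v => prod_nonneg fun s _ => by split_ifs <;> simp [hq s]
  have hM : 0 ≤ M := sum_nonneg fun v _ => mul_nonneg (sq_nonneg _) (hW v)
  have hM' : 0 ≤ M' := sum_nonneg fun v _ => mul_nonneg (sq_nonneg _) (hW v)
  set f := fun x => Lin C q y x ^ 2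
  set f' := fun x => Lin C' q y' x ^ 2
  -- term for a set B
  let T : Finset ι → ℝ := fun B => ∑ x, ∑ x', (∏ s, if s ∈ B then ρ s (x s) (x' s) else pr C (q s) (x s) * pr C' (q s) (x' s))
      * (f x * f' x')
  have h1 : ∑ x, ∑ x', (∏ s, J s (x s) (x' s)) * (f x * f' x') ≤ ∑ B ∈ (univ : Finset ι).powerset, T B := by
    simp only [T]
    rw [Finset.sum_comm (s := (univ : Finset ι).powerset)]
    refine sum_le_sum fun x _ => ?_
    rw [Finset.sum_comm (s := (univ : Finset ι).powerset)]
    refine sum_le_sum fun x' _ => ?_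
    rw [← Finset.sum_mul]
    refine mul_le_mul_of_nonneg_right ?_ (mul_nonneg (sq_nonneg _) (sq_nonneg _))
    refine (prod_le_prod (fun s _ => hJ s _ _) fun s _ => hJρ s _ _).trans (le_of_eq ?_)
    simp_rw [add_comm (pr _ _ _ * _)]
    rw [prod_add]
    refine sum_congr rfl fun t _ => ?_
    rw [← Finset.prod_sdiff (subset_univ t), mul_comm]
    congr 1
    · refine prod_congr rfl fun s hs => ?_
      rw [if_neg (by simpa using hs)]
    · refine prod_congr rfl fun s hs => ?_
      rw [if_pos hs]
  have h0 : T ∅ = EE (fun s => pr C (q s)) f * EE (fun s => pr C' (q s)) f' := by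
    simp only [T, EE, Finset.sum_mul_sum]
    refine sum_congr rfl fun x _ => sum_congr rfl fun x' _ => ?_
    simp [prod_mul_distrib]; ring
  have hB : ∀ B, T B ≤ M * M' * ∏ s ∈ B, (81 * r s) := by
    intro B
    let lam : ι → (Option α × Option α) → ℝ := fun s z => if s ∈ B then ρ s z.1 z.2 else (if z = (none, none) then 1 else 0)
    have hlam : ∀ s z, 0 ≤ lam s z := fun s z => by
      simp only [lam]; split_ifs <;> simp [hρ]
    let tau : (ι → Option α) → ι → Option α → ℝ := fun x0 s c => if s ∈ B then (if c = x0 s then 1 else 0) else pr C (q s) c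
    let tau' : (ι → Option α) → ι → Option α → ℝ := fun x0 s c => if s ∈ B then (if c = x0 s then 1 else 0) else pr C' (q s) c
    have e : T B = ∑ z : ι → Option α × Option α, (∏ s, lam s (z s)) * (EE (tau fun s => (z s).1) f * EE (tau' fun s => (z s).2) f') := by
      have : ∀ x x' : ι → Option α, (∏ s, if s ∈ B then ρ s (x s) (x' s) else pr C (q s) (x s) * pr C' (q s) (x' s)) =
         ∑ z : ι → Option α × Option α, ∏ s, (lam s (z s) * (tau (fun s => (z s).1) s (x s) * tau' (fun s => (z s).2) s (x' s))) := by
        intro x x'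
        have := sum_prod_pi (fun s (z : Option α × Option α) => lam s z * ((if s ∈ B then (if x s = z.1 then 1 else 0) else pr C (q s) (x s)) *
          (if s ∈ B then (if x' s = z.2 then 1 else 0) else pr C' (q s) (x' s))))
        refine Eq.trans ?_ this.symm
        refine prod_congr rfl fun s _ => ?_
        by_cases hs : s ∈ B
        · simp only [lam, hs, if_true]
          rw [Finset.sum_eq_single (x s, x' s)]
          · simp
          · rintro ⟨a, b⟩ _ hab
            by_cases h1 : x s = a
            · by_cases h2 : x' s = b
              · exact absurd (by rw [h1, h2]) hab
              · simp [h2]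
            · simp [h1]
          · simp
        · simp [lam, hs]
      have h5 : ∀ z : ι → Option α × Option α, (∏ s, lam s (z s)) * (EE (tau fun s => (z s).1) f * EE (tau' fun s => (z s).2) f')
        = ∑ x, ∑ x', (∏ s, (lam s (z s) * (tau (fun s => (z s).1) s (x s) * tau' (fun s => (z s).2) s (x' s)))) * (f x * f' x') := by
        intro z
        rw [EE, EE, Finset.sum_mul_sum, Finset.mul_sum]
        refine sum_congr rfl fun x _ => ?_
        rw [Finset.mul_sum]
        refine sum_congr rfl fun x' _ => ?_
        rw [prod_mul_distrib, prod_mul_distrib]; ring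
      simp only [T, h5]
      rw [Finset.sum_comm (s := (univ : Finset (ι → Option α × Option α)))]
      refine sum_congr rfl fun x _ => ?_
      rw [Finset.sum_comm (s := (univ : Finset (ι → Option α × Option α)))]
      refine sum_congr rfl fun x' _ => ?_
      rw [this, Finset.sum_mul]
    rw [e]
    have h2 : ∀ z : ι → Option α × Option α, (∏ s, lam s (z s)) * (EE (tau fun s => (z s).1) f * EE (tau' fun s => (z s).2) f')
       ≤ (∏ s, lam s (z s)) * ((9 ^ #B * M) * (9 ^ #B * M')) := by
      intro z
      refine mul_le_mul_of_nonneg_left ?_ (prod_nonneg fun s _ => hlam s _)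
      refine mul_le_mul (forced_bound C q hq h _ B y Y hY hm) (forced_bound C' q hq h' _ B y' Y' hY' hm') ?_ (by positivity)
      refine sum_nonneg fun x _ => mul_nonneg (prod_nonneg fun s _ => ?_) (sq_nonneg _)
      simp only [tau']; split_ifs
      · simp
      · simp
      · exact pr_nonneg _ (hq s) (h' s) _
    refine (sum_le_sum fun z _ => h2 z).trans ?_
    rw [← Finset.sum_mul, sum_prod_pi lam]
    have h3 : ∏ s, ∑ c, lam s c ≤ ∏ s ∈ B, r s := by
      rw [← Finset.prod_sdiff (subset_univ B), Finset.prod_eq_one (s := univ \ B), one_mul]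
      · refine prod_le_prod (fun s _ => sum_nonneg fun c _ => hlam s c) fun s hs => ?_
        simp only [lam, hs, if_true]
        rw [Fintype.sum_prod_type]
        exact hr s
      · intro s hs
        simp at hs
        simp [lam, hs]
    calc _ ≤ (∏ s ∈ B, r s) * (9 ^ #B * M * (9 ^ #B * M')) := mul_le_mul_of_nonneg_right h3 (by positivity)
      _ = _ := by
        rw [prod_mul_distrib, prod_const]
        have : (81:ℝ) ^ #B = 9 ^ #B * 9 ^ #B := by rw [← mul_pow]; norm_num
        rw [this]; ring
  refine h1.trans ?_
  have hp : ∏ s, (1 + 81 * r s) = ∑ B ∈ (univ : Finset ι).powerset, ∏ s ∈ B, (81 * r s) := by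
    simp_rw [add_comm (1:ℝ)]
    rw [prod_add]; simp
  rw [hp, ← Finset.add_sum_erase _ _ (empty_mem_powerset univ), ← Finset.add_sum_erase _ (fun B => ∏ s ∈ B, (81 * r s)) (empty_mem_powerset univ), h0]
  simp only [prod_empty, add_sub_cancel_left]
  rw [Finset.mul_sum]
  exact add_le_add le_rfl (sum_le_sum fun B _ => hB B)
end AbsSieve2

section Interval

lemma sum_periodic (D : ℕ) (hD : 0 < D) (P : ℕ → ℝ) (hP : ∀ m, P (m + D) = P m) (h1 : ∀ m, |P m| ≤ 1) (N : ℕ) :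
    |∑ m ∈ range N, P m - N * ((∑ m ∈ range D, P m) / D)| ≤ 2 * D := by
  have hP' : ∀ a m, P (a * D + m) = P m := by
    intro a; induction a with
    | zero => simp
    | succ a ih => intro m; rw [← ih m, ← hP (a * D + m)]; congr 1; ring
  have hmul : ∀ a, ∑ m ∈ range (a * D), P m = a * ∑ m ∈ range D, P m := by
    intro a; induction a with
    | zero => simp
    | succ a ih =>
      rw [add_mul, one_mul, sum_range_add, ih]
      simp only [hP']; push_cast; ring
  have hD' : (0:ℝ) < D := by exact_mod_cast hD
  have hN : N = (N / D) * D + N % D := by rw [mul_comm]; exact (Nat.div_add_mod N D).symm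
  have hbd : ∀ k, |∑ m ∈ range k, P m| ≤ k := fun k =>
    (abs_sum_le_sum_abs _ _).trans ((sum_le_sum fun m _ => h1 m).trans (by simp))
  set a := N / D
  set r := N % D
  have hr : r < D := Nat.mod_lt _ hD
  have hr' : (r:ℝ) ≤ D := by exact_mod_cast hr.le
  rw [hN, sum_range_add, hmul]
  simp only [hP']
  have e : (a:ℝ) * ∑ m ∈ range D, P m + ∑ m ∈ range r, P m - ((a * D + r : ℕ):ℝ) * ((∑ m ∈ range D, P m) / D) =
     ∑ m ∈ range r, P m - r * ((∑ m ∈ range D, P m) / D) := by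
    push_cast; field_simp; ring
  rw [e]
  have h2 : |(∑ m ∈ range D, P m) / D| ≤ 1 := by
    rw [abs_div, abs_of_pos hD', div_le_one hD']; exact hbd D
  calc _ ≤ |∑ m ∈ range r, P m| + |(r:ℝ) * ((∑ m ∈ range D, P m) / D)| := abs_sub _ _
    _ ≤ r + r * 1 := by
      refine add_le_add (hbd r) ?_
      rw [abs_mul, Nat.abs_cast]
      exact mul_le_mul_of_nonneg_left h2 (Nat.cast_nonneg _)
    _ ≤ _ := by linarith

lemma sum_range_zmod (D : ℕ) [NeZero D] (F : ZMod D → ℝ) : ∑ m ∈ range D, F (m : ZMod D) = ∑ r : ZMod D, F r := by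
  refine Finset.sum_nbij' (fun m => (m : ZMod D)) (fun r => r.val) ?_ ?_ ?_ ?_ ?_
  · simp
  · intro r _; simpa using ZMod.val_lt r
  · intro m hm; simp at hm; exact ZMod.val_cast_of_lt hm
  · intro r _; simp
  · simp

variable {ι β : Type} [Fintype ι] [DecidableEq ι] [Fintype β] [DecidableEq β]

noncomputable def avg (n : ℕ) [NeZero n] (F : ZMod n → ℝ) : ℝ := (∑ r, F r) / n

lemma avg_affine (n : ℕ) [NeZero n] (F : ZMod n → ℝ) (b W : ℤ) (hW : IsUnit (W : ZMod n)) :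
    avg n (fun r => F (b + W * r)) = avg n F := by
  unfold avg
  congr 1
  obtain ⟨u, hu⟩ := hW
  rw [← hu]
  exact Fintype.sum_equiv ((Units.mulLeft u).trans (Equiv.addLeft (b : ZMod n))) _ _ (fun r => by simp)

lemma sum_range_prod (sd : ι → ℕ) [∀ s, NeZero (sd s)] (hco : Pairwise (Function.onFun Nat.Coprime sd))
    (F : ∀ s, ZMod (sd s) → ℝ) (hF : ∀ s r, |F s r| ≤ 1) (N : ℕ) :
    |∑ m ∈ range N, ∏ s, F s (m : ZMod (sd s)) - N * ∏ s, avg (sd s) (F s)| ≤ 2 * ∏ s, (sd s : ℝ) := by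
  have hpos : 0 < ∏ s, sd s := prod_pos fun s _ => Nat.pos_of_ne_zero (NeZero.ne _)
  have hne : NeZero (∏ s, sd s) := ⟨hpos.ne'⟩
  have := sum_periodic (∏ s, sd s) hpos (fun m => ∏ s, F s (m : ZMod (sd s))) ?_ ?_ N
  · have e : (∑ m ∈ range (∏ s, sd s), ∏ s, F s (m : ZMod (sd s))) / ((∏ s, sd s : ℕ) : ℝ) = ∏ s, avg (sd s) (F s) := by
      unfold avg
      rw [prod_div_distrib]
      push_cast
      congr 1
      have h1 : ∀ m : ℕ, ∏ s, F s (m : ZMod (sd s)) = ∏ s, F s (ZMod.prodEquivPi sd hco (m : ZMod (∏ s, sd s)) s) := by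
        intro m; refine prod_congr rfl fun s _ => ?_
        congr 1; simp
      simp only [h1]
      rw [sum_range_zmod (∏ s, sd s) (fun r => ∏ s, F s (ZMod.prodEquivPi sd hco r s)), Finset.prod_univ_sum]
      simp only [Fintype.piFinset_univ]
      exact Fintype.sum_equiv (ZMod.prodEquivPi sd hco).toEquiv _ _ (fun r => rfl)
    rw [← e]
    simpa using this
  · intro m
    refine prod_congr rfl fun s _ => ?_
    congr 1
    push_cast
    have : ((sd s : ℕ) : ZMod (sd s)) = 0 := ZMod.natCast_self _
    rw [Finset.prod_eq_zero (mem_univ s) this]; simp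
  · intro m
    rw [abs_prod]
    exact prod_le_one (fun s _ => abs_nonneg _) fun s _ => hF s _

lemma sum_range_prod' (sd : ι → ℕ) [∀ s, NeZero (sd s)] (hco : Pairwise (Function.onFun Nat.Coprime sd))
    (F : ∀ s, ZMod (sd s) → ℝ) (hF : ∀ s r, |F s r| ≤ 1) (T : Finset ι) (hT : ∀ s, s ∉ T → ∀ r, F s r = 1)
    (b W : ℤ) (hW : ∀ s, IsUnit (W : ZMod (sd s))) (N : ℕ) :
    |∑ m ∈ range N, ∏ s, F s ((b + W * (m:ℤ) : ℤ) : ZMod (sd s)) - N * ∏ s, avg (sd s) (F s)| ≤ 2 * ∏ s ∈ T, (sd s : ℝ) := by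
  have := sum_range_prod (ι := T) (fun s => sd s) (fun s t hst => hco (fun h => hst (Subtype.ext h)))
    (fun s r => F s (b + W * r)) (fun s r => hF s _) N
  rw [Finset.prod_coe_sort T (fun s => (sd s : ℝ))] at this
  have e1 : ∑ m ∈ range N, ∏ s, F s ((b + W * (m:ℤ) : ℤ) : ZMod (sd s)) = ∑ m ∈ range N, ∏ s : T, F s (b + W * (m : ZMod (sd s))) := by
    refine sum_congr rfl fun m _ => ?_
    rw [Finset.prod_coe_sort T (fun s => F s (b + W * (m : ZMod (sd s))))]
    rw [← Finset.prod_subset (subset_univ T)]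
    · refine prod_congr rfl fun s _ => ?_
      push_cast; rfl
    · intro s _ hs; exact hT s hs _
  have e2 : ∏ s, avg (sd s) (F s) = ∏ s : T, avg (sd s) (fun r => F s (b + W * r)) := by
    rw [Finset.prod_coe_sort T (fun s => avg (sd s) (fun r => F s (b + W * r)))]
    rw [← Finset.prod_subset (subset_univ T)]
    · refine prod_congr rfl fun s _ => ?_
      rw [avg_affine _ _ _ _ (hW s)]
    · intro s _ hs
      have : (sd s : ℝ) ≠ 0 := by exact_mod_cast NeZero.ne (sd s)
      simp [avg, hT s hs, this]
  rw [e1, e2]; exact this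

/-- density of the pattern value -/
noncomputable def pden (n : ℕ) [NeZero n] (X : ZMod n → β) (c : β) : ℝ := (#{r | X r = c} : ℝ) / n

lemma avg_pattern (n : ℕ) [NeZero n] (X : ZMod n → β) (φ : β → ℝ) : avg n (fun r => φ (X r)) = ∑ c, pden n X c * φ c := by
  unfold avg pden
  rw [← Finset.sum_fiberwise univ X (fun r => φ (X r)), Finset.sum_div]
  refine sum_congr rfl fun c _ => ?_
  rw [Finset.sum_congr rfl (g := fun _ => φ c) (by intro r hr; simp at hr; rw [hr])]
  simp; ring

lemma interval_pattern {Ω : Type} [Fintype Ω] (sd : ι → ℕ) [∀ s, NeZero (sd s)] (hco : Pairwise (Function.onFun Nat.Coprime sd))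
    (X : ∀ s, ZMod (sd s) → β) (c : Ω → ℝ) (φ : Ω → ι → β → ℝ) (hφ : ∀ u s b, |φ u s b| ≤ 1) (T : Ω → Finset ι)
    (hT : ∀ u s, s ∉ T u → ∀ b, φ u s b = 1) (g : (ι → β) → ℝ) (hg : ∀ x, g x = ∑ u, c u * ∏ s, φ u s (x s))
    (b W : ℤ) (hW : ∀ s, IsUnit (W : ZMod (sd s))) (N : ℕ) :
    |∑ m ∈ range N, g (fun s => X s ((b + W * (m:ℤ) : ℤ) : ZMod (sd s))) - N * EE (fun s => pden (sd s) (X s)) g|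
      ≤ 2 * ∑ u, |c u| * ∏ s ∈ T u, (sd s : ℝ) := by
  have e1 : ∑ m ∈ range N, g (fun s => X s ((b + W * (m:ℤ) : ℤ) : ZMod (sd s))) =
     ∑ u, c u * ∑ m ∈ range N, ∏ s, φ u s (X s ((b + W * (m:ℤ) : ℤ) : ZMod (sd s))) := by
    simp only [hg, Finset.mul_sum]; rw [Finset.sum_comm]
  have e2 : EE (fun s => pden (sd s) (X s)) g = ∑ u, c u * ∏ s, avg (sd s) (fun r => φ u s (X s r)) := by
    simp only [avg_pattern, ← EE_prod]
    unfold EE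
    simp only [hg, Finset.mul_sum]
    rw [Finset.sum_comm]
    exact sum_congr rfl fun u _ => sum_congr rfl fun x _ => by ring
  rw [e1, e2, Finset.mul_sum, ← sum_sub_distrib, Finset.mul_sum]
  refine (abs_sum_le_sum_abs _ _).trans (sum_le_sum fun u _ => ?_)
  have := sum_range_prod' sd hco (fun s r => φ u s (X s r)) (fun s r => hφ u s _) (T u) (fun s hs r => hT u s hs _) b W hW N
  have e3 : c u * ∑ m ∈ range N, ∏ s, φ u s (X s ((b + W * (m:ℤ) : ℤ) : ZMod (sd s))) -
     N * (c u * ∏ s, avg (sd s) (fun r => φ u s (X s r))) = c u * (∑ m ∈ range N, ∏ s, φ u s (X s ((b + W * (m:ℤ) : ℤ) : ZMod (sd s))) -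
     N * ∏ s, avg (sd s) (fun r => φ u s (X s r))) := by ring
  rw [e3, abs_mul]
  calc _ ≤ |c u| * (2 * ∏ s ∈ T u, (sd s : ℝ)) := mul_le_mul_of_nonneg_left this (abs_nonneg _)
    _ = _ := by ring
end Interval

section IntLin
variable {ι α : Type} [Fintype ι] [DecidableEq ι] [Fintype α] [DecidableEq α]

/-- modulus of a colouring -/
noncomputable def DD (sd : ι → ℕ) (v : ι → Option α) : ℝ := ∏ s, if v s = none then 1 else (sd s : ℝ)

noncomputable def S1 (sd : ι → ℕ) (y : (ι → Option α) → ℝ) : ℝ := ∑ v, |y v| * DD sd v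

lemma abs_ee_le (C : Finset α) {q : ℝ} (hq : 0 ≤ q) (hq1 : q ≤ 1) (a x : Option α) : |ee C q a x| ≤ 1 := by
  cases a with
  | none => simp [ee]
  | some h =>
    simp only [ee]; split_ifs
    · rw [abs_le]; constructor <;> linarith
    · simp [abs_of_nonneg hq, hq1]
    · simp

lemma DD_filter (sd : ι → ℕ) (v : ι → Option α) : DD sd v = ∏ s ∈ univ.filter (fun s => v s ≠ none), (sd s : ℝ) := by
  rw [DD, Finset.prod_filter]; refine prod_congr rfl fun s _ => ?_
  by_cases h : v s = none <;> simp [h]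

lemma DD_pos (sd : ι → ℕ) [∀ s, NeZero (sd s)] (v : ι → Option α) : 1 ≤ DD sd v := by
  unfold DD
  refine Finset.prod_induction _ (fun t : ℝ => 1 ≤ t) (fun a b ha hb => one_le_mul_of_one_le_of_one_le ha hb) le_rfl fun s _ => ?_
  split_ifs
  · simp
  · exact_mod_cast Nat.pos_of_ne_zero (NeZero.ne _)

lemma prod_union_le (sd : ι → ℕ) [∀ s, NeZero (sd s)] (A B : Finset ι) : ∏ s ∈ A ∪ B, (sd s : ℝ) ≤ (∏ s ∈ A, (sd s : ℝ)) * ∏ s ∈ B, (sd s : ℝ) := by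
  rw [← Finset.prod_union_inter]
  have h0 : (0:ℝ) ≤ ∏ s ∈ A ∪ B, (sd s : ℝ) := prod_nonneg fun s _ => Nat.cast_nonneg _
  have : (1:ℝ) ≤ ∏ s ∈ A ∩ B, (sd s : ℝ) := Finset.prod_induction _ (fun t : ℝ => 1 ≤ t) (fun a b ha hb => one_le_mul_of_one_le_of_one_le ha hb) le_rfl fun s _ => by exact_mod_cast Nat.pos_of_ne_zero (NeZero.ne (sd s))
  nlinarith

lemma interval_single (sd : ι → ℕ) [∀ s, NeZero (sd s)] (hco : Pairwise (Function.onFun Nat.Coprime sd))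
    (X : ∀ s, ZMod (sd s) → Option α) (C : Finset α) (y : (ι → Option α) → ℝ)
    (b W : ℤ) (hW : ∀ s, IsUnit (W : ZMod (sd s))) (N : ℕ) :
    |∑ m ∈ range N, (Lin C (fun s => 1 / (sd s : ℝ)) y (fun s => X s ((b + W * (m:ℤ) : ℤ) : ZMod (sd s)))) ^ 2
      - N * EE (fun s => pden (sd s) (X s)) (fun x => (Lin C (fun s => 1 / (sd s : ℝ)) y x) ^ 2)|
      ≤ 2 * S1 sd y ^ 2 := by
  have hq : ∀ s, (0:ℝ) ≤ 1 / (sd s : ℝ) ∧ 1 / (sd s : ℝ) ≤ 1 := fun s => by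
    have : (1:ℝ) ≤ sd s := by exact_mod_cast Nat.pos_of_ne_zero (NeZero.ne (sd s))
    exact ⟨by positivity, by rw [div_le_one (by linarith)]; exact this⟩
  refine (interval_pattern (Ω := (ι → Option α) × (ι → Option α)) sd hco X (fun u => y u.1 * y u.2)
    (fun u s x => ee C (1 / (sd s : ℝ)) (u.1 s) x * ee C (1 / (sd s : ℝ)) (u.2 s) x) ?_
    (fun u => univ.filter (fun s => u.1 s ≠ none) ∪ univ.filter (fun s => u.2 s ≠ none)) ?_
    (fun x => (Lin C (fun s => 1 / (sd s : ℝ)) y x) ^ 2) ?_ b W hW N).trans ?_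
  · intro u s x
    rw [abs_mul]
    exact mul_le_one₀ (abs_ee_le C (hq s).1 (hq s).2 _ _) (abs_nonneg _) (abs_ee_le C (hq s).1 (hq s).2 _ _)
  · intro u s hs x
    simp at hs
    simp [hs.1, hs.2, ee]
  · intro x
    rw [Lin, sq, Finset.sum_mul_sum, Fintype.sum_prod_type]
    refine sum_congr rfl fun v _ => sum_congr rfl fun v' _ => ?_
    simp only [prod_mul_distrib]; ring
  · refine mul_le_mul_of_nonneg_left ?_ (by norm_num)
    rw [S1, sq, Finset.sum_mul_sum, Fintype.sum_prod_type]
    refine sum_le_sum fun v _ => sum_le_sum fun v' _ => ?_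
    simp only [abs_mul]
    have := prod_union_le sd (univ.filter (fun s => v s ≠ none)) (univ.filter (fun s => v' s ≠ none))
    rw [← DD_filter, ← DD_filter] at this
    nlinarith [mul_le_mul_of_nonneg_left this (mul_nonneg (abs_nonneg (y v)) (abs_nonneg (y v')))]

lemma interval_double (sd : ι → ℕ) [∀ s, NeZero (sd s)] (hco : Pairwise (Function.onFun Nat.Coprime sd))
    (X X' : ∀ s, ZMod (sd s) → Option α) (C C' : Finset α) (y y' : (ι → Option α) → ℝ)
    (b W : ℤ) (hW : ∀ s, IsUnit (W : ZMod (sd s))) (N : ℕ) :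
    |∑ m ∈ range N, ((Lin C (fun s => 1 / (sd s : ℝ)) y (fun s => X s ((b + W * (m:ℤ) : ℤ) : ZMod (sd s)))) ^ 2 *
      (Lin C' (fun s => 1 / (sd s : ℝ)) y' (fun s => X' s ((b + W * (m:ℤ) : ℤ) : ZMod (sd s)))) ^ 2)
      - N * ∑ x, ∑ x', (∏ s, pden (sd s) (fun r => (X s r, X' s r)) (x s, x' s)) *
         ((Lin C (fun s => 1 / (sd s : ℝ)) y x) ^ 2 * (Lin C' (fun s => 1 / (sd s : ℝ)) y' x') ^ 2)|
      ≤ 2 * (S1 sd y ^ 2 * S1 sd y' ^ 2) := by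
  have hq : ∀ s, (0:ℝ) ≤ 1 / (sd s : ℝ) ∧ 1 / (sd s : ℝ) ≤ 1 := fun s => by
    have : (1:ℝ) ≤ sd s := by exact_mod_cast Nat.pos_of_ne_zero (NeZero.ne (sd s))
    exact ⟨by positivity, by rw [div_le_one (by linarith)]; exact this⟩
  set q : ι → ℝ := fun s => 1 / (sd s : ℝ)
  have key := interval_pattern (β := Option α × Option α) (Ω := ((ι → Option α) × (ι → Option α)) × ((ι → Option α) × (ι → Option α)))
    sd hco (fun s r => (X s r, X' s r)) (fun u => (y u.1.1 * y u.1.2) * (y' u.2.1 * y' u.2.2))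
    (fun u s x => (ee C (q s) (u.1.1 s) x.1 * ee C (q s) (u.1.2 s) x.1) * (ee C' (q s) (u.2.1 s) x.2 * ee C' (q s) (u.2.2 s) x.2)) ?_
    (fun u => (univ.filter (fun s => u.1.1 s ≠ none) ∪ univ.filter (fun s => u.1.2 s ≠ none)) ∪
      (univ.filter (fun s => u.2.1 s ≠ none) ∪ univ.filter (fun s => u.2.2 s ≠ none))) ?_
    (fun x => (Lin C q y (fun s => (x s).1)) ^ 2 * (Lin C' q y' (fun s => (x s).2)) ^ 2) ?_ b W hW N
  · have e : EE (fun s => pden (sd s) (fun r => (X s r, X' s r))) (fun x => (Lin C q y (fun s => (x s).1)) ^ 2 * (Lin C' q y' (fun s => (x s).2)) ^ 2)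
       = ∑ x, ∑ x', (∏ s, pden (sd s) (fun r => (X s r, X' s r)) (x s, x' s)) *
         ((Lin C q y x) ^ 2 * (Lin C' q y' x') ^ 2) := by
      rw [EE, ← Fintype.sum_prod_type']
      exact Fintype.sum_equiv (Equiv.arrowProdEquivProdArrow ι (fun _ => Option α) (fun _ => Option α)) _ _ (fun x => rfl)
    rw [e] at key
    refine key.trans ?_
    refine mul_le_mul_of_nonneg_left ?_ (by norm_num)
    have e2 : S1 sd y ^ 2 * S1 sd y' ^ 2 = ∑ u : ((ι → Option α) × (ι → Option α)) × ((ι → Option α) × (ι → Option α)),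
       (|y u.1.1| * DD sd u.1.1 * (|y u.1.2| * DD sd u.1.2)) * (|y' u.2.1| * DD sd u.2.1 * (|y' u.2.2| * DD sd u.2.2)) := by
      rw [Fintype.sum_prod_type]
      simp only [← Finset.mul_sum, ← Finset.sum_mul]
      rw [S1, S1, sq, sq, Finset.sum_mul_sum, Finset.sum_mul_sum, Fintype.sum_prod_type, Fintype.sum_prod_type]
    rw [e2]
    refine sum_le_sum fun u _ => ?_
    simp only [abs_mul]
    have h1 := prod_union_le sd (univ.filter (fun s => u.1.1 s ≠ none)) (univ.filter (fun s => u.1.2 s ≠ none))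
    have h2 := prod_union_le sd (univ.filter (fun s => u.2.1 s ≠ none)) (univ.filter (fun s => u.2.2 s ≠ none))
    have h3 := prod_union_le sd (univ.filter (fun s => u.1.1 s ≠ none) ∪ univ.filter (fun s => u.1.2 s ≠ none))
      (univ.filter (fun s => u.2.1 s ≠ none) ∪ univ.filter (fun s => u.2.2 s ≠ none))
    rw [← DD_filter, ← DD_filter] at h1 h2
    have h4 := h3.trans (mul_le_mul h1 h2 (prod_nonneg fun s _ => Nat.cast_nonneg _)
      (mul_nonneg (zero_le_one.trans (DD_pos _ _)) (zero_le_one.trans (DD_pos _ _))))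
    refine (mul_le_mul_of_nonneg_left h4 (by positivity)).trans (le_of_eq ?_)
    ring
  · intro u s x
    have h := fun a b => abs_ee_le C (hq s).1 (hq s).2 a b
    have h' := fun a b => abs_ee_le C' (hq s).1 (hq s).2 a b
    rw [abs_mul, abs_mul, abs_mul]
    exact mul_le_one₀ (mul_le_one₀ (h _ _) (abs_nonneg _) (h _ _)) (by positivity) (mul_le_one₀ (h' _ _) (abs_nonneg _) (h' _ _))
  · intro u s hs x
    simp at hs
    simp [hs.1, hs.2.1, hs.2.2.1, hs.2.2.2, ee]
  · intro x
    simp only [prod_mul_distrib]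
    rw [Fintype.sum_prod_type]
    have e : ∀ a b : (ι → Option α) × (ι → Option α), (y a.1 * y a.2) * (y' b.1 * y' b.2) * (((∏ s, ee C (q s) (a.1 s) (x s).1) * ∏ s, ee C (q s) (a.2 s) (x s).1) *
      ((∏ s, ee C' (q s) (b.1 s) (x s).2) * ∏ s, ee C' (q s) (b.2 s) (x s).2)) =
      ((y a.1 * ∏ s, ee C (q s) (a.1 s) (x s).1) * (y a.2 * ∏ s, ee C (q s) (a.2 s) (x s).1)) *
      ((y' b.1 * ∏ s, ee C' (q s) (b.1 s) (x s).2) * (y' b.2 * ∏ s, ee C' (q s) (b.2 s) (x s).2)) := fun a b => by ring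
    simp only [e, ← Finset.mul_sum, ← Finset.sum_mul]
    rw [Fintype.sum_prod_type, Fintype.sum_prod_type]
    simp only [← Finset.mul_sum, ← Finset.sum_mul, Lin, sq]
end IntLin

/-- sieve data -/
structure SV (ι : Type) [Fintype ι] where
  sd : ι → ℕ
  g : ℝ → ℝ
  R : ℝ
  kap : ℕ
  kk : ℝ
  prime : ∀ s, (sd s).Prime
  inj : Function.Injective sd
  g_nonneg : ∀ r, 0 ≤ g r
  g_anti : Antitone g
  g_one : g 1 = 1
  g_big : ∀ r, 1 ≤ r → R < r ^ 2 → g r = 0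
  hR : 1 ≤ R
  kap_lt : ∀ s, kap < sd s
  few : ∀ Z : Finset ι, ∏ s ∈ Z, (sd s : ℝ) ≤ R ^ kap → ∑ s ∈ Z, 1 / (sd s : ℝ) ≤ 1 / 2
  few2 : ∀ Z : Finset ι, ∏ s ∈ Z, (sd s : ℝ) ≤ R → 1 / 2 ≤ ∏ s ∈ Z, (1 - kk * (1 / (sd s : ℝ)))
  kk_le : ∀ s, kk * (1 / (sd s : ℝ)) ≤ 1

section GStep
variable {ι α : Type} [Fintype ι] [DecidableEq ι] [Fintype α] [DecidableEq α] (V : SV ι)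

instance (s : ι) : NeZero (V.sd s) := ⟨(V.prime s).ne_zero⟩

namespace SV

noncomputable def q (s : ι) : ℝ := 1 / (V.sd s : ℝ)
lemma q_nonneg (s : ι) : 0 ≤ V.q s := by unfold q; positivity
noncomputable def pE (E : Finset ι) : ℝ := ∏ s ∈ E, (V.sd s : ℝ)
noncomputable def qE (E : Finset ι) : ℝ := ∏ s ∈ E, V.q s
noncomputable def dd (h : α) (v : ι → Option α) : ℝ := ∏ s, if v s = some h then (V.sd s : ℝ) else 1
def col (A : Finset α) (v : ι → Option α) : Prop := ∀ s a, v s = some a → a ∈ A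
def fill (h : α) (E : Finset ι) (v : ι → Option α) : ι → Option α := fun s => if s ∈ E then some h else v s
def nn (v : ι → Option α) : Finset ι := univ.filter (fun s => v s = none)
open Classical in
noncomputable def yy (A : Finset α) (v : ι → Option α) : ℝ :=
  if col A v ∧ DD V.sd v ≤ V.R then ∏ h, V.g (V.dd h v) else 0
noncomputable def ww (v : ι → Option α) : ℝ := (∏ h, V.g (V.dd h v)) ^ 2 * Wt V.q v
open Classical in
noncomputable def NN (A : Finset α) : ℝ := ∑ v : ι → Option α, if col A v then V.ww v else 0
open Classical in
noncomputable def YY (i : α) (C : Finset α) (v : ι → Option α) : ℝ :=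
  if col C v then ∑ E ∈ (nn v).powerset, V.qE E * V.yy (insert i C) (fill i E v) else 0
noncomputable def GG : ℝ := ∑ E : Finset ι, V.g (V.pE E) * V.qE E
noncomputable def I0 : ℝ := ∑ E : Finset ι, V.g (V.pE E) ^ 2 * V.qE E
noncomputable def L1 : ℝ := ∑ E : Finset ι, V.g (V.pE E) ^ 2 * Real.log (V.pE E) * V.qE E

lemma sd_one (s : ι) : (1:ℝ) ≤ V.sd s := by exact_mod_cast (V.prime s).one_le
lemma one_le_pE (E : Finset ι) : 1 ≤ V.pE E :=
  Finset.prod_induction _ (fun t : ℝ => 1 ≤ t) (fun a b ha hb => one_le_mul_of_one_le_of_one_le ha hb) le_rfl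
    fun s _ => V.sd_one s
lemma one_le_dd (h : α) (v : ι → Option α) : 1 ≤ V.dd h v :=
  Finset.prod_induction _ (fun t : ℝ => 1 ≤ t) (fun a b ha hb => one_le_mul_of_one_le_of_one_le ha hb) le_rfl
    fun s _ => by split_ifs; exacts [V.sd_one s, le_rfl]
lemma qE_nonneg (E : Finset ι) : 0 ≤ V.qE E := prod_nonneg fun s _ => V.q_nonneg s
lemma Wt_nonneg (v : ι → Option α) : 0 ≤ Wt V.q v := prod_nonneg fun s _ => by split_ifs <;> simp [V.q_nonneg s]
lemma ww_nonneg (v : ι → Option α) : 0 ≤ V.ww v := mul_nonneg (sq_nonneg _) (V.Wt_nonneg v)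
lemma gprod_nonneg (v : ι → Option α) : 0 ≤ ∏ h, V.g (V.dd h v) := prod_nonneg fun _ _ => V.g_nonneg _

/-- (B) -/
lemma sum_fill (h : α) (A : Finset α) (hA : h ∉ A) (Ψ : (ι → Option α) → ℝ) [DecidablePred (col A (ι := ι))]
    [DecidablePred (col (insert h A) (ι := ι))] :
    ∑ v : ι → Option α, (if col (insert h A) v then Ψ v else 0) =
      ∑ v : ι → Option α, (if col A v then ∑ E ∈ (nn v).powerset, Ψ (fill h E v) else 0) := by
  rw [← Finset.sum_filter, ← Finset.sum_filter, Finset.sum_sigma']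
  refine Finset.sum_bij' (fun v _ => ⟨fun s => if v s = some h then none else v s, univ.filter fun s => v s = some h⟩)
    (fun z _ => fill h z.2 z.1) ?_ ?_ ?_ ?_ ?_
  · intro v hv
    simp only [mem_filter, mem_univ, true_and] at hv
    simp only [mem_sigma, mem_filter, mem_univ, true_and, mem_powerset]
    refine ⟨fun s a hs => ?_, fun s hs => ?_⟩
    · by_cases h1 : v s = some h
      · simp [h1] at hs
      · simp [h1] at hs
        have := hv s a hs
        rcases mem_insert.1 this with rfl | h2
        · exact absurd hs h1
        · exact h2
    · simp at hs; simp [nn, hs]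
  · rintro ⟨v, E⟩ hz
    simp only [mem_sigma, mem_filter, mem_univ, true_and, mem_powerset] at hz ⊢
    intro s a hs
    by_cases h1 : s ∈ E
    · simp [fill, h1] at hs; simp [hs]
    · simp [fill, h1] at hs; exact mem_insert_of_mem (hz.1 s a hs)
  · intro v hv
    funext s
    by_cases h1 : v s = some h <;> simp [fill, h1]
  · rintro ⟨v, E⟩ hz
    simp only [mem_sigma, mem_filter, mem_univ, true_and, mem_powerset] at hz
    have h1 : ∀ s, fill h E v s = some h ↔ s ∈ E := by
      intro s
      by_cases h1 : s ∈ E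
      · simp [fill, h1]
      · simp [fill, h1]; intro h2; exact hA (hz.1 s h h2)
    have e1 : (fun s => if fill h E v s = some h then none else fill h E v s) = v := by
      funext s
      simp only [h1]
      by_cases h2 : s ∈ E
      · have := hz.2 h2; simp [nn] at this; simp [h2, this]
      · simp [h2, fill]
    have e2 : (univ.filter fun s => fill h E v s = some h) = E := by ext s; simp [h1]
    simp only [e1, e2]
  · intro v hv
    congr 1
    funext s
    by_cases h1 : v s = some h <;> simp [fill, h1]

section fillprops
variable {V} {h : α} {A : Finset α} {v : ι → Option α} {E : Finset ι}

lemma dd_fill_self (hA : h ∉ A) (hv : col A v) : V.dd h (fill h E v) = V.pE E := by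
  unfold dd pE
  rw [← Finset.prod_filter]
  congr 1
  ext s
  by_cases h1 : s ∈ E
  · simp [fill, h1]
  · simp [fill, h1]; intro h2; exact hA (hv s h h2)

lemma dd_fill_ne {h' : α} (hne : h' ≠ h) (hE : E ⊆ nn v) : V.dd h' (fill h E v) = V.dd h' v := by
  unfold dd
  refine prod_congr rfl fun s _ => ?_
  by_cases h1 : s ∈ E
  · have := hE h1; simp [nn] at this; simp [fill, h1, this, hne.symm]
  · simp [fill, h1]

lemma dd_col (hA : h ∉ A) (hv : col A v) : V.dd h v = 1 := by
  unfold dd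
  refine prod_eq_one fun s _ => ?_
  rw [if_neg]; intro h2; exact hA (hv s h h2)

lemma Wt_fill (hE : E ⊆ nn v) : Wt V.q (fill h E v) = Wt V.q v * V.qE E := by
  unfold Wt qE
  rw [← Finset.prod_filter_mul_prod_filter_not univ (fun s => s ∈ E) (fun s => if fill h E v s = none then 1 else V.q s),
    ← Finset.prod_filter_mul_prod_filter_not univ (fun s => s ∈ E) (fun s => if v s = none then 1 else V.q s)]
  have e1 : ∏ s ∈ univ.filter (fun s => s ∈ E), (if v s = none then 1 else V.q s) = 1 :=
    prod_eq_one fun s hs => by have := hE (mem_filter.1 hs).2; simp [nn] at this; simp [this]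
  have e2 : ∏ s ∈ univ.filter (fun s => s ∈ E), (if fill h E v s = none then 1 else V.q s) = ∏ s ∈ E, V.q s := by
    rw [show univ.filter (fun s => s ∈ E) = E by ext; simp]
    exact prod_congr rfl fun s hs => by simp [fill, hs]
  have e3 : ∏ s ∈ univ.filter (fun s => s ∉ E), (if fill h E v s = none then 1 else V.q s) =
     ∏ s ∈ univ.filter (fun s => s ∉ E), (if v s = none then 1 else V.q s) :=
    prod_congr rfl fun s hs => by simp [fill, (mem_filter.1 hs).2]
  rw [e1, e2, e3]; ring

lemma DD_fill (hE : E ⊆ nn v) : DD V.sd (fill h E v) = DD V.sd v * V.pE E := by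
  unfold DD pE
  rw [← Finset.prod_filter_mul_prod_filter_not univ (fun s => s ∈ E) (fun s => if fill h E v s = none then 1 else (V.sd s : ℝ)),
    ← Finset.prod_filter_mul_prod_filter_not univ (fun s => s ∈ E) (fun s => if v s = none then 1 else (V.sd s : ℝ))]
  have e1 : ∏ s ∈ univ.filter (fun s => s ∈ E), (if v s = none then 1 else (V.sd s : ℝ)) = 1 :=
    prod_eq_one fun s hs => by have := hE (mem_filter.1 hs).2; simp [nn] at this; simp [this]
  have e2 : ∏ s ∈ univ.filter (fun s => s ∈ E), (if fill h E v s = none then 1 else (V.sd s : ℝ)) = ∏ s ∈ E, (V.sd s : ℝ) := by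
    rw [show univ.filter (fun s => s ∈ E) = E by ext; simp]
    exact prod_congr rfl fun s hs => by simp [fill, hs]
  have e3 : ∏ s ∈ univ.filter (fun s => s ∉ E), (if fill h E v s = none then 1 else (V.sd s : ℝ)) =
     ∏ s ∈ univ.filter (fun s => s ∉ E), (if v s = none then 1 else (V.sd s : ℝ)) :=
    prod_congr rfl fun s hs => by simp [fill, (mem_filter.1 hs).2]
  rw [e1, e2, e3]; ring

lemma gprod_fill (hA : h ∉ A) (hv : col A v) (hE : E ⊆ nn v) :
    ∏ h', V.g (V.dd h' (fill h E v)) = (∏ h', V.g (V.dd h' v)) * V.g (V.pE E) := by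
  rw [← Finset.mul_prod_erase univ _ (mem_univ h), ← Finset.mul_prod_erase univ (fun h' => V.g (V.dd h' v)) (mem_univ h),
    dd_fill_self hA hv, dd_col hA hv, V.g_one, one_mul, mul_comm]
  congr 1
  exact prod_congr rfl fun h' hh => by rw [dd_fill_ne (ne_of_mem_erase hh) hE]

lemma ww_fill (hA : h ∉ A) (hv : col A v) (hE : E ⊆ nn v) :
    V.ww (fill h E v) = V.ww v * (V.g (V.pE E) ^ 2 * V.qE E) := by
  rw [ww, gprod_fill hA hv hE, Wt_fill hE, ww]; ring

lemma col_fill (hv : col A v) : col (insert h A) (fill h E v) := by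
  intro s a hs
  by_cases h1 : s ∈ E
  · simp [fill, h1] at hs; simp [hs]
  · simp [fill, h1] at hs; exact mem_insert_of_mem (hv s a hs)
end fillprops

/-- removing a few primes costs little -/
lemma restr_lower (f : ℝ → ℝ) (hf : ∀ r, 0 ≤ f r) (hanti : Antitone f) (Z : Finset ι) (hZ : ∑ s ∈ Z, V.q s ≤ 1 / 2) :
    1 / 2 * ∑ E : Finset ι, f (V.pE E) * V.qE E ≤ ∑ E ∈ (univ \ Z).powerset, f (V.pE E) * V.qE E := by
  set T := ∑ E : Finset ι, f (V.pE E) * V.qE E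
  have hnn : ∀ E, 0 ≤ f (V.pE E) * V.qE E := fun E => mul_nonneg (hf _) (V.qE_nonneg E)
  have h1 : ∀ s, ∑ E ∈ univ.filter (fun E : Finset ι => s ∈ E), f (V.pE E) * V.qE E ≤ V.q s * T := by
    intro s
    have h2 : ∀ E ∈ univ.filter (fun E : Finset ι => s ∈ E), f (V.pE E) * V.qE E ≤
        V.q s * (f (V.pE (E.erase s)) * V.qE (E.erase s)) := by
      intro E hE
      have hs : s ∈ E := by simpa using hE
      have e1 : V.qE E = V.q s * V.qE (E.erase s) := (Finset.mul_prod_erase E _ hs).symm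
      have e2 : V.pE E = V.sd s * V.pE (E.erase s) := (Finset.mul_prod_erase E _ hs).symm
      have h3 : f (V.pE E) ≤ f (V.pE (E.erase s)) := hanti (by rw [e2]; nlinarith [V.sd_one s, V.one_le_pE (E.erase s)])
      rw [e1]
      calc _ ≤ f (V.pE (E.erase s)) * (V.q s * V.qE (E.erase s)) :=
            mul_le_mul_of_nonneg_right h3 (mul_nonneg (V.q_nonneg s) (V.qE_nonneg _))
        _ = _ := by ring
    refine (sum_le_sum h2).trans ?_
    rw [← Finset.mul_sum]
    refine mul_le_mul_of_nonneg_left ?_ (V.q_nonneg s)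
    rw [← Finset.sum_image (f := fun E => f (V.pE E) * V.qE E) (g := fun E : Finset ι => E.erase s)]
    · exact sum_le_sum_of_subset_of_nonneg (subset_univ _) fun E _ _ => hnn E
    · intro E hE E' hE' h
      simp at hE hE'
      have h : E.erase s = E'.erase s := h
      rw [← insert_erase hE, ← insert_erase hE', h]
  have h2 : T ≤ ∑ E ∈ (univ \ Z).powerset, f (V.pE E) * V.qE E + ∑ s ∈ Z, ∑ E ∈ univ.filter (fun E : Finset ι => s ∈ E), f (V.pE E) * V.qE E := by
    have e1 : ∑ E ∈ (univ \ Z).powerset, f (V.pE E) * V.qE E = ∑ E : Finset ι, if E ∈ (univ \ Z).powerset then f (V.pE E) * V.qE E else 0 := by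
      rw [← Finset.sum_filter]; congr 1; ext; simp
    simp_rw [Finset.sum_filter]
    rw [e1, Finset.sum_comm, ← Finset.sum_add_distrib]
    refine sum_le_sum fun E _ => ?_
    have h6 : ∀ s ∈ Z, 0 ≤ (if s ∈ E then f (V.pE E) * V.qE E else 0) := fun s _ => by split_ifs; exacts [hnn E, le_rfl]
    by_cases h5 : E ⊆ univ \ Z
    · rw [if_pos (mem_powerset.2 h5)]; linarith [sum_nonneg h6]
    · rw [if_neg (by rwa [mem_powerset])]
      rw [not_subset] at h5
      obtain ⟨s, hs, hs'⟩ := h5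
      have := single_le_sum h6 (show s ∈ Z by simpa using hs')
      rw [if_pos hs] at this; linarith
  have h3 : ∑ s ∈ Z, ∑ E ∈ univ.filter (fun E : Finset ι => s ∈ E), f (V.pE E) * V.qE E ≤ (∑ s ∈ Z, V.q s) * T := by
    rw [Finset.sum_mul]; exact sum_le_sum fun s _ => h1 s
  have hT : 0 ≤ T := sum_nonneg fun E _ => hnn E
  nlinarith [mul_le_mul_of_nonneg_right hZ hT]
end SV
end GStep

section GStep2
variable {ι α : Type} [Fintype ι] [DecidableEq ι] [Fintype α] [DecidableEq α] (V : SV ι)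
namespace SV

lemma DD_eq (v : ι → Option α) : DD V.sd v = ∏ h, V.dd h v := by
  unfold DD dd
  rw [Finset.prod_comm]
  refine prod_congr rfl fun s _ => ?_
  cases hv : v s with
  | none => simp
  | some a => simp

lemma dd_sq_le {v : ι → Option α} (hv : ∏ h, V.g (V.dd h v) ≠ 0) (h : α) : V.dd h v ^ 2 ≤ V.R := by
  by_contra hc
  push Not at hc
  exact (Finset.prod_ne_zero_iff.1 hv h (mem_univ h)) (V.g_big _ (V.one_le_dd h v) hc)

lemma fewZ (hκ : Fintype.card α ≤ V.kap) {v : ι → Option α} (hv : ∏ h, V.g (V.dd h v) ≠ 0) :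
    ∑ s ∈ univ.filter (fun s => v s ≠ none), V.q s ≤ 1 / 2 := by
  refine V.few _ ?_
  rw [← DD_filter, V.DD_eq]
  calc ∏ h, V.dd h v ≤ ∏ h : α, V.R := prod_le_prod (fun h _ => by linarith [V.one_le_dd h v])
        fun h _ => by nlinarith [V.one_le_dd h v, V.dd_sq_le hv h]
    _ = V.R ^ Fintype.card α := by simp
    _ ≤ V.R ^ V.kap := pow_le_pow_right₀ V.hR hκ

lemma nn_eq (v : ι → Option α) : univ \ univ.filter (fun s => v s ≠ none) = nn v := by
  ext s; simp [nn]

lemma restr_nn (hκ : Fintype.card α ≤ V.kap) {v : ι → Option α} (hv : ∏ h, V.g (V.dd h v) ≠ 0)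
    (f : ℝ → ℝ) (hf : ∀ r, 0 ≤ f r) (hanti : Antitone f) :
    1 / 2 * ∑ E : Finset ι, f (V.pE E) * V.qE E ≤ ∑ E ∈ (nn v).powerset, f (V.pE E) * V.qE E := by
  rw [← nn_eq]; exact V.restr_lower f hf hanti _ (V.fewZ hκ hv)

lemma gsq_anti : Antitone (fun r => V.g r ^ 2) := fun a b hab =>
  pow_le_pow_left₀ (V.g_nonneg b) (V.g_anti hab) 2

lemma I0_one : 1 ≤ V.I0 := by
  have := single_le_sum (f := fun E : Finset ι => V.g (V.pE E) ^ 2 * V.qE E)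
    (fun E _ => mul_nonneg (sq_nonneg _) (V.qE_nonneg E)) (mem_univ ∅)
  simpa [I0, GG, pE, qE, V.g_one] using this

lemma GG_one : 1 ≤ V.GG := by
  have := single_le_sum (f := fun E : Finset ι => V.g (V.pE E) * V.qE E)
    (fun E _ => mul_nonneg (V.g_nonneg _) (V.qE_nonneg E)) (mem_univ ∅)
  simpa [I0, GG, pE, qE, V.g_one] using this

lemma L1_nonneg : 0 ≤ V.L1 := sum_nonneg fun E _ =>
  mul_nonneg (mul_nonneg (sq_nonneg _) (Real.log_nonneg (V.one_le_pE E))) (V.qE_nonneg E)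

lemma NN_nonneg (A : Finset α) : 0 ≤ V.NN A := sum_nonneg fun v _ => by split_ifs; exacts [V.ww_nonneg v, le_rfl]

lemma NN_one (A : Finset α) : 1 ≤ V.NN A := by
  classical
  have := single_le_sum (f := fun v : ι → Option α => if col A v then V.ww v else 0)
    (fun v _ => by split_ifs; exacts [V.ww_nonneg v, le_rfl]) (mem_univ (fun _ => none))
  have h1 : col A (fun _ : ι => (none : Option α)) := fun s a h => by simp at h
  simp only [h1, if_true] at this
  have h2 : V.ww (fun _ : ι => (none : Option α)) = 1 := by simp [ww, Wt, dd, V.g_one]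
  rw [h2] at this; exact this

lemma NN_insert_le (h : α) (A : Finset α) (hA : h ∉ A) : V.NN (insert h A) ≤ V.I0 * V.NN A := by
  classical
  rw [NN, sum_fill h A hA, NN, mul_sum]
  refine sum_le_sum fun v _ => ?_
  split_ifs with hv
  · rw [sum_congr rfl fun E hE => ww_fill hA hv (mem_powerset.1 hE), ← mul_sum, mul_comm]
    refine mul_le_mul_of_nonneg_right ?_ (V.ww_nonneg v)
    exact sum_le_sum_of_subset_of_nonneg (subset_univ _) fun E _ _ => mul_nonneg (sq_nonneg _) (V.qE_nonneg E)
  · simp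

lemma NN_insert_ge (hκ : Fintype.card α ≤ V.kap) (h : α) (A : Finset α) (hA : h ∉ A) :
    1 / 2 * V.I0 * V.NN A ≤ V.NN (insert h A) := by
  classical
  conv_rhs => rw [NN, sum_fill h A hA]
  rw [NN, mul_sum]
  refine sum_le_sum fun v _ => ?_
  split_ifs with hv
  · rw [sum_congr rfl fun E hE => ww_fill hA hv (mem_powerset.1 hE), ← mul_sum, mul_comm]
    by_cases h0 : ∏ h, V.g (V.dd h v) = 0
    · simp [ww, h0]
    refine mul_le_mul_of_nonneg_left ?_ (V.ww_nonneg v)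
    exact V.restr_nn hκ h0 (fun r => V.g r ^ 2) (fun r => sq_nonneg _) V.gsq_anti
  · simp

open Classical in
lemma log_one (hκ : Fintype.card α ≤ V.kap) (h : α) (A : Finset α) (hA : h ∈ A) :
    V.I0 * ∑ v : ι → Option α, (if col A v then V.ww v * Real.log (V.dd h v) else 0) ≤ 2 * V.L1 * V.NN A := by
  obtain ⟨B, hB, rfl⟩ : ∃ B, h ∉ B ∧ A = insert h B := ⟨A.erase h, by simp, (insert_erase hA).symm⟩
  have h1 : ∑ v : ι → Option α, (if col (insert h B) v then V.ww v * Real.log (V.dd h v) else 0) ≤ V.L1 * V.NN B := by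
    rw [sum_fill h B hB, NN, mul_sum]
    refine sum_le_sum fun v _ => ?_
    split_ifs with hv
    · rw [sum_congr rfl fun E hE => show V.ww (fill h E v) * Real.log (V.dd h (fill h E v)) =
          V.ww v * (V.g (V.pE E) ^ 2 * Real.log (V.pE E) * V.qE E) by
          rw [ww_fill hB hv (mem_powerset.1 hE), dd_fill_self hB hv]; ring, ← mul_sum, mul_comm]
      refine mul_le_mul_of_nonneg_right ?_ (V.ww_nonneg v)
      exact sum_le_sum_of_subset_of_nonneg (subset_univ _) fun E _ _ =>
        mul_nonneg (mul_nonneg (sq_nonneg _) (Real.log_nonneg (V.one_le_pE E))) (V.qE_nonneg E)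
    · simp
  have h2 := V.NN_insert_ge hκ h B hB
  have h3 := V.I0_one
  calc _ ≤ V.I0 * (V.L1 * V.NN B) := mul_le_mul_of_nonneg_left h1 (by linarith)
    _ = 2 * V.L1 * (1 / 2 * V.I0 * V.NN B) := by ring
    _ ≤ _ := mul_le_mul_of_nonneg_left h2 (by linarith [V.L1_nonneg])

open Classical in
/-- Markov -/
lemma markov (hκ : Fintype.card α ≤ V.kap) (A : Finset α) (hA : #A * (2 * V.L1) ≤ Real.log V.R / 4 * V.I0) (hR1 : 1 < V.R) :
    1 / 2 * V.NN A ≤ ∑ v : ι → Option α, (if col A v ∧ DD V.sd v ^ 2 ≤ V.R then V.ww v else 0) := by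
  have hl : 0 < Real.log V.R := Real.log_pos hR1
  have h1 : V.I0 * ∑ v : ι → Option α, (if col A v then V.ww v * Real.log (DD V.sd v) else 0) ≤
      Real.log V.R / 4 * V.I0 * V.NN A := by
    have e : ∀ v : ι → Option α, (if col A v then V.ww v * Real.log (DD V.sd v) else 0) =
        ∑ h ∈ A, (if col A v then V.ww v * Real.log (V.dd h v) else 0) := by
      intro v
      by_cases hv : col A v
      · simp only [hv, if_true]
        rw [V.DD_eq, Real.log_prod (fun h _ => by linarith [V.one_le_dd h v]), ← mul_sum]
        congr 1
        symm
        refine sum_subset (subset_univ _) fun h _ hh => ?_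
        rw [dd_col hh hv, Real.log_one]
      · simp [hv]
    rw [sum_congr rfl fun v _ => e v, sum_comm, mul_sum]
    refine (sum_le_sum fun h hh => V.log_one hκ h A hh).trans ?_
    rw [sum_const, nsmul_eq_mul]
    calc _ = #A * (2 * V.L1) * V.NN A := by ring
      _ ≤ _ := mul_le_mul_of_nonneg_right hA (V.NN_nonneg A)
  have h2 : ∑ v : ι → Option α, (if col A v then V.ww v * Real.log (DD V.sd v) else 0) ≤ Real.log V.R / 4 * V.NN A := by
    have := V.I0_one
    refine le_of_mul_le_mul_left (h1.trans (le_of_eq (by ring))) (show 0 < V.I0 by linarith)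
  have h3 : Real.log V.R / 2 * (V.NN A - ∑ v : ι → Option α, (if col A v ∧ DD V.sd v ^ 2 ≤ V.R then V.ww v else 0)) ≤
      ∑ v : ι → Option α, (if col A v then V.ww v * Real.log (DD V.sd v) else 0) := by
    rw [NN, ← sum_sub_distrib, mul_sum]
    refine sum_le_sum fun v _ => ?_
    have hw := V.ww_nonneg v
    by_cases hv : col A v
    · by_cases hd : DD V.sd v ^ 2 ≤ V.R
      · simp only [hv, hd, and_self, if_true, sub_self, mul_zero]
        exact mul_nonneg hw (Real.log_nonneg (DD_pos _ v))
      · simp only [hv, hd, and_false, if_true, if_false, sub_zero]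
        push Not at hd
        have := Real.log_lt_log (by linarith [V.hR]) hd
        rw [Real.log_pow] at this
        push_cast at this
        nlinarith
    · simp [hv]
  nlinarith

/-- sub-vector -/
def sub (v v' : ι → Option α) : Prop := ∀ s, v s = none ∨ v s = v' s

lemma dd_mono {v v' : ι → Option α} (h : sub v v') (a : α) : V.dd a v ≤ V.dd a v' := by
  unfold dd
  refine prod_le_prod (fun s _ => by split_ifs <;> simp) fun s _ => ?_
  rcases h s with h1 | h1
  · simp only [h1]; simp; split_ifs; exacts [V.sd_one s, le_rfl]
  · rw [h1]

lemma DD_mono {v v' : ι → Option α} (h : sub v v') : DD V.sd v ≤ DD V.sd v' := by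
  unfold DD
  refine prod_le_prod (fun s _ => by split_ifs <;> simp) fun s _ => ?_
  rcases h s with h1 | h1
  · simp only [h1, if_true]; split_ifs; exacts [le_rfl, V.sd_one s]
  · rw [h1]

lemma yy_nonneg (A : Finset α) (v : ι → Option α) : 0 ≤ V.yy A v := by
  unfold yy; split_ifs; exacts [V.gprod_nonneg v, le_rfl]

lemma yy_mono (A : Finset α) {v v' : ι → Option α} (h : sub v v') : V.yy A v' ≤ V.yy A v := by
  by_cases h1 : col A v' ∧ DD V.sd v' ≤ V.R
  · have h2 : col A v ∧ DD V.sd v ≤ V.R := ⟨fun s a hs => by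
      rcases h s with h3 | h3
      · rw [h3] at hs; simp at hs
      · exact h1.1 s a (h3 ▸ hs), (V.DD_mono h).trans h1.2⟩
    rw [yy, yy, if_pos h1, if_pos h2]
    exact prod_le_prod (fun _ _ => V.g_nonneg _) fun a _ => V.g_anti (V.dd_mono h a)
  · rw [yy, if_neg h1]; exact V.yy_nonneg A v

lemma YY_nonneg (i : α) (C : Finset α) (v : ι → Option α) : 0 ≤ V.YY i C v := by
  unfold YY; split_ifs
  · exact sum_nonneg fun E _ => mul_nonneg (V.qE_nonneg E) (V.yy_nonneg _ _)
  · exact le_rfl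

lemma YY_mono (i : α) (C : Finset α) {v v' : ι → Option α} (h : sub v v') : V.YY i C v' ≤ V.YY i C v := by
  by_cases h1 : col C v'
  · have h2 : col C v := fun s a hs => by
      rcases h s with h3 | h3
      · rw [h3] at hs; simp at hs
      · exact h1 s a (h3 ▸ hs)
    rw [YY, YY, if_pos h1, if_pos h2]
    have hn : nn v' ⊆ nn v := by
      intro s hs; simp [nn] at hs ⊢
      rcases h s with h3 | h3
      · exact h3
      · rw [h3, hs]
    refine (sum_le_sum fun E hE => ?_).trans (sum_le_sum_of_subset_of_nonneg (powerset_mono.2 hn)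
      fun E _ _ => mul_nonneg (V.qE_nonneg E) (V.yy_nonneg _ _))
    refine mul_le_mul_of_nonneg_left (V.yy_mono _ fun s => ?_) (V.qE_nonneg E)
    by_cases hs : s ∈ E
    · simp [fill, hs]
    · simpa [fill, hs] using h s
  · rw [YY, if_neg h1]; exact V.YY_nonneg i C v

lemma YY_update (i : α) (C : Finset α) (v : ι → Option α) (s : ι) (c : Option α) :
    V.YY i C (Function.update v s c) ≤ V.YY i C (Function.update v s none) := by
  refine V.YY_mono i C fun t => ?_
  by_cases h : t = s
  · subst h; simp
  · simp [h]

lemma YY_zero (i : α) (C : Finset α) (v : ι → Option α) (h : ¬ col C v) : V.YY i C v = 0 := by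
  rw [YY, if_neg h]

/-- forced avoidance of color `i` -/
lemma Lin_YY (i : α) (C : Finset α) (hi : i ∉ C) (x : ι → Option α) (hx : ∀ s, x s ≠ some i) :
    Lin (insert i C) V.q (V.yy (insert i C)) x = Lin C V.q (V.YY i C) x := by
  classical
  have e1 : Lin (insert i C) V.q (V.yy (insert i C)) x =
      ∑ v : ι → Option α, (if col (insert i C) v then V.yy (insert i C) v * ∏ s, ee (insert i C) (V.q s) (v s) (x s) else 0) := by
    refine sum_congr rfl fun v _ => ?_
    split_ifs with h
    · rfl
    · rw [yy, if_neg (fun h' => h h'.1), zero_mul]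
  rw [e1, sum_fill i C hi, Lin]
  refine sum_congr rfl fun v _ => ?_
  split_ifs with hv
  · rw [YY, if_pos hv, sum_mul]
    refine sum_congr rfl fun E hE => ?_
    have hE := mem_powerset.1 hE
    have : ∏ s, ee (insert i C) (V.q s) (fill i E v s) (x s) = V.qE E * ∏ s, ee C (V.q s) (v s) (x s) := by
      have h1 : V.qE E = ∏ s, if s ∈ E then V.q s else 1 := by
        rw [← prod_filter, qE]; congr 1; ext; simp
      rw [h1, ← prod_mul_distrib]
      refine prod_congr rfl fun s _ => ?_
      by_cases hs : s ∈ E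
      · have h2 : v s = none := by have := hE hs; simpa [nn] using this
        simp [fill, hs, h2, ee, hx s]
      · simp only [fill, hs, if_false, one_mul]
        cases h3 : v s with
        | none => simp [ee]
        | some a =>
          have h4 := hv s a h3
          simp [ee, h4]
    rw [this]; ring
  · rw [V.YY_zero i C v hv, zero_mul]

lemma YY_ge (hκ : Fintype.card α ≤ V.kap) (i : α) (C : Finset α) (hi : i ∉ C) (v : ι → Option α) (hv : col C v) (hd : DD V.sd v ^ 2 ≤ V.R) :
    (∏ h, V.g (V.dd h v)) * (1 / 2 * V.GG) ≤ V.YY i C v := by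
  by_cases h0 : ∏ h, V.g (V.dd h v) = 0
  · rw [h0, zero_mul]; exact V.YY_nonneg i C v
  rw [YY, if_pos hv]
  refine (mul_le_mul_of_nonneg_left (V.restr_nn hκ h0 V.g V.g_nonneg V.g_anti) (V.gprod_nonneg v)).trans ?_
  rw [mul_sum]
  refine sum_le_sum fun E hE => ?_
  have hE := mem_powerset.1 hE
  by_cases hp : V.R < V.pE E ^ 2
  · rw [V.g_big _ (V.one_le_pE E) hp]
    simp; exact mul_nonneg (V.qE_nonneg E) (V.yy_nonneg _ _)
  · have : DD V.sd (fill i E v) ≤ V.R := by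
      rw [DD_fill hE]
      have := DD_pos V.sd v
      have := V.one_le_pE E
      nlinarith [sq_nonneg (DD V.sd v - V.pE E)]
    rw [yy, if_pos ⟨col_fill hv, this⟩, gprod_fill hi hv hE]
    exact le_of_eq (by ring)

noncomputable def MY (i : α) (C : Finset α) : ℝ := ∑ v, V.YY i C v ^ 2 * Wt V.q v

lemma MY_nonneg (i : α) (C : Finset α) : 0 ≤ V.MY i C :=
  sum_nonneg fun v _ => mul_nonneg (sq_nonneg _) (V.Wt_nonneg v)

lemma MY_ge (hκ : Fintype.card α ≤ V.kap) (i : α) (C : Finset α) (hi : i ∉ C)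
    (hA : #C * (2 * V.L1) ≤ Real.log V.R / 4 * V.I0) (hR1 : 1 < V.R) :
    V.GG ^ 2 / (8 * V.I0) * V.NN (insert i C) ≤ V.MY i C := by
  classical
  have h1 := V.markov hκ C hA hR1
  have h2 : V.GG ^ 2 / 4 * ∑ v : ι → Option α, (if col C v ∧ DD V.sd v ^ 2 ≤ V.R then V.ww v else 0) ≤ V.MY i C := by
    rw [MY, mul_sum]
    refine sum_le_sum fun v _ => ?_
    split_ifs with h
    · have := pow_le_pow_left₀ (mul_nonneg (V.gprod_nonneg v) (by linarith [V.GG_one])) (V.YY_ge hκ i C hi v h.1 h.2) 2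
      calc _ = ((∏ h, V.g (V.dd h v)) * (1 / 2 * V.GG)) ^ 2 * Wt V.q v := by rw [ww]; ring
        _ ≤ _ := mul_le_mul_of_nonneg_right this (V.Wt_nonneg v)
    · rw [mul_zero]; exact mul_nonneg (sq_nonneg _) (V.Wt_nonneg v)
  have h3 := V.NN_insert_le i C hi
  have h4 := V.I0_one
  have h5 : V.GG ^ 2 / (8 * V.I0) * V.NN (insert i C) ≤ V.GG ^ 2 / (8 * V.I0) * (V.I0 * V.NN C) :=
    mul_le_mul_of_nonneg_left h3 (by positivity)
  have h6 : V.GG ^ 2 / (8 * V.I0) * (V.I0 * V.NN C) = V.GG ^ 2 / 4 * (1 / 2 * V.NN C) := by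
    field_simp; ring
  have h7 := mul_le_mul_of_nonneg_left h1 (show 0 ≤ V.GG ^ 2 / 4 by positivity)
  linarith

lemma YY_supp (i : α) (C : Finset α) (v : ι → Option α) (h : V.R < DD V.sd v) : V.YY i C v = 0 := by
  rw [YY]
  split_ifs with hv
  · refine sum_eq_zero fun E hE => ?_
    rw [yy, if_neg, mul_zero]
    rintro ⟨_, h2⟩
    rw [DD_fill (mem_powerset.1 hE)] at h2
    nlinarith [V.one_le_pE E, DD_pos V.sd v]
  · rfl

noncomputable def EY (i : α) (C : Finset α) : ℝ := EE (fun s => pr C (V.q s)) (fun x => (Lin C V.q (V.YY i C) x) ^ 2)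

lemma MY_le (i : α) (C : Finset α) (hk : (#C : ℝ) ≤ V.kk) : V.MY i C ≤ 2 * V.EY i C := by
  have h := sieve_lower C V.q V.q_nonneg V.kk hk V.kk_le (V.YY i C) (fun v ⟨s, a, h1, h2⟩ =>
    V.YY_zero i C v fun hc => h2 (hc s a h1))
  unfold EY
  refine le_trans ?_ (mul_le_mul_of_nonneg_left h (by norm_num : (0:ℝ) ≤ 2))
  rw [MY, mul_sum]
  refine sum_le_sum fun v _ => ?_
  by_cases hd : V.R < DD V.sd v
  · simp [V.YY_supp i C v hd]
  push Not at hd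
  rw [DD_filter] at hd
  have h2 := V.few2 _ hd
  have e : ∏ s, (if v s = none then 1 else V.q s * (1 - V.kk * V.q s)) =
      Wt V.q v * ∏ s ∈ univ.filter (fun s => v s ≠ none), (1 - V.kk * (1 / (V.sd s : ℝ))) := by
    rw [prod_filter, Wt, ← prod_mul_distrib]
    refine prod_congr rfl fun s _ => ?_
    by_cases hs : v s = none <;> simp [hs, q]
  rw [e]
  have h3 : 0 ≤ V.YY i C v ^ 2 * Wt V.q v := mul_nonneg (sq_nonneg _) (V.Wt_nonneg v)
  nlinarith

lemma EY_ge (hκ : Fintype.card α ≤ V.kap) (i : α) (C : Finset α) (hi : i ∉ C) (hk : (#C : ℝ) ≤ V.kk)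
    (hA : #C * (2 * V.L1) ≤ Real.log V.R / 4 * V.I0) (hR1 : 1 < V.R) :
    V.GG ^ 2 / (16 * V.I0) * V.NN (insert i C) ≤ V.EY i C := by
  have h1 := V.MY_ge hκ i C hi hA hR1
  have h2 := V.MY_le i C hk
  have : V.GG ^ 2 / (8 * V.I0) = 2 * (V.GG ^ 2 / (16 * V.I0)) := by
    have := V.I0_one
    field_simp; ring
  rw [this] at h1; linarith

lemma card_q_le (hκ : Fintype.card α ≤ V.kap) (C : Finset α) (s : ι) : #C * V.q s ≤ 1 := by
  have h1 : (#C : ℝ) ≤ V.sd s := by exact_mod_cast (card_le_univ C).trans (hκ.trans (V.kap_lt s).le)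
  rw [q, mul_one_div]; exact div_le_one_of_le₀ h1 (by positivity)

/-- total mass -/
lemma Eyy_le (hκ : Fintype.card α ≤ V.kap) (A : Finset α) :
    EE (fun s => pr A (V.q s)) (fun x => (Lin A V.q (V.yy A) x) ^ 2) ≤ V.NN A := by
  refine (sieve_upper A V.q V.q_nonneg (V.card_q_le hκ A) _).trans ?_
  rw [NN]
  refine sum_le_sum fun v _ => ?_
  unfold yy
  by_cases h : col A v
  · by_cases h2 : DD V.sd v ≤ V.R
    · simp [h, h2, ww]
    · simp [h, h2, V.ww_nonneg]
  · simp [h]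

lemma EY_le_MY (hκ : Fintype.card α ≤ V.kap) (i : α) (C : Finset α) : V.EY i C ≤ V.MY i C :=
  sieve_upper C V.q V.q_nonneg (V.card_q_le hκ C) _

lemma g_le_one {r : ℝ} (h : 1 ≤ r) : V.g r ≤ 1 := V.g_one ▸ V.g_anti h

lemma S1_yy (hκ : Fintype.card α ≤ V.kap) (h3 : ∏ s, (1 + V.kap * V.q s ^ 2) ≤ 3) (A : Finset α) : S1 V.sd (V.yy A) ≤ 3 * V.R ^ 3 := by
  have h1 : ∀ v : ι → Option α, |V.yy A v| * DD V.sd v ≤ V.R ^ 3 * ∏ s, (if v s = none then 1 else V.q s ^ 2) := by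
    intro v
    have e : ∏ s, (if v s = none then 1 else V.q s ^ 2) = (1 / DD V.sd v) ^ 2 := by
      rw [DD, one_div, ← prod_inv_distrib, ← prod_pow]
      refine prod_congr rfl fun s _ => ?_
      split_ifs <;> simp [q]
    rw [abs_of_nonneg (V.yy_nonneg A v), e]
    have hD := DD_pos V.sd v
    unfold yy
    split_ifs with h
    · have h4 : ∏ h, V.g (V.dd h v) ≤ 1 := prod_le_one (fun _ _ => V.g_nonneg _) fun a _ => V.g_le_one (V.one_le_dd a v)
      have h5 : (1:ℝ) ≤ V.R / DD V.sd v := by rw [le_div_iff₀ (by linarith)]; linarith [h.2]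
      calc _ ≤ 1 * DD V.sd v := mul_le_mul_of_nonneg_right h4 (by linarith)
        _ ≤ V.R * (V.R / DD V.sd v) ^ 2 := by
          have h6 : 1 ≤ (V.R / DD V.sd v) ^ 2 := one_le_pow₀ h5
          nlinarith [h.2, V.hR]
        _ = _ := by field_simp
    · rw [zero_mul]; have := V.hR; positivity
  refine (sum_le_sum fun v _ => h1 v).trans ?_
  rw [← mul_sum, sum_prod_pi (fun s c => if c = none then 1 else V.q s ^ 2), mul_comm]
  refine mul_le_mul_of_nonneg_right (le_trans (prod_le_prod (fun s _ => sum_nonneg fun c _ => by split_ifs <;> positivity) fun s _ => ?_) h3)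
    (by have := V.hR; positivity)
  rw [Fintype.sum_option]
  simp only [if_true, reduceCtorEq, if_false, sum_const, card_univ, nsmul_eq_mul]
  have : (Fintype.card α : ℝ) ≤ V.kap := by exact_mod_cast hκ
  nlinarith [sq_nonneg (V.q s)]

lemma S1_YY (hκ : Fintype.card α ≤ V.kap) (h3 : ∏ s, (1 + V.kap * V.q s ^ 2) ≤ 3) (i : α) (C : Finset α) (hi : i ∉ C) :
    S1 V.sd (V.YY i C) ≤ 3 * V.R ^ 3 := by
  classical
  refine le_trans ?_ (V.S1_yy hκ h3 (insert i C))
  have e1 : S1 V.sd (V.yy (insert i C)) =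
      ∑ v : ι → Option α, (if col (insert i C) v then |V.yy (insert i C) v| * DD V.sd v else 0) := by
    refine sum_congr rfl fun v _ => ?_
    split_ifs with h
    · rfl
    · rw [yy, if_neg (fun h' => h h'.1), abs_zero, zero_mul]
  rw [e1, sum_fill i C hi, S1]
  refine sum_le_sum fun v _ => ?_
  split_ifs with hv
  · rw [abs_of_nonneg (V.YY_nonneg i C v), YY, if_pos hv, sum_mul]
    refine sum_le_sum fun E hE => ?_
    rw [DD_fill (mem_powerset.1 hE), abs_of_nonneg (V.yy_nonneg _ _)]
    have h1 := V.one_le_pE E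
    have h2 : V.qE E ≤ 1 := prod_le_one (fun s _ => V.q_nonneg s) fun s _ => by
      rw [q]; exact div_le_one_of_le₀ (V.sd_one s) (by positivity)
    have h4 := V.yy_nonneg (insert i C) (fill i E v)
    have h5 := DD_pos V.sd v
    have h6 : V.qE E * V.yy (insert i C) (fill i E v) ≤ V.pE E * V.yy (insert i C) (fill i E v) :=
      mul_le_mul_of_nonneg_right (h2.trans h1) h4
    nlinarith
  · rw [V.YY_zero i C v hv]; simp

lemma Lin_abs_le (C : Finset α) (y : (ι → Option α) → ℝ) (x : ι → Option α) : |Lin C V.q y x| ≤ S1 V.sd y := by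
  unfold Lin S1
  refine (abs_sum_le_sum_abs _ _).trans (sum_le_sum fun v _ => ?_)
  rw [abs_mul, abs_prod]
  refine mul_le_mul_of_nonneg_left (le_trans (prod_le_one (fun _ _ => abs_nonneg _) fun s _ => abs_ee_le C (V.q_nonneg s) ?_ _ _) (DD_pos V.sd v)) (abs_nonneg _)
  rw [q]; exact div_le_one_of_le₀ (V.sd_one s) (by positivity)
end SV
end GStep2

section Cover
open Classical in
lemma cover_lemma {P N Q : Type} (N0 : Finset N) (hN : N0.Nonempty) (u : P → N → ℝ) (hu : ∀ p n, 0 ≤ u p n)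
    (hit : P → N → Q → Prop) (T : Finset Q) (good : Finset P) (hu1 : ∀ p ∈ good, ∑ n ∈ N0, u p n ≤ 1) :
    ∀ (θ : Q → ℝ), (∀ q, 0 ≤ θ q) → ∃ f : P → N, (∑ q ∈ T, if ∀ p ∈ good, ¬ hit p (f p) q then θ q else 0) ≤
      ∑ q ∈ T, θ q * ∏ p ∈ good, (1 - ∑ n ∈ N0, if hit p n q then u p n else 0) := by
  obtain ⟨n0, hn0⟩ := hN
  induction good using Finset.induction_on with
  | empty => intro θ hθ; exact ⟨fun _ => n0, by simp⟩
  | insert p0 s hp ih =>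
    intro θ hθ
    have hc0 : ∀ q, 0 ≤ 1 - ∑ n ∈ N0, (if hit p0 n q then u p0 n else 0) := fun q => by
      have : ∑ n ∈ N0, (if hit p0 n q then u p0 n else 0) ≤ ∑ n ∈ N0, u p0 n :=
        sum_le_sum fun n _ => by split_ifs; exacts [le_rfl, hu _ _]
      linarith [hu1 p0 (mem_insert_self _ _)]
    obtain ⟨f, hf⟩ := ih (fun p hp => hu1 p (mem_insert_of_mem hp))
      (fun q => θ q * (1 - ∑ n ∈ N0, if hit p0 n q then u p0 n else 0)) (fun q => mul_nonneg (hθ q) (hc0 q))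
    -- choose n for p0
    set τ : Q → ℝ := fun q => if ∀ p ∈ s, ¬ hit p (f p) q then θ q else 0 with hτ
    have hτ0 : ∀ q, 0 ≤ τ q := fun q => by simp only [hτ]; split_ifs; exacts [hθ q, le_rfl]
    have hex : ∃ n ∈ N0, ∑ q ∈ T, (if hit p0 n q then 0 else τ q) ≤ ∑ q ∈ T, τ q * (1 - ∑ n ∈ N0, if hit p0 n q then u p0 n else 0) := by
      by_contra hcon
      push Not at hcon
      set RHS := ∑ q ∈ T, τ q * (1 - ∑ n ∈ N0, if hit p0 n q then u p0 n else 0) with hRHS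
      set D := 1 - ∑ n ∈ N0, u p0 n with hD
      have hD0 : 0 ≤ D := by linarith [hu1 p0 (mem_insert_self _ _)]
      have h1 : ∑ n ∈ N0, u p0 n * ∑ q ∈ T, (if hit p0 n q then 0 else τ q) + D * ∑ q ∈ T, τ q = RHS := by
        have e : ∀ q, τ q * (1 - ∑ n ∈ N0, if hit p0 n q then u p0 n else 0) =
            ∑ n ∈ N0, u p0 n * (if hit p0 n q then 0 else τ q) + D * τ q := by
          intro q
          have e2 : ∑ n ∈ N0, u p0 n * (if hit p0 n q then 0 else τ q) = τ q * (∑ n ∈ N0, u p0 n - ∑ n ∈ N0, if hit p0 n q then u p0 n else 0) := by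
            rw [← sum_sub_distrib, mul_sum]
            refine sum_congr rfl fun n _ => ?_
            split_ifs <;> ring
          rw [e2, hD]; ring
        rw [hRHS, sum_congr rfl fun q _ => e q, sum_add_distrib, sum_comm, ← mul_sum]
        simp only [mul_sum]
      have h2 : ∑ q ∈ T, (if hit p0 n0 q then 0 else τ q) ≤ ∑ q ∈ T, τ q :=
        sum_le_sum fun q _ => by split_ifs; exacts [hτ0 q, le_rfl]
      have h3 := hcon n0 hn0
      -- strictness
      have h4 : ∑ n ∈ N0, u p0 n * RHS ≤ ∑ n ∈ N0, u p0 n * ∑ q ∈ T, (if hit p0 n q then 0 else τ q) :=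
        sum_le_sum fun n hn => mul_le_mul_of_nonneg_left (hcon n hn).le (hu _ _)
      by_cases hall : D = 0
      · have hs : ∃ n ∈ N0, 0 < u p0 n := by
          by_contra hh; push Not at hh
          have : ∑ n ∈ N0, u p0 n ≤ 0 := sum_nonpos hh
          linarith
        obtain ⟨n1, hn1, hpos⟩ := hs
        have : ∑ n ∈ N0, u p0 n * RHS < ∑ n ∈ N0, u p0 n * ∑ q ∈ T, (if hit p0 n q then 0 else τ q) :=
          sum_lt_sum (fun n hn => mul_le_mul_of_nonneg_left (hcon n hn).le (hu _ _))
            ⟨n1, hn1, mul_lt_mul_of_pos_left (hcon n1 hn1) hpos⟩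
        rw [← sum_mul] at this
        have h5 : ∑ n ∈ N0, u p0 n = 1 := by linarith
        rw [h5] at this; rw [hall] at h1; linarith
      · have hDp : 0 < D := lt_of_le_of_ne hD0 (Ne.symm hall)
        rw [← sum_mul] at h4
        have h5 : ∑ n ∈ N0, u p0 n = 1 - D := by linarith
        rw [h5] at h4
        nlinarith
    obtain ⟨n, hn, hle⟩ := hex
    refine ⟨Function.update f p0 n, ?_⟩
    refine le_trans (le_of_eq ?_) (hle.trans (le_trans (le_of_eq ?_) (hf.trans (le_of_eq ?_))))
    · refine sum_congr rfl fun q _ => ?_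
      have e1 : (∀ p ∈ insert p0 s, ¬ hit p (Function.update f p0 n p) q) ↔ (¬ hit p0 n q ∧ ∀ p ∈ s, ¬ hit p (f p) q) := by
        rw [Finset.forall_mem_insert]
        simp only [Function.update_self]
        refine and_congr Iff.rfl (forall₂_congr fun p hps => ?_)
        rw [Function.update_of_ne (by rintro rfl; exact hp hps)]
      simp only [e1, hτ]
      by_cases h1 : hit p0 n q <;> simp [h1]
    · refine sum_congr rfl fun q _ => ?_
      simp only [hτ]; split_ifs <;> simp
    · refine sum_congr rfl fun q _ => ?_
      rw [prod_insert hp]; ring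
end Cover

section Ea
variable {ι : Type} [Fintype ι] [DecidableEq ι] (sd : ι → ℕ) [∀ s, NeZero (sd s)]

noncomputable def Ea (f : (∀ s, ZMod (sd s)) → ℝ) : ℝ := (∑ a, f a) / ∏ s, (sd s : ℝ)

open Classical in
noncomputable def ind (U : Finset ℤ) (a : ∀ s, ZMod (sd s)) : ℝ := if ∀ s, ∀ u ∈ U, (u : ZMod (sd s)) ≠ a s then 1 else 0

noncomputable def sig (j : ℕ) : ℝ := ∏ s, (1 - j / (sd s : ℝ))

lemma prodsd_pos : 0 < ∏ s, (sd s : ℝ) := prod_pos fun s _ => by exact_mod_cast Nat.pos_of_ne_zero (NeZero.ne _)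

lemma Ea_mono {f g : (∀ s, ZMod (sd s)) → ℝ} (h : ∀ a, f a ≤ g a) : Ea sd f ≤ Ea sd g :=
  div_le_div_of_nonneg_right (sum_le_sum fun a _ => h a) (prodsd_pos sd).le
lemma Ea_add (f g : (∀ s, ZMod (sd s)) → ℝ) : Ea sd (fun a => f a + g a) = Ea sd f + Ea sd g := by
  simp only [Ea, sum_add_distrib, add_div]
lemma Ea_sub (f g : (∀ s, ZMod (sd s)) → ℝ) : Ea sd (fun a => f a - g a) = Ea sd f - Ea sd g := by
  simp only [Ea, sum_sub_distrib, sub_div]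
lemma Ea_mul (c : ℝ) (f : (∀ s, ZMod (sd s)) → ℝ) : Ea sd (fun a => c * f a) = c * Ea sd f := by
  simp only [Ea, ← mul_sum, mul_div_assoc]
lemma Ea_sum {κ : Type} (S : Finset κ) (f : κ → (∀ s, ZMod (sd s)) → ℝ) : Ea sd (fun a => ∑ k ∈ S, f k a) = ∑ k ∈ S, Ea sd (f k) := by
  simp only [Ea]; rw [sum_comm, sum_div]
lemma Ea_one : Ea sd (fun _ => 1) = 1 := by
  have := (prodsd_pos sd).ne'
  simp only [Ea, sum_const, card_univ, Fintype.card_pi, ZMod.card, nsmul_eq_mul, mul_one]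
  push_cast; exact div_self this
lemma Ea_exists {f : (∀ s, ZMod (sd s)) → ℝ} {c : ℝ} (h : Ea sd f ≤ c) : ∃ a, f a ≤ c := by
  by_contra hc
  push Not at hc
  have h1 : ∑ a : ∀ s, ZMod (sd s), c < ∑ a, f a := sum_lt_sum_of_nonempty ⟨fun _ => 0, mem_univ _⟩ fun a _ => hc a
  have h2 : Ea sd (fun _ => c) < Ea sd f := div_lt_div_of_pos_right h1 (prodsd_pos sd)
  have h3 := Ea_mul sd c (fun _ => 1)
  simp only [Ea_one, mul_one] at h3
  linarith

lemma ind_nonneg (U : Finset ℤ) (a : ∀ s, ZMod (sd s)) : 0 ≤ ind sd U a := by unfold ind; split_ifs <;> simp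
lemma ind_le_one (U : Finset ℤ) (a : ∀ s, ZMod (sd s)) : ind sd U a ≤ 1 := by unfold ind; split_ifs <;> simp
lemma ind_union (U U' : Finset ℤ) (a : ∀ s, ZMod (sd s)) : ind sd (U ∪ U') a = ind sd U a * ind sd U' a := by
  have : (∀ s, ∀ u ∈ U ∪ U', (u : ZMod (sd s)) ≠ a s) ↔ (∀ s, ∀ u ∈ U, (u : ZMod (sd s)) ≠ a s) ∧ (∀ s, ∀ u ∈ U', (u : ZMod (sd s)) ≠ a s) := by
    constructor
    · intro h; exact ⟨fun s u hu => h s u (mem_union_left _ hu), fun s u hu => h s u (mem_union_right _ hu)⟩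
    · rintro ⟨h1, h2⟩ s u hu
      rcases mem_union.1 hu with h | h
      exacts [h1 s u h, h2 s u h]
  unfold ind
  rw [if_congr this rfl rfl, ite_and]
  split_ifs <;> simp

open Classical in
lemma Ea_ind (U : Finset ℤ) : Ea sd (ind sd U) = ∏ s, (1 - (#(U.image (fun u : ℤ => (u : ZMod (sd s)))) : ℝ) / sd s) := by
  have h1 : ∀ a : ∀ s, ZMod (sd s), ind sd U a = ∏ s, if a s ∈ U.image (fun u : ℤ => (u : ZMod (sd s))) then (0:ℝ) else 1 := by
    intro a
    unfold ind
    split_ifs with h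
    · symm; refine prod_eq_one fun s _ => if_neg ?_
      rw [mem_image]; rintro ⟨u, hu, he⟩; exact h s u hu he
    · push Not at h
      obtain ⟨s, u, hu, he⟩ := h
      symm; exact prod_eq_zero (mem_univ s) (if_pos (mem_image.2 ⟨u, hu, he⟩))
  rw [Ea, sum_congr rfl fun a _ => h1 a]
  have h2 := (Finset.prod_univ_sum (fun s : ι => (univ : Finset (ZMod (sd s))))
    (fun s r => if r ∈ U.image (fun u : ℤ => (u : ZMod (sd s))) then (0:ℝ) else 1))
  rw [Fintype.piFinset_univ] at h2
  rw [← h2, ← prod_div_distrib]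
  refine prod_congr rfl fun s _ => ?_
  have hs : (sd s : ℝ) ≠ 0 := by exact_mod_cast NeZero.ne (sd s)
  have h3 : ∑ r : ZMod (sd s), (if r ∈ U.image (fun u : ℤ => (u : ZMod (sd s))) then (0:ℝ) else 1) =
      sd s - #(U.image (fun u : ℤ => (u : ZMod (sd s)))) := by
    have : ∀ r : ZMod (sd s), (if r ∈ U.image (fun u : ℤ => (u : ZMod (sd s))) then (0:ℝ) else 1) =
       1 - (if r ∈ U.image (fun u : ℤ => (u : ZMod (sd s))) then (1:ℝ) else 0) := fun r => by split_ifs <;> simp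
    rw [sum_congr rfl fun r _ => this r, sum_sub_distrib, sum_ite_mem]
    simp
  rw [h3]; field_simp

/-- distinct residues -/
def dist' (U : Finset ℤ) : Prop := ∀ s, Set.InjOn (fun u : ℤ => (u : ZMod (sd s))) U

open Classical in
lemma Ea_ind_dist {U : Finset ℤ} (h : dist' sd U) : Ea sd (ind sd U) = sig sd #U := by
  rw [Ea_ind, sig]
  refine prod_congr rfl fun s _ => ?_
  rw [card_image_of_injOn (h s)]

lemma sig_pos {κ w : ℝ} (hκw : κ < w) (hw : ∀ s, w ≤ sd s) {j : ℕ} (hj : (j:ℝ) ≤ κ) : 0 < sig sd j := by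
  refine prod_pos fun s _ => ?_
  have h1 : (0:ℝ) < sd s := by exact_mod_cast Nat.pos_of_ne_zero (NeZero.ne _)
  have : (j:ℝ) / sd s < 1 := by rw [div_lt_one h1]; linarith [hw s]
  linarith

open Classical in
lemma pair_bound {κ w : ℝ} (hκ0 : 0 ≤ κ) (hκw : κ < w) (hw : ∀ s, w ≤ sd s) {U U' : Finset ℤ} (hU : dist' sd U) (hU' : dist' sd U')
    (hu : (#U : ℝ) ≤ κ) (hu' : (#U' : ℝ) ≤ κ) (B : Finset ι)
    (hB : ∀ s, s ∉ B → Set.InjOn (fun u : ℤ => (u : ZMod (sd s))) (U ∪ U' : Finset ℤ)) :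
    Ea sd (fun a => ind sd U a * ind sd U' a) * sig sd #(U ∩ U') ≤ (1 / (1 - κ / w)) ^ #B * (sig sd #U * sig sd #U') := by
  have e : (fun a => ind sd U a * ind sd U' a) = ind sd (U ∪ U') := by funext a; rw [ind_union]
  have hw0 : 0 < w := by linarith
  have hβ : 1 ≤ 1 / (1 - κ / w) := by
    have : κ / w < 1 := (div_lt_one hw0).2 hκw
    rw [le_div_iff₀ (by linarith)]; have := div_nonneg hκ0 hw0.le; linarith
  have e2 : (1 / (1 - κ / w)) ^ #B = ∏ s, if s ∈ B then 1 / (1 - κ / w) else 1 := by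
    rw [prod_ite_mem]; simp
  rw [e, Ea_ind, sig, sig, sig, e2, ← prod_mul_distrib, ← prod_mul_distrib, ← prod_mul_distrib]
  have hI : (#(U ∪ U') : ℝ) + #(U ∩ U') = #U + #U' := by exact_mod_cast card_union_add_card_inter U U'
  have hi1 : (#(U ∩ U') : ℝ) ≤ #U := by exact_mod_cast card_le_card inter_subset_left
  have hi2 : (#(U ∩ U') : ℝ) ≤ #U' := by exact_mod_cast card_le_card inter_subset_right
  have hi0 : (0 : ℝ) ≤ #(U ∩ U') := by positivity
  have key : ∀ s, ∀ t : ℝ, t ≤ κ → 0 ≤ t → 0 < 1 - t / sd s := fun s t ht h0 => by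
    have h1 : (0:ℝ) < sd s := by linarith [hw s]
    have : t / sd s < 1 := by rw [div_lt_one h1]; linarith [hw s]
    linarith
  have him : ∀ s, #((U ∪ U').image (fun u : ℤ => (u : ZMod (sd s)))) ≤ sd s := fun s =>
    (card_le_univ _).trans (by simp)
  refine prod_le_prod (fun s _ => mul_nonneg ?_ (key s _ (hi1.trans hu) hi0).le) fun s _ => ?_
  · have h1 : (0:ℝ) < sd s := by linarith [hw s]
    rw [sub_nonneg, div_le_one h1]; exact_mod_cast him s
  have hs : (0:ℝ) < sd s := by linarith [hw s]
  by_cases hsB : s ∈ B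
  · rw [if_pos hsB]
    have h1 : (#U : ℝ) ≤ #((U ∪ U').image (fun u : ℤ => (u : ZMod (sd s)))) := by
      rw [← card_image_of_injOn (hU s)]; exact_mod_cast card_le_card (image_subset_image subset_union_left)
    have h2 : 1 - (#((U ∪ U').image (fun u : ℤ => (u : ZMod (sd s)))) : ℝ) / sd s ≤ 1 - #U / sd s := by
      have := div_le_div_of_nonneg_right h1 hs.le; linarith
    have h3 := key s _ (hi1.trans hu) hi0
    have h4 := key s _ hu (by positivity)
    have h5 := key s _ hu' (by positivity)
    have h6 : 1 - (#(U ∩ U') : ℝ) / sd s ≤ 1 := by have := div_nonneg hi0 hs.le; linarith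
    have h7 : 1 ≤ 1 / (1 - κ / w) * (1 - (#U' : ℝ) / sd s) := by
      have : κ / w < 1 := (div_lt_one hw0).2 hκw
      rw [div_mul_eq_mul_div, one_mul, le_div_iff₀ (by linarith), one_mul]
      have : (#U' : ℝ) / sd s ≤ κ / w := div_le_div₀ hκ0 hu' hw0 (hw s)
      linarith
    calc _ ≤ (1 - (#U : ℝ) / sd s) * 1 := mul_le_mul h2 h6 h3.le h4.le
      _ ≤ (1 - (#U : ℝ) / sd s) * (1 / (1 - κ / w) * (1 - (#U' : ℝ) / sd s)) := mul_le_mul_of_nonneg_left h7 h4.le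
      _ = _ := by ring
  · rw [if_neg hsB, card_image_of_injOn (hB s hsB), one_mul]
    have h8 : (#(U ∪ U') : ℝ) = #U + #U' - #(U ∩ U') := by linarith
    rw [h8]
    have : 0 ≤ ((#U:ℝ) - #(U ∩ U')) * (#U' - #(U ∩ U')) := mul_nonneg (by linarith) (by linarith)
    have h9 : (1 - (#U : ℝ) / sd s) * (1 - (#U' : ℝ) / sd s) - (1 - ((#U : ℝ) + #U' - #(U ∩ U')) / sd s) * (1 - (#(U ∩ U') : ℝ) / sd s)
      = ((#U:ℝ) - #(U ∩ U')) * (#U' - #(U ∩ U')) / (sd s) ^ 2 := by field_simp; ring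
    have : 0 ≤ ((#U:ℝ) - #(U ∩ U')) * (#U' - #(U ∩ U')) / (sd s) ^ 2 := by positivity
    linarith
end Ea

structure AC (ι : Type) [Fintype ι] where
  sd : ι → ℕ
  prime : ∀ s, (sd s).Prime
  κ : ℕ
  w : ℝ
  hκ : 1 ≤ κ
  hκw : (κ:ℝ) < w
  hw : ∀ s, w ≤ sd s
  P1 : Finset ℕ
  hP : ∀ p ∈ P1, p.Prime
  hPκ : ∀ p ∈ P1, κ < p
  hPs : ∀ p ∈ P1, ∀ s, sd s < p
  A : ℕ → ℤ → Finset ℕ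
  hA : ∀ p n, A p n ⊆ range κ
  wt : ℕ → ℤ → ℝ
  wt0 : ∀ p n, 0 ≤ wt p n
  B : ℝ
  wtB : ∀ p n, wt p n ≤ B
  N0 : Finset ℤ
  hN0 : N0.Nonempty
  y : ℝ
  hy : 0 < y
  tot : ∀ p ∈ P1, ∑ n ∈ N0, wt p n ≤ 2 * y
  Q : Finset ℤ
  hQN : ∀ q ∈ Q, ∀ p ∈ P1, ∀ i < κ, q - i * p ∈ N0
  hQA : ∀ q ∈ Q, ∀ p ∈ P1, ∀ i < κ, i ∈ A p (q - i * p)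
  Λ : ℕ
  hΛ : ∀ p ∈ P1, ∀ p' ∈ P1, ∀ n ∈ N0, ∀ n' ∈ N0, ∀ h < κ, ∀ h' < κ, ((n + h * p) - (n' + h' * p') : ℤ) ≠ 0 →
    #{s | (sd s : ℤ) ∣ (n + h * p) - (n' + h' * p')} ≤ Λ
  ε : ℝ
  hε : 0 ≤ ε
  hβ : (1 / (1 - κ / w)) ^ (κ ^ 2 * Λ) ≤ 1 + ε
  S : ℝ
  hS : ∀ j ≤ κ, 1 ≤ S * ∏ s, (1 - (j:ℝ) / (sd s : ℝ))
  m : ℝ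
  hm0 : 0 < m
  hF : ∀ q ∈ Q, m / 2 ≤ ∑ p ∈ P1, ∑ i ∈ range κ, wt p (q - i * p)
  Nc : ℝ
  hNc : ∀ p ∈ P1, ∀ n ∈ N0, (#{n' ∈ N0 | (p:ℤ) ∣ n' - n} : ℝ) ≤ Nc
  num1 : S * Nc * B ≤ ε * y
  num2 : κ * B * S ≤ ε * (m / 2)
  num3 : #P1 * κ ≤ 16 * m

namespace AC
variable {ι : Type} [Fintype ι] [DecidableEq ι] (V : AC ι)

instance (s : ι) : NeZero (V.sd s) := ⟨(V.prime s).ne_zero⟩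

def U (p : ℕ) (n : ℤ) : Finset ℤ := (V.A p n).image (fun h : ℕ => n + h * p)
noncomputable def σ (j : ℕ) : ℝ := sig V.sd j
noncomputable def W (p : ℕ) (n : ℤ) (a : ∀ s, ZMod (V.sd s)) : ℝ := ind V.sd (V.U p n) a / V.σ #(V.A p n) * V.wt p n
noncomputable def F (q : ℤ) : ℝ := ∑ p ∈ V.P1, ∑ i ∈ range V.κ, V.wt p (q - i * p)
noncomputable def X (q : ℤ) (a : ∀ s, ZMod (V.sd s)) : ℝ := ∑ p ∈ V.P1, ∑ i ∈ range V.κ, V.W p (q - i * p) a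
noncomputable def Z (p : ℕ) (a : ∀ s, ZMod (V.sd s)) : ℝ := ∑ n ∈ V.N0, V.W p n a
noncomputable def e (p : ℕ) : ℝ := ∑ n ∈ V.N0, V.wt p n

variable {V}

lemma cardU {p : ℕ} (hp : p ∈ V.P1) (n : ℤ) : #(V.U p n) = #(V.A p n) := by
  refine card_image_of_injective _ fun h h' e => ?_
  have hp0 : (p:ℤ) ≠ 0 := by exact_mod_cast (V.hP p hp).ne_zero
  simp only [add_right_inj] at e
  exact_mod_cast mul_right_cancel₀ hp0 e

lemma cardA (p : ℕ) (n : ℤ) : #(V.A p n) ≤ V.κ := by simpa using card_le_card (V.hA p n)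

lemma σ_pos {j : ℕ} (hj : j ≤ V.κ) : 0 < V.σ j := sig_pos V.sd V.hκw V.hw (by exact_mod_cast hj)
lemma σ_le_one {j : ℕ} (hj : j ≤ V.κ) : V.σ j ≤ 1 := by
  refine prod_le_one (fun s _ => ?_) fun s _ => ?_
  · have h0 := V.hw s
    have h1 := V.hκw
    have h2 : (j:ℝ) ≤ V.κ := by exact_mod_cast hj
    have h3 : (0:ℝ) ≤ j := by positivity
    rw [sub_nonneg, div_le_one (by linarith)]; linarith
  · have : 0 ≤ (j:ℝ) / V.sd s := by positivity
    linarith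
lemma inv_σ {j : ℕ} (hj : j ≤ V.κ) : 1 / V.σ j ≤ V.S := by
  rw [div_le_iff₀ (σ_pos hj)]; exact V.hS j hj

lemma W_nonneg (p : ℕ) (n : ℤ) (a) : 0 ≤ V.W p n a :=
  mul_nonneg (div_nonneg (ind_nonneg _ _ _) (σ_pos (cardA p n)).le) (V.wt0 p n)

lemma distU {p : ℕ} (hp : p ∈ V.P1) (n : ℤ) : dist' V.sd (V.U p n) := by
  intro s u hu u' hu' h
  simp only [U, coe_image, Set.mem_image, mem_coe] at hu hu'
  obtain ⟨h1, hh1, rfl⟩ := hu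
  obtain ⟨h2, hh2, rfl⟩ := hu'
  have b1 := mem_range.1 (V.hA p n hh1)
  have b2 := mem_range.1 (V.hA p n hh2)
  have hs := V.hw s
  have hk := V.hκw
  have hlt : V.κ < V.sd s := by exact_mod_cast lt_of_lt_of_le hk hs
  simp only at h
  rw [ZMod.intCast_eq_intCast_iff_dvd_sub] at h
  have e1 : (n + h2 * p - (n + h1 * p) : ℤ) = ((h2:ℤ) - h1) * p := by ring
  rw [e1] at h
  rcases (Nat.prime_iff_prime_int.1 (V.prime s)).dvd_or_dvd h with h3 | h3
  · have : (h2:ℤ) - h1 = 0 := Int.eq_zero_of_abs_lt_dvd h3 (by rw [abs_lt]; constructor <;> omega)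
    have : h2 = h1 := by omega
    rw [this]
  · have h4 : V.sd s ∣ p := by exact_mod_cast h3
    have h5 := (Nat.prime_dvd_prime_iff_eq (V.prime s) (V.hP p hp)).1 h4
    have := V.hPs p hp s
    omega

lemma EW {p : ℕ} (hp : p ∈ V.P1) (n : ℤ) : Ea V.sd (V.W p n) = V.wt p n := by
  have : V.W p n = fun a => V.wt p n / V.σ #(V.A p n) * ind V.sd (V.U p n) a := by funext a; rw [W]; ring
  rw [this, Ea_mul, Ea_ind_dist _ (distU hp n), cardU hp]
  have := (σ_pos (V := V) (cardA p n)).ne'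
  change _ * V.σ _ = _
  field_simp

/-- trivial pair bound -/
lemma EWW_triv {p p' : ℕ} (hp : p ∈ V.P1) (n n' : ℤ) :
    Ea V.sd (fun a => V.W p n a * V.W p' n' a) ≤ V.S * (V.wt p n * V.wt p' n') := by
  have h1 : ∀ a, V.W p n a * V.W p' n' a ≤ V.S * V.wt p' n' * V.W p n a := by
    intro a
    have h2 : V.W p' n' a ≤ V.S * V.wt p' n' := by
      refine mul_le_mul_of_nonneg_right (le_trans ?_ (inv_σ (cardA p' n'))) (V.wt0 p' n')
      exact div_le_div_of_nonneg_right (ind_le_one _ _ _) (σ_pos (cardA p' n')).le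
    rw [mul_comm]; exact mul_le_mul_of_nonneg_right h2 (W_nonneg p n a)
  refine (Ea_mono V.sd h1).trans (le_of_eq ?_)
  rw [Ea_mul, EW hp]; ring

/-- good pair bound -/
lemma EWW_good {p p' : ℕ} (hp : p ∈ V.P1) (hp' : p' ∈ V.P1) {n n' : ℤ} (hn : n ∈ V.N0) (hn' : n' ∈ V.N0) {j : ℕ} (hj : #(V.U p n ∩ V.U p' n') = j) :
    Ea V.sd (fun a => V.W p n a * V.W p' n' a) * V.σ j ≤ (1 + V.ε) * (V.wt p n * V.wt p' n') := by
  classical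
  set T : Finset (ℕ × ℕ) := ((V.A p n) ×ˢ (V.A p' n')).filter (fun t => ((n + t.1 * p) - (n' + t.2 * p') : ℤ) ≠ 0) with hT
  set BB : Finset ι := T.biUnion (fun t => univ.filter fun s => (V.sd s : ℤ) ∣ (n + t.1 * p) - (n' + t.2 * p')) with hBB
  have hcard : #BB ≤ V.κ ^ 2 * V.Λ := by
    refine (card_biUnion_le_card_mul _ _ V.Λ fun t ht => ?_).trans (Nat.mul_le_mul_right _ ?_)
    · simp only [hT, mem_filter, mem_product] at ht
      exact V.hΛ p hp p' hp' n hn n' hn' t.1 (mem_range.1 (V.hA p n ht.1.1)) t.2 (mem_range.1 (V.hA p' n' ht.1.2)) ht.2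
    · refine (card_filter_le _ _).trans ?_
      rw [card_product, sq]; exact Nat.mul_le_mul (cardA p n) (cardA p' n')
  have hinj : ∀ s, s ∉ BB → Set.InjOn (fun u : ℤ => (u : ZMod (V.sd s))) (V.U p n ∪ V.U p' n' : Finset ℤ) := by
    intro s hs
    have cross : ∀ u ∈ V.U p n, ∀ u' ∈ V.U p' n', (u : ZMod (V.sd s)) = u' → u = u' := by
      intro u hu u' hu' h
      simp only [U, mem_image] at hu hu'
      obtain ⟨h1, hh1, rfl⟩ := hu
      obtain ⟨h2, hh2, rfl⟩ := hu'
      by_contra hne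
      refine hs (mem_biUnion.2 ⟨(h1, h2), ?_, ?_⟩)
      · simp only [hT, mem_filter, mem_product]
        exact ⟨⟨hh1, hh2⟩, sub_ne_zero.2 hne⟩
      · simp only [mem_filter, mem_univ, true_and]
        exact (ZMod.intCast_eq_intCast_iff_dvd_sub _ _ _).1 h.symm
    intro u hu u' hu' h
    rcases mem_union.1 (mem_coe.1 hu) with h1 | h1 <;> rcases mem_union.1 (mem_coe.1 hu') with h2 | h2
    · exact distU hp n s h1 h2 h
    · exact cross u h1 u' h2 h
    · exact (cross u' h2 u h1 h.symm).symm
    · exact distU hp' n' s h1 h2 h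
  have hc1 : (#(V.U p n) : ℝ) ≤ V.κ := by rw [cardU hp]; exact_mod_cast cardA p n
  have hc2 : (#(V.U p' n') : ℝ) ≤ V.κ := by rw [cardU hp']; exact_mod_cast cardA p' n'
  have key := pair_bound V.sd (by positivity) V.hκw V.hw (distU hp n) (distU hp' n') hc1 hc2 BB hinj
  have hs1 := σ_pos (V := V) (cardA p n)
  have hs2 := σ_pos (V := V) (cardA p' n')
  rw [hj, cardU hp, cardU hp'] at key
  change _ * V.σ j ≤ _ * (V.σ _ * V.σ _) at key
  have hw0 : 0 < V.w := by have := V.hκw; have : (0:ℝ) ≤ V.κ := by positivity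
                           linarith
  have hβ1 : 1 ≤ 1 / (1 - (V.κ:ℝ) / V.w) := by
    have : (V.κ:ℝ) / V.w < 1 := (div_lt_one hw0).2 V.hκw
    rw [le_div_iff₀ (by linarith)]; have : 0 ≤ (V.κ:ℝ) / V.w := by positivity
    linarith
  have hpow := (pow_le_pow_right₀ hβ1 hcard).trans V.hβ
  have e1 : (fun a => V.W p n a * V.W p' n' a) = fun a => (V.wt p n * V.wt p' n' / (V.σ #(V.A p n) * V.σ #(V.A p' n'))) *
      (ind V.sd (V.U p n) a * ind V.sd (V.U p' n') a) := by
    funext a; rw [W, W]; field_simp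
  rw [e1, Ea_mul]
  have hw0 := mul_nonneg (V.wt0 p n) (V.wt0 p' n')
  calc _ = (V.wt p n * V.wt p' n' / (V.σ #(V.A p n) * V.σ #(V.A p' n'))) * (Ea V.sd (fun a => ind V.sd (V.U p n) a * ind V.sd (V.U p' n') a) * V.σ j) := by ring
    _ ≤ (V.wt p n * V.wt p' n' / (V.σ #(V.A p n) * V.σ #(V.A p' n'))) * ((1 + V.ε) * (V.σ #(V.A p n) * V.σ #(V.A p' n'))) :=
      mul_le_mul_of_nonneg_left (key.trans (mul_le_mul_of_nonneg_right hpow (by positivity))) (by positivity)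
    _ = _ := by field_simp

lemma σ_zero : V.σ 0 = 1 := by simp [σ, sig]

lemma e_le {p : ℕ} (hp : p ∈ V.P1) : V.e p ≤ 2 * V.y := V.tot p hp
lemma e_nonneg (p : ℕ) : 0 ≤ V.e p := sum_nonneg fun n _ => V.wt0 p n

lemma B_nonneg : 0 ≤ V.B := (V.wt0 0 0).trans (V.wtB 0 0)
lemma S_nonneg : 0 ≤ V.S := le_trans (by have := σ_pos (V := V) (Nat.zero_le _); positivity) (inv_σ (V := V) (Nat.zero_le _))

lemma EZsq {p : ℕ} (hp : p ∈ V.P1) : Ea V.sd (fun a => V.Z p a ^ 2) ≤ (1 + V.ε) * V.e p ^ 2 + V.e p * (V.ε * V.y) := by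
  have e1 : (fun a => V.Z p a ^ 2) = fun a => ∑ n ∈ V.N0, ∑ n' ∈ V.N0, V.W p n a * V.W p n' a := by
    funext a; rw [Z, sq, sum_mul_sum]
  rw [e1, Ea_sum, sum_congr rfl fun n _ => Ea_sum V.sd V.N0 (fun n' a => V.W p n a * V.W p n' a)]
  have h1 : ∀ n ∈ V.N0, ∀ n' ∈ V.N0, Ea V.sd (fun a => V.W p n a * V.W p n' a) ≤
      (1 + V.ε) * (V.wt p n * V.wt p n') + (if (p:ℤ) ∣ n' - n then V.S * (V.wt p n * V.B) else 0) := by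
    intro n hn n' hn'
    have := V.wt0 p n
    have := V.wt0 p n'
    have := V.hε
    split_ifs with hd
    · refine (EWW_triv hp n n').trans ?_
      have h2 : V.S * (V.wt p n * V.wt p n') ≤ V.S * (V.wt p n * V.B) :=
        mul_le_mul_of_nonneg_left (mul_le_mul_of_nonneg_left (V.wtB _ _) (V.wt0 _ _)) S_nonneg
      have : 0 ≤ (1 + V.ε) * (V.wt p n * V.wt p n') := by positivity
      linarith
    · have h0 : #(V.U p n ∩ V.U p n') = 0 := by
        rw [card_eq_zero, ← disjoint_iff_inter_eq_empty, disjoint_left]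
        intro u hu hu'
        simp only [U, mem_image] at hu hu'
        obtain ⟨h1, hh1, rfl⟩ := hu
        obtain ⟨h2, hh2, h3⟩ := hu'
        exact hd ⟨(h1:ℤ) - h2, by linear_combination h3⟩
      have := EWW_good hp hp hn hn' h0
      rw [σ_zero, mul_one] at this
      linarith
  refine (sum_le_sum fun n hn => sum_le_sum fun n' hn' => h1 n hn n' hn').trans ?_
  simp only [sum_add_distrib]
  refine add_le_add (le_of_eq ?_) ?_
  · rw [e, sq, sum_mul_sum]; simp only [mul_sum]
  · rw [e, sum_mul]
    refine sum_le_sum fun n hn => ?_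
    rw [← sum_filter, sum_const, nsmul_eq_mul]
    calc _ ≤ V.Nc * (V.S * (V.wt p n * V.B)) := mul_le_mul_of_nonneg_right (V.hNc p hp n hn)
          (mul_nonneg S_nonneg (mul_nonneg (V.wt0 _ _) B_nonneg))
      _ = V.wt p n * (V.S * V.Nc * V.B) := by ring
      _ ≤ _ := mul_le_mul_of_nonneg_left V.num1 (V.wt0 _ _)

lemma EZ {p : ℕ} (hp : p ∈ V.P1) : Ea V.sd (V.Z p) = V.e p := by
  have : V.Z p = fun a => ∑ n ∈ V.N0, V.W p n a := rfl
  rw [this, Ea_sum, e]; exact sum_congr rfl fun n _ => EW hp n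

lemma VarZ {p : ℕ} (hp : p ∈ V.P1) : Ea V.sd (fun a => (V.Z p a - V.e p) ^ 2) ≤ 6 * V.ε * V.y ^ 2 := by
  have e1 : (fun a => (V.Z p a - V.e p) ^ 2) = fun a => V.Z p a ^ 2 - (2 * V.e p) * V.Z p a + V.e p ^ 2 * 1 := by funext a; ring
  rw [e1, Ea_add V.sd (fun a => V.Z p a ^ 2 - (2 * V.e p) * V.Z p a), Ea_sub, Ea_mul, Ea_mul, Ea_one, EZ hp]
  have h1 := EZsq hp
  have h2 := e_le hp
  have h3 := e_nonneg (V := V) p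
  have h4 := V.hε
  have h5 := V.hy
  have h6 : V.e p ^ 2 ≤ 4 * V.y ^ 2 := by nlinarith
  nlinarith [mul_le_mul_of_nonneg_left h6 h4, mul_le_mul_of_nonneg_left h2 (mul_nonneg h4 h5.le)]

lemma q_mem {q : ℤ} (hq : q ∈ V.Q) {p i : ℕ} (hp : p ∈ V.P1) (hi : i < V.κ) : q ∈ V.U p (q - i * p) :=
  mem_image.2 ⟨i, V.hQA q hq p hp i hi, by ring⟩

lemma F_ge {q : ℤ} (hq : q ∈ V.Q) : V.m / 2 ≤ V.F q := V.hF q hq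
lemma F_pos {q : ℤ} (hq : q ∈ V.Q) : 0 < V.F q := lt_of_lt_of_le (by have := V.hm0; positivity) (F_ge hq)

lemma EXsq {q : ℤ} (hq : q ∈ V.Q) : Ea V.sd (fun a => V.X q a ^ 2) ≤ (1 + 2 * V.ε) * V.F q ^ 2 / V.σ 1 := by
  have e1 : (fun a => V.X q a ^ 2) = fun a => ∑ p ∈ V.P1, ∑ i ∈ range V.κ, ∑ p' ∈ V.P1, ∑ i' ∈ range V.κ,
      V.W p (q - i * p) a * V.W p' (q - i' * p') a := by
    funext a; rw [X, sq, sum_mul]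
    refine sum_congr rfl fun p _ => ?_
    rw [sum_mul]
    refine sum_congr rfl fun i _ => ?_
    rw [mul_sum]; simp only [mul_sum]
  have hs := σ_pos (V := V) V.hκ
  have hs1 := σ_le_one (V := V) V.hκ
  have hε := V.hε
  rw [e1, Ea_sum, sum_congr rfl fun p _ => Ea_sum V.sd (range V.κ) (fun i a => ∑ p' ∈ V.P1, ∑ i' ∈ range V.κ,
      V.W p (q - i * p) a * V.W p' (q - i' * p') a)]
  have h1 : ∀ p ∈ V.P1, ∀ i ∈ range V.κ, Ea V.sd (fun a => ∑ p' ∈ V.P1, ∑ i' ∈ range V.κ, V.W p (q - i * p) a * V.W p' (q - i' * p') a) ≤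
      V.wt p (q - i * p) * ((1 + 2 * V.ε) * V.F q / V.σ 1) := by
    intro p hp i hi
    rw [Ea_sum, sum_congr rfl fun p' _ => Ea_sum V.sd (range V.κ) (fun i' a => V.W p (q - i * p) a * V.W p' (q - i' * p') a)]
    have h2 : ∀ p' ∈ V.P1, ∀ i' ∈ range V.κ, Ea V.sd (fun a => V.W p (q - i * p) a * V.W p' (q - i' * p') a) ≤
       V.wt p (q - i * p) * ((1 + V.ε) / V.σ 1 * V.wt p' (q - i' * p') + (if p' = p then V.S * V.B else 0)) := by
      intro p' hp' i' hi'
      have hw := V.wt0 p (q - i * p)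
      have hw' := V.wt0 p' (q - i' * p')
      split_ifs with hpp
      · refine (EWW_triv hp _ _).trans ?_
        have h3 : V.S * (V.wt p (q - i * p) * V.wt p' (q - i' * p')) ≤ V.wt p (q - i * p) * (V.S * V.B) := by
          have := mul_le_mul_of_nonneg_left (V.wtB p' (q - i' * p')) (mul_nonneg (S_nonneg (V := V)) hw)
          linarith
        have : 0 ≤ V.wt p (q - i * p) * ((1 + V.ε) / V.σ 1 * V.wt p' (q - i' * p')) := by positivity
        linarith
      · have hj : #(V.U p (q - i * p) ∩ V.U p' (q - i' * p')) = 1 := by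
          rw [card_eq_one]
          refine ⟨q, ?_⟩
          ext u
          simp only [mem_inter, mem_singleton]
          constructor
          · rintro ⟨hu, hu'⟩
            simp only [U, mem_image] at hu hu'
            obtain ⟨h, hh, rfl⟩ := hu
            obtain ⟨h', hh', h3⟩ := hu'
            have b1 := mem_range.1 (V.hA _ _ hh)
            have b2 := mem_range.1 hi
            have h4 : ((h:ℤ) - i) * p = (h' - i') * p' := by linear_combination -h3
            have h5 : (p:ℤ) ∣ (h' - i') * p' := ⟨(h:ℤ) - i, by rw [← h4]; ring⟩
            have h6 : (p':ℤ) ∣ (h - i) * p := ⟨(h':ℤ) - i', by rw [h4]; ring⟩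
            have hpi := Nat.prime_iff_prime_int.1 (V.hP p' hp')
            rcases hpi.dvd_or_dvd h6 with h7 | h7
            · have hpk := V.hPκ p' hp'
              have : (h:ℤ) - i = 0 := Int.eq_zero_of_abs_lt_dvd h7 (by rw [abs_lt]; constructor <;> omega)
              have : (h:ℤ) = i := by omega
              rw [this]; ring
            · exact absurd ((Nat.prime_dvd_prime_iff_eq (V.hP p' hp') (V.hP p hp)).1 (by exact_mod_cast h7)) hpp
          · rintro rfl; exact ⟨q_mem hq hp (mem_range.1 hi), q_mem hq hp' (mem_range.1 hi')⟩
        have := EWW_good hp hp' (V.hQN q hq p hp i (mem_range.1 hi)) (V.hQN q hq p' hp' i' (mem_range.1 hi')) hj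
        rw [← le_div_iff₀ hs] at this
        refine this.trans (le_of_eq ?_)
        field_simp; ring
    refine (sum_le_sum fun p' hp' => sum_le_sum fun i' hi' => h2 p' hp' i' hi').trans ?_
    simp only [← mul_sum]
    refine mul_le_mul_of_nonneg_left ?_ (V.wt0 _ _)
    simp only [sum_add_distrib, ← mul_sum]
    have h3 : ∑ p' ∈ V.P1, ∑ i' ∈ range V.κ, (if p' = p then V.S * V.B else 0) = V.κ * B V * V.S := by
      rw [sum_comm]; simp [hp]; ring
    rw [h3]
    change _ * V.F q + _ ≤ _
    have h4 : V.κ * V.B * V.S ≤ V.ε * V.F q := V.num2.trans (mul_le_mul_of_nonneg_left (F_ge hq) hε)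
    have h5 : V.ε * V.F q ≤ V.ε * V.F q / V.σ 1 := by
      rw [le_div_iff₀ hs]; have : 0 ≤ V.ε * V.F q := mul_nonneg hε (F_pos hq).le
      nlinarith
    have h6 : (1 + 2 * V.ε) * V.F q / V.σ 1 = (1 + V.ε) / V.σ 1 * V.F q + V.ε * V.F q / V.σ 1 := by field_simp; ring
    linarith
  refine (sum_le_sum fun p hp => sum_le_sum fun i hi => h1 p hp i hi).trans (le_of_eq ?_)
  simp only [← sum_mul]
  change V.F q * _ = _
  ring

lemma Eind {q : ℤ} : Ea V.sd (ind V.sd {q}) = V.σ 1 := by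
  rw [Ea_ind_dist]; · rfl
  intro s u hu u' hu' _
  simp at hu hu'; rw [hu, hu']

lemma VarX {q : ℤ} (hq : q ∈ V.Q) : Ea V.sd (fun a => ind V.sd {q} a * (V.X q a - V.F q / V.σ 1) ^ 2) ≤ 2 * V.ε * V.F q ^ 2 / V.σ 1 := by
  have hs := σ_pos (V := V) V.hκ
  have hW : ∀ a, ind V.sd {q} a * V.X q a = V.X q a := by
    intro a
    rw [X, mul_sum]
    refine sum_congr rfl fun p hp => ?_
    rw [mul_sum]
    refine sum_congr rfl fun i hi => ?_
    have : ind V.sd {q} a * ind V.sd (V.U p (q - i * p)) a = ind V.sd (V.U p (q - i * p)) a := by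
      rw [← ind_union]; congr 1
      rw [union_eq_right, singleton_subset_iff]; exact q_mem hq hp (mem_range.1 hi)
    rw [W]
    calc _ = ind V.sd {q} a * ind V.sd (V.U p (q - i * p)) a / V.σ #(V.A p (q - i * p)) * V.wt p (q - i * p) := by ring
      _ = _ := by rw [this]
  have e1 : (fun a => ind V.sd {q} a * (V.X q a - V.F q / V.σ 1) ^ 2) =
      fun a => V.X q a ^ 2 - (2 * V.F q / V.σ 1) * V.X q a + (V.F q / V.σ 1) ^ 2 * ind V.sd {q} a := by
    funext a
    have h := hW a
    linear_combination (V.X q a - 2 * V.F q / V.σ 1) * h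
  have e2 : Ea V.sd (V.X q) = V.F q := by
    have : V.X q = fun a => ∑ p ∈ V.P1, ∑ i ∈ range V.κ, V.W p (q - i * p) a := rfl
    rw [this, Ea_sum, F]
    refine sum_congr rfl fun p hp => ?_
    rw [Ea_sum]
    exact sum_congr rfl fun i _ => EW hp _
  rw [e1, Ea_add V.sd (fun a => V.X q a ^ 2 - (2 * V.F q / V.σ 1) * V.X q a), Ea_sub, Ea_mul, Ea_mul, e2, Eind]
  have h1 := EXsq hq
  have e3 : (1 + 2 * V.ε) * V.F q ^ 2 / V.σ 1 - 2 * V.F q / V.σ 1 * V.F q + (V.F q / V.σ 1) ^ 2 * V.σ 1 = 2 * V.ε * V.F q ^ 2 / V.σ 1 := by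
    field_simp; ring
  linarith

open Classical in
theorem main (V : AC ι) : ∃ (a : ∀ s, ZMod (V.sd s)) (n : ℕ → ℤ),
    (#{q ∈ V.Q | (∀ s, (q : ZMod (V.sd s)) ≠ a s) ∧ ∀ p ∈ V.P1, ¬ (p:ℤ) ∣ q - n p} : ℝ) ≤
      V.σ 1 * #V.Q * Real.exp (-(V.m / (32 * V.σ 1 * V.y))) + 8 * V.ε * #V.Q + 768 * V.ε * V.y := by
  have hs := σ_pos (V := V) V.hκ
  have hs1 := σ_le_one (V := V) V.hκ
  have hε := V.hε
  have hy := V.hy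
  have hm := V.hm0
  set μ := V.m / (32 * V.σ 1 * V.y) with hμ
  set Ψ : (∀ s, ZMod (V.sd s)) → ℝ := fun a => (∑ q ∈ V.Q, Real.exp (-μ) * ind V.sd {q} a) +
    (∑ q ∈ V.Q, (4 * V.σ 1 ^ 2 / V.F q ^ 2) * (ind V.sd {q} a * (V.X q a - V.F q / V.σ 1) ^ 2)) +
    (∑ p ∈ V.P1, (8 * V.κ / (V.m * V.y)) * (V.Z p a - V.e p) ^ 2) with hΨ
  have hE : Ea V.sd Ψ ≤ V.σ 1 * #V.Q * Real.exp (-μ) + 8 * V.ε * #V.Q + 768 * V.ε * V.y := by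
    rw [hΨ, Ea_add V.sd (fun a => (∑ q ∈ V.Q, Real.exp (-μ) * ind V.sd {q} a) +
      (∑ q ∈ V.Q, (4 * V.σ 1 ^ 2 / V.F q ^ 2) * (ind V.sd {q} a * (V.X q a - V.F q / V.σ 1) ^ 2))), Ea_add, Ea_sum, Ea_sum, Ea_sum]
    simp only [Ea_mul]
    refine add_le_add (add_le_add ?_ ?_) ?_
    · rw [sum_congr rfl fun q _ => by rw [Eind]]; rw [sum_const, nsmul_eq_mul]; exact le_of_eq (by ring)
    · have : ∀ q ∈ V.Q, 4 * V.σ 1 ^ 2 / V.F q ^ 2 * Ea V.sd (fun a => ind V.sd {q} a * (V.X q a - V.F q / V.σ 1) ^ 2) ≤ 8 * V.ε := by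
        intro q hq
        have hFp := F_pos hq
        calc _ ≤ 4 * V.σ 1 ^ 2 / V.F q ^ 2 * (2 * V.ε * V.F q ^ 2 / V.σ 1) := mul_le_mul_of_nonneg_left (VarX hq) (by positivity)
          _ = 8 * V.ε * V.σ 1 := by field_simp; ring
          _ ≤ _ := by nlinarith
      refine (sum_le_sum this).trans (le_of_eq ?_)
      rw [sum_const, nsmul_eq_mul]; ring
    · refine (sum_le_sum fun p hp => mul_le_mul_of_nonneg_left (VarZ hp) (by positivity)).trans ?_
      rw [sum_const, nsmul_eq_mul]
      have h3 := V.num3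
      calc _ = (#V.P1 * V.κ) * (48 * V.ε * V.y / V.m) := by field_simp; ring
        _ ≤ 16 * V.m * (48 * V.ε * V.y / V.m) := mul_le_mul_of_nonneg_right h3 (by positivity)
        _ = _ := by field_simp; ring
  obtain ⟨a, ha⟩ := Ea_exists V.sd hE
  set good := V.P1.filter (fun p => V.Z p a ≤ 4 * V.y) with hgood
  set Bd : ℤ → ℝ := fun q => ∑ p ∈ V.P1.filter (fun p => ¬ V.Z p a ≤ 4 * V.y), ∑ i ∈ range V.κ, V.W p (q - i * p) a with hBd
  set Qa := V.Q.filter (fun q => ∀ s, (q : ZMod (V.sd s)) ≠ a s) with hQa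
  have hind : ∀ q, q ∈ Qa → ind V.sd {q} a = 1 := fun q hq => by
    rw [ind, if_pos]; intro s u hu; rw [mem_singleton.1 hu]; exact (mem_filter.1 hq).2 s
  set T := Qa.filter (fun q => V.F q / (2 * V.σ 1) ≤ V.X q a ∧ Bd q ≤ V.m / (8 * V.σ 1)) with hT
  obtain ⟨f, hf⟩ := cover_lemma V.N0 V.hN0 (fun p n => V.W p n a / (4 * V.y)) (fun p n => div_nonneg (W_nonneg p n a) (by positivity))
    (fun p n q => (p:ℤ) ∣ q - n) T good (fun p hp => by
      rw [← sum_div]; exact div_le_one_of_le₀ (mem_filter.1 hp).2 (by positivity)) (fun _ => 1) (fun _ => zero_le_one)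
  refine ⟨a, f, le_trans ?_ ha⟩
  have hcov : ∀ q ∈ T, ∏ p ∈ good, (1 - ∑ n ∈ V.N0, if (p:ℤ) ∣ q - n then V.W p n a / (4 * V.y) else 0) ≤ Real.exp (-μ) := by
    intro q hq
    have hqT := (mem_filter.1 hq).2
    have hqQ : q ∈ V.Q := (mem_filter.1 (mem_filter.1 hq).1).1
    have hc : ∀ p ∈ good, (∑ i ∈ range V.κ, V.W p (q - i * p) a) / (4 * V.y) ≤ ∑ n ∈ V.N0, if (p:ℤ) ∣ q - n then V.W p n a / (4 * V.y) else 0 := by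
      intro p hp
      have hp1 : p ∈ V.P1 := (mem_filter.1 hp).1
      rw [← sum_filter, ← sum_div]
      refine div_le_div_of_nonneg_right ?_ (by positivity)
      rw [← sum_image (f := fun n => V.W p n a) (g := fun i : ℕ => q - i * p)]
      · refine sum_le_sum_of_subset_of_nonneg ?_ fun n _ _ => W_nonneg p n a
        intro n hn
        obtain ⟨i, hi, rfl⟩ := mem_image.1 hn
        exact mem_filter.2 ⟨V.hQN q hqQ p hp1 i (mem_range.1 hi), ⟨i, by ring⟩⟩
      · intro i _ i' _ h
        have hp0 : (p:ℤ) ≠ 0 := by exact_mod_cast (V.hP p hp1).ne_zero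
        simp only [sub_right_inj] at h
        exact_mod_cast mul_right_cancel₀ hp0 h
    have h1 : ∏ p ∈ good, (1 - ∑ n ∈ V.N0, if (p:ℤ) ∣ q - n then V.W p n a / (4 * V.y) else 0) ≤
        ∏ p ∈ good, Real.exp (-((∑ i ∈ range V.κ, V.W p (q - i * p) a) / (4 * V.y))) := by
      refine prod_le_prod (fun p hp => ?_) fun p hp => ?_
      · have h2 : ∑ n ∈ V.N0, (if (p:ℤ) ∣ q - n then V.W p n a / (4 * V.y) else 0) ≤ ∑ n ∈ V.N0, V.W p n a / (4 * V.y) :=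
          sum_le_sum fun n _ => by split_ifs; exacts [le_rfl, div_nonneg (W_nonneg p n a) (by positivity)]
        rw [← sum_div] at h2
        have : V.Z p a / (4 * V.y) ≤ 1 := div_le_one_of_le₀ (mem_filter.1 hp).2 (by positivity)
        rw [Z] at this
        linarith
      · have := hc p hp
        have h3 := Real.add_one_le_exp (-((∑ i ∈ range V.κ, V.W p (q - i * p) a) / (4 * V.y)))
        linarith
    refine h1.trans ?_
    rw [← Real.exp_sum, Real.exp_le_exp, sum_neg_distrib, neg_le_neg_iff, ← sum_div, le_div_iff₀ (by positivity)]
    have h4 : ∑ p ∈ good, ∑ i ∈ range V.κ, V.W p (q - i * p) a + Bd q = V.X q a := sum_filter_add_sum_filter_not _ _ _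
    have h5 : V.m / 2 / (2 * V.σ 1) ≤ V.F q / (2 * V.σ 1) := div_le_div_of_nonneg_right (F_ge hqQ) (by positivity)
    have h6 : μ * (4 * V.y) = V.m / 2 / (2 * V.σ 1) - V.m / (8 * V.σ 1) := by rw [hμ]; field_simp; norm_num
    linarith [hqT.1, hqT.2]
  -- split the count
  have hsplit : (#{q ∈ V.Q | (∀ s, (q : ZMod (V.sd s)) ≠ a s) ∧ ∀ p ∈ V.P1, ¬ (p:ℤ) ∣ q - f p} : ℝ) ≤
      (∑ q ∈ T, if ∀ p ∈ good, ¬ (p:ℤ) ∣ q - f p then (1:ℝ) else 0) +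
      (#(Qa.filter fun q => V.X q a < V.F q / (2 * V.σ 1)) : ℝ) + #(Qa.filter fun q => V.m / (8 * V.σ 1) < Bd q) := by
    rw [← sum_filter, sum_const, nsmul_eq_mul, mul_one]
    norm_cast
    refine (card_le_card ?_).trans ((card_union_le _ _).trans (Nat.add_le_add_right (card_union_le _ _) _))
    intro q hq
    rw [mem_filter] at hq
    have hqa : q ∈ Qa := mem_filter.2 ⟨hq.1, hq.2.1⟩
    by_cases h1 : V.X q a < V.F q / (2 * V.σ 1)
    · exact mem_union_left _ (mem_union_right _ (mem_filter.2 ⟨hqa, h1⟩))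
    by_cases h2 : V.m / (8 * V.σ 1) < Bd q
    · exact mem_union_right _ (mem_filter.2 ⟨hqa, h2⟩)
    push Not at h1 h2
    exact mem_union_left _ (mem_union_left _ (mem_filter.2 ⟨mem_filter.2 ⟨hqa, h1, h2⟩, fun p hp => hq.2.2 p (mem_filter.1 hp).1⟩))
  refine hsplit.trans (add_le_add (add_le_add ?_ ?_) ?_)
  · refine (le_of_eq (sum_congr rfl fun q _ => by congr)).trans (hf.trans ?_)
    refine ((sum_le_sum fun q hq => show (1:ℝ) * _ ≤ Real.exp (-μ) * ind V.sd {q} a from ?_).trans ?_)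
    · rw [one_mul, hind q (mem_filter.1 hq).1, mul_one]; exact (le_of_eq (prod_congr rfl fun p _ => by congr 1; exact sum_congr rfl fun n _ => by congr)).trans (hcov q hq)
    · exact sum_le_sum_of_subset_of_nonneg ((filter_subset _ _).trans (filter_subset _ _)) fun q _ _ =>
        mul_nonneg (Real.exp_pos _).le (ind_nonneg _ _ _)
  · rw [card_eq_sum_ones, Nat.cast_sum]
    refine (sum_le_sum fun q hq => show ((1:ℕ):ℝ) ≤ (4 * V.σ 1 ^ 2 / V.F q ^ 2) * (ind V.sd {q} a * (V.X q a - V.F q / V.σ 1) ^ 2) from ?_).trans ?_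
    · obtain ⟨h1, h2⟩ := mem_filter.1 hq
      have hFp := F_pos (mem_filter.1 h1).1
      rw [hind q h1, one_mul, Nat.cast_one]
      have h3 : V.F q / (2 * V.σ 1) ≤ V.F q / V.σ 1 - V.X q a := by
        have : V.F q / V.σ 1 = V.F q / (2 * V.σ 1) + V.F q / (2 * V.σ 1) := by field_simp; ring
        linarith
      have h4 : (V.F q / (2 * V.σ 1)) ^ 2 ≤ (V.X q a - V.F q / V.σ 1) ^ 2 := by
        rw [← neg_sub, neg_sq]; exact pow_le_pow_left₀ (by positivity) h3 2
      calc (1:ℝ) = (4 * V.σ 1 ^ 2 / V.F q ^ 2) * (V.F q / (2 * V.σ 1)) ^ 2 := by field_simp; norm_num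
        _ ≤ _ := mul_le_mul_of_nonneg_left h4 (by positivity)
    · exact sum_le_sum_of_subset_of_nonneg ((filter_subset _ _).trans (filter_subset _ _)) fun q _ _ =>
        mul_nonneg (by positivity) (mul_nonneg (ind_nonneg _ _ _) (sq_nonneg _))
  · have hBd0 : ∀ q, 0 ≤ Bd q := fun q => sum_nonneg fun p _ => sum_nonneg fun i _ => W_nonneg _ _ _
    have h1 : (#(Qa.filter fun q => V.m / (8 * V.σ 1) < Bd q) : ℝ) ≤ ∑ q ∈ V.Q, 8 / V.m * Bd q := by
      rw [card_eq_sum_ones, Nat.cast_sum]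
      refine (sum_le_sum fun q hq => show ((1:ℕ):ℝ) ≤ 8 / V.m * Bd q from ?_).trans
        (sum_le_sum_of_subset_of_nonneg ((filter_subset _ _).trans (filter_subset _ _)) fun q _ _ => mul_nonneg (by positivity) (hBd0 q))
      have h2 := (mem_filter.1 hq).2
      have h3 : V.m / 8 ≤ V.m / (8 * V.σ 1) := div_le_div_of_nonneg_left hm.le (by positivity) (by linarith)
      calc ((1:ℕ):ℝ) = 8 / V.m * (V.m / 8) := by field_simp; norm_num
        _ ≤ _ := mul_le_mul_of_nonneg_left (h3.trans h2.le) (by positivity)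
    refine h1.trans ?_
    rw [← mul_sum, hBd]
    simp only
    rw [sum_comm]
    have h2 : ∀ p ∈ V.P1.filter (fun p => ¬ V.Z p a ≤ 4 * V.y), ∑ q ∈ V.Q, ∑ i ∈ range V.κ, V.W p (q - i * p) a ≤
        V.κ / V.y * (V.Z p a - V.e p) ^ 2 := by
      intro p hp
      obtain ⟨hp1, hp2⟩ := mem_filter.1 hp
      rw [sum_comm]
      have h3 : ∀ i ∈ range V.κ, ∑ q ∈ V.Q, V.W p (q - i * p) a ≤ V.Z p a := by
        intro i hi
        rw [← sum_image (f := fun n => V.W p n a) (g := fun q : ℤ => q - i * p) (fun q _ q' _ h => by simpa using h)]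
        refine sum_le_sum_of_subset_of_nonneg ?_ fun n _ _ => W_nonneg p n a
        intro n hn
        obtain ⟨q, hq, rfl⟩ := mem_image.1 hn
        exact V.hQN q hq p hp1 i (mem_range.1 hi)
      refine (sum_le_sum h3).trans ?_
      rw [sum_const, card_range, nsmul_eq_mul, div_mul_eq_mul_div, mul_div_assoc]
      refine mul_le_mul_of_nonneg_left ?_ (by positivity)
      rw [le_div_iff₀ hy]
      have := e_le hp1
      have := e_nonneg (V := V) p
      push Not at hp2
      nlinarith
    refine (mul_le_mul_of_nonneg_left (sum_le_sum h2) (by positivity)).trans ?_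
    rw [mul_sum]
    refine (sum_le_sum fun p _ => le_of_eq ?_).trans (sum_le_sum_of_subset_of_nonneg (filter_subset _ _) fun p _ _ =>
      show 0 ≤ (8 * V.κ / (V.m * V.y)) * (V.Z p a - V.e p) ^ 2 from mul_nonneg (by positivity) (sq_nonneg _))
    field_simp
end AC

open Classical in
noncomputable def pat {α : Type} {s : ℕ} (C : Finset α) (c : α → ZMod s) (r : ZMod s) : Option α :=
  if h : ∃ a ∈ C, r + c a = 0 then some h.choose else none

section pat
variable {α : Type} [Fintype α] [DecidableEq α] {s : ℕ} (C : Finset α) (c : α → ZMod s)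

lemma pat_some (hc : Function.Injective c) (r : ZMod s) (a : α) : pat C c r = some a ↔ a ∈ C ∧ r + c a = 0 := by
  unfold pat
  split_ifs with h
  · obtain ⟨h1, h2⟩ := h.choose_spec
    rw [Option.some_inj]
    constructor
    · rintro rfl; exact ⟨h1, h2⟩
    · rintro ⟨h3, h4⟩
      exact hc (add_left_cancel (h2.trans h4.symm))
  · simp only [false_iff, reduceCtorEq]
    exact fun h5 => h ⟨a, h5⟩

lemma pat_congr {C C' : Finset α} {c c' : α → ZMod s} (hc : Function.Injective c) (hc' : Function.Injective c') {r r' : ZMod s}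
    (h : ∀ a, (a ∈ C ∧ r + c a = 0) ↔ (a ∈ C' ∧ r' + c' a = 0)) : pat C c r = pat C' c' r' := by
  refine Option.ext fun a => ?_
  rw [pat_some C c hc, pat_some C' c' hc', h]

lemma pden_pat [NeZero s] (hc : Function.Injective c) : pden s (pat C c) = pr C (1 / (s:ℝ)) := by
  have hs : (s:ℝ) ≠ 0 := Nat.cast_ne_zero.2 (NeZero.ne s)
  have h1 : ∀ a, pden s (pat C c) (some a) = pr C (1 / (s:ℝ)) (some a) := by
    intro a
    simp only [pden, pr, pat_some C c hc]
    split_ifs with h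
    · have : ({r | a ∈ C ∧ r + c a = 0} : Finset (ZMod s)) = {-c a} := by
        ext r; simp [h, eq_neg_iff_add_eq_zero]
      rw [this]; simp
    · simp [h]
  have h2 : ∑ x, pden s (pat C c) x = 1 := by
    simp only [pden]
    rw [← sum_div, ← Nat.cast_sum, ← card_eq_sum_card_fiberwise (fun _ _ => mem_univ _), card_univ, ZMod.card, div_self hs]
  have h3 := sum_pr C (1 / (s:ℝ))
  funext x
  cases x with
  | some a => exact h1 a
  | none =>
    rw [Fintype.sum_option] at h2 h3
    have : ∑ a, pden s (pat C c) (some a) = ∑ a, pr C (1 / (s:ℝ)) (some a) := sum_congr rfl fun a _ => h1 a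
    linarith

lemma pden_pair_left {β : Type} [Fintype β] [DecidableEq β] [NeZero s] (X X' : ZMod s → β) (a : β) :
    ∑ b, pden s (fun r => (X r, X' r)) (a, b) = pden s X a := by
  simp only [pden]
  rw [← sum_div, ← Nat.cast_sum]
  congr 2
  rw [card_eq_sum_card_fiberwise (f := X') (t := univ) (fun _ _ => mem_univ _)]
  refine sum_congr rfl fun b _ => ?_
  congr 1; ext r; simp [Prod.ext_iff]

lemma pden_pair_right {β : Type} [Fintype β] [DecidableEq β] [NeZero s] (X X' : ZMod s → β) (b : β) :
    ∑ a, pden s (fun r => (X r, X' r)) (a, b) = pden s X' b := by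
  simp only [pden]
  rw [← sum_div, ← Nat.cast_sum]
  congr 2
  rw [card_eq_sum_card_fiberwise (f := X) (t := univ) (fun _ _ => mem_univ _)]
  refine sum_congr rfl fun b _ => ?_
  congr 1; ext r; simp [Prod.ext_iff, and_comm]

lemma pden_nonneg' {β : Type} [DecidableEq β] [NeZero s] (X : ZMod s → β) (a : β) : 0 ≤ pden s X a := by
  unfold pden; positivity

lemma sum_pr_some (C : Finset α) (q : ℝ) : ∑ a, pr C q (some a) = #C * q := by
  simp [pr, sum_ite_mem]

/-- existence of the excess measure -/
lemma rho_exists [NeZero s] (C' : Finset α) (c' : α → ZMod s) (hc : Function.Injective c) (hc' : Function.Injective c')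
    (κ : ℝ) (hκ : #C ≤ κ) (hκ' : #C' ≤ κ) (hs : κ ≤ s) (t : ℝ) (ht : 0 ≤ t)
    (hb : t < 3 * κ * (1 / (s:ℝ)) → ∀ a ∈ C, ∀ b ∈ C', c a ≠ c' b) :
    ∃ ρ : Option α → Option α → ℝ, (∀ a b, 0 ≤ ρ a b) ∧
      (∀ a b, pden s (fun r => (pat C c r, pat C' c' r)) (a, b) ≤ pr C (1 / (s:ℝ)) a * pr C' (1 / (s:ℝ)) b + ρ a b) ∧
      ∑ a, ∑ b, ρ a b ≤ 2 * κ ^ 2 * (1 / (s:ℝ)) ^ 2 + t := by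
  classical
  set J := pden s (fun r => (pat C c r, pat C' c' r)) with hJ
  have hs0 : (0:ℝ) < s := Nat.cast_pos.2 (NeZero.pos s)
  set q : ℝ := 1 / (s:ℝ) with hq
  have hq0 : 0 < q := by positivity
  have hsq : κ * q ≤ 1 := by rw [hq, mul_one_div]; exact div_le_one_of_le₀ hs hs0.le
  have hC : #C * q ≤ 1 := (mul_le_mul_of_nonneg_right hκ hq0.le).trans hsq
  have hC' : #C' * q ≤ 1 := (mul_le_mul_of_nonneg_right hκ' hq0.le).trans hsq
  have hL : ∀ a, ∑ b, J (a, b) = pr C q a := fun a => by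
    rw [hJ, pden_pair_left, pden_pat C c hc]
  have hRr : ∀ b, ∑ a, J (a, b) = pr C' q b := fun b => by
    rw [hJ, pden_pair_right, pden_pat C' c' hc']
  have hJ0 : ∀ a, 0 ≤ J a := fun a => pden_nonneg' _ a
  have hp : ∀ a, 0 ≤ pr C q a := pr_nonneg C hq0.le hC
  have hp' : ∀ a, 0 ≤ pr C' q a := pr_nonneg C' hq0.le hC'
  have hκ0 : 0 ≤ κ := (Nat.cast_nonneg _).trans hκ
  have hJl : ∀ a b, J (a, b) ≤ pr C q a := fun a b => by
    rw [← hL]; exact single_le_sum (f := fun b => J (a, b)) (fun b _ => hJ0 _) (mem_univ b)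
  have hJr : ∀ a b, J (a, b) ≤ pr C' q b := fun a b => by
    rw [← hRr]; exact single_le_sum (f := fun a => J (a, b)) (fun b _ => hJ0 _) (mem_univ a)
  by_cases hbad : 3 * κ * q ≤ t
  · refine ⟨fun a b => if a = none ∧ b = none then #C' * q else J (a, b), ?_, ?_, ?_⟩
    · intro a b; dsimp only; split_ifs; exacts [by positivity, hJ0 _]
    · intro a b; dsimp only; split_ifs with h
      · obtain ⟨rfl, rfl⟩ := h
        refine (hJl none none).trans ?_
        simp only [pr]
        nlinarith [mul_nonneg (Nat.cast_nonneg (α := ℝ) #C) hq0.le, mul_nonneg (Nat.cast_nonneg (α := ℝ) #C') hq0.le]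
      · have := mul_nonneg (hp a) (hp' b); linarith
    · rw [Fintype.sum_option]
      have h1 : ∑ a, ∑ b, (if (some a : Option α) = none ∧ b = none then #C' * q else J (some a, b)) = #C * q := by
        simp only [reduceCtorEq, false_and, if_false]
        rw [← sum_pr_some]; exact sum_congr rfl fun a _ => hL _
      have h2 : ∑ b, (if (none : Option α) = none ∧ b = none then #C' * q else J (none, b)) ≤ #C' * q + #C' * q := by
        rw [Fintype.sum_option]
        simp only [reduceCtorEq, and_false, if_false, and_self, if_true]
        gcongr
        rw [← sum_pr_some]; exact sum_le_sum fun b _ => hJr _ _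
      have h3 := mul_le_mul_of_nonneg_right hκ hq0.le
      have h4 := mul_le_mul_of_nonneg_right hκ' hq0.le
      have : 0 ≤ 2 * κ ^ 2 * q ^ 2 := by positivity
      rw [h1]; linarith
  · refine ⟨fun a b => if a = none then (if b = none then 0 else pr C' q b * (#C * q)) else
        if b = none then pr C q a * (#C' * q) else 0, ?_, ?_, ?_⟩
    · intro a b; dsimp only
      have := hp a; have := hp' b
      split_ifs <;> positivity
    · have hz : ∀ a b, J (some a, some b) = 0 := by
        intro a b
        simp only [hJ, pden]
        rw [filter_false_of_mem]; · simp
        intro r _ h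
        rw [Prod.mk.injEq, pat_some C c hc, pat_some C' c' hc'] at h
        exact hb (not_le.1 hbad) a h.1.1 b h.2.1 (add_left_cancel (h.1.2.trans h.2.2.symm))
      intro a b; dsimp only
      cases a with
      | none =>
        cases b with
        | none =>
          simp only [if_true, add_zero]
          have h1 := hL none
          rw [Fintype.sum_option] at h1
          have h2 : ∑ b, J (none, some b) = #C' * q := by
            rw [← sum_pr_some]; refine sum_congr rfl fun b _ => ?_
            rw [← hRr, Fintype.sum_option]; simp [hz]
          rw [h2] at h1
          simp only [pr] at h1 ⊢
          nlinarith [mul_nonneg (mul_nonneg (Nat.cast_nonneg (α := ℝ) #C) hq0.le) (mul_nonneg (Nat.cast_nonneg (α := ℝ) #C') hq0.le)]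
        | some b =>
          simp only [if_true, reduceCtorEq, if_false]
          refine (hJr _ _).trans (le_of_eq ?_)
          simp only [pr]; ring
      | some a =>
        cases b with
        | none =>
          simp only [if_true, reduceCtorEq, if_false]
          refine (hJl _ _).trans (le_of_eq ?_)
          simp only [pr]; ring
        | some b =>
          simp only [reduceCtorEq, if_false, add_zero]
          rw [hz]; exact mul_nonneg (hp _) (hp' _)
    · rw [Fintype.sum_option, Fintype.sum_option]
      simp only [Fintype.sum_option, if_true, reduceCtorEq, if_false, sum_const_zero, add_zero, zero_add]
      rw [← sum_mul, ← sum_mul, sum_pr_some, sum_pr_some]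
      have h5 : (#C:ℝ) * #C' ≤ κ * κ := mul_le_mul hκ hκ' (by positivity) hκ0
      nlinarith [mul_le_mul_of_nonneg_right h5 (sq_nonneg q)]
end pat

structure QS (ι : Type) [Fintype ι] where
  V : SV ι
  WT : ℕ
  hWT : 0 < WT
  hWs : ∀ s, Nat.Coprime WT (V.sd s)
  P1 : Finset ℕ
  hP : ∀ p ∈ P1, p.Prime
  hPκ : ∀ p ∈ P1, V.kap < p
  hPs : ∀ p ∈ P1, ∀ s, V.sd s < p
  hκ1 : 1 ≤ V.kap
  hk : ∀ p ∈ P1, ∀ n : ℤ, (#{h : Fin V.kap | IsCoprime (n + h.val * p) (WT:ℤ)} : ℝ) ≤ V.kk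
  hL1 : V.kk * (2 * V.L1) ≤ Real.log V.R / 4 * V.I0
  hR1 : 1 < V.R
  h3 : ∏ s, (1 + V.kap * V.q s ^ 2) ≤ 3
  hγ : 1 ≤ V.GG ^ 2 / (16 * V.I0)
  w : ℝ
  hw0 : 0 < w
  hw : ∀ s, w ≤ V.sd s
  δ : ℝ
  hδ : ∑ s, V.q s ^ 2 ≤ δ
  Λ : ℕ
  hΛ : ∀ p ∈ P1, ∀ p' ∈ P1, ∀ d d' : ℤ, |d| < V.kap → |d'| < V.kap → d * p - d' * p' ≠ 0 →
    #{s | (V.sd s : ℤ) ∣ d * p - d' * p'} ≤ Λ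
  ε : ℝ
  hε : Real.exp (81 * (2 * V.kap ^ 2 * δ + V.kap ^ 2 * Λ * (3 * V.kap / w))) ≤ 1 + ε

namespace QS
variable {ι : Type} [Fintype ι] [DecidableEq ι] (Q : QS ι)

instance (s : ι) : NeZero (Q.V.sd s) := ⟨(Q.V.prime s).ne_zero⟩

def A (p : ℕ) (n : ℤ) : Finset (Fin Q.V.kap) := {h | IsCoprime (n + h.val * p) (Q.WT:ℤ)}

/-- pattern shifts -/
def sh (p : ℕ) (d : ℤ) (s : ι) (h : Fin Q.V.kap) : ZMod (Q.V.sd s) := (((h.val : ℤ) - d) * p : ℤ)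

noncomputable def wt (p : ℕ) (n : ℤ) : ℝ :=
  Lin (Q.A p n) Q.V.q (Q.V.yy (Q.A p n)) (fun s => pat (Q.A p n) (Q.sh p 0 s) n) ^ 2 / Q.V.NN (Q.A p n)

noncomputable def ff (p : ℕ) (i : Fin Q.V.kap) (q : ℤ) : ℝ :=
  Lin ((Q.A p (q - i.val * p)).erase i) Q.V.q (Q.V.YY i ((Q.A p (q - i.val * p)).erase i))
    (fun s => pat ((Q.A p (q - i.val * p)).erase i) (Q.sh p i.val s) q) ^ 2 / Q.V.NN (Q.A p (q - i.val * p))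

variable {Q}

lemma hcard : Fintype.card (Fin Q.V.kap) ≤ Q.V.kap := by simp

lemma sh_inj {p : ℕ} (hp : p ∈ Q.P1) (d : ℤ) (s : ι) : Function.Injective (Q.sh p d s) := by
  intro h h' e
  unfold sh at e
  rw [ZMod.intCast_eq_intCast_iff_dvd_sub] at e
  have h1 : ((Q.V.sd s : ℕ) : ℤ) ∣ ((h'.val : ℤ) - h.val) * p := by
    convert e using 1; ring
  have hs : Prime ((Q.V.sd s : ℕ) : ℤ) := Nat.prime_iff_prime_int.1 (Q.V.prime s)
  rcases hs.dvd_or_dvd h1 with h2 | h2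
  · have := Q.V.kap_lt s
    have := h.isLt; have := h'.isLt
    have h3 := Int.eq_zero_of_abs_lt_dvd h2 (by rw [abs_lt]; constructor <;> omega)
    exact Fin.ext (by omega)
  · rw [Int.natCast_dvd_natCast] at h2
    have := (Nat.prime_dvd_prime_iff_eq (Q.V.prime s) (Q.hP p hp)).1 h2
    have := Q.hPs p hp s
    omega

lemma A_mod {p : ℕ} {n n' : ℤ} (h : (Q.WT : ℤ) ∣ n - n') : Q.A p n = Q.A p n' := by
  unfold A
  ext a
  simp only [mem_filter, mem_univ, true_and]
  obtain ⟨k, hk⟩ := h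
  have : n + a.val * p = n' + a.val * p + Q.WT * k := by rw [← hk]; ring
  rw [this, IsCoprime.add_mul_left_left_iff]

lemma wt_nonneg (p : ℕ) (n : ℤ) : 0 ≤ Q.wt p n :=
  div_nonneg (sq_nonneg _) (zero_le_one.trans (Q.V.NN_one _))
lemma ff_nonneg (p : ℕ) (i) (n : ℤ) : 0 ≤ Q.ff p i n :=
  div_nonneg (sq_nonneg _) (zero_le_one.trans (Q.V.NN_one _))

lemma sq_bound {a S R : ℝ} (h : |a| ≤ S) (hS : S ≤ 3 * R ^ 3) : a ^ 2 ≤ 9 * R ^ 6 := by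
  rw [← sq_abs]
  calc |a| ^ 2 ≤ (3 * R ^ 3) ^ 2 := pow_le_pow_left₀ (abs_nonneg _) (h.trans hS) 2
    _ = _ := by ring

lemma wt_le (p : ℕ) (n : ℤ) : Q.wt p n ≤ 9 * Q.V.R ^ 6 :=
  (div_le_self (sq_nonneg _) (Q.V.NN_one _)).trans
    (sq_bound (Q.V.Lin_abs_le _ _ _) (Q.V.S1_yy hcard Q.h3 _))
lemma ff_le (p : ℕ) (i) (n : ℤ) : Q.ff p i n ≤ 9 * Q.V.R ^ 6 :=
  (div_le_self (sq_nonneg _) (Q.V.NN_one _)).trans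
    (sq_bound (Q.V.Lin_abs_le _ _ _) (Q.V.S1_YY hcard Q.h3 _ _ (notMem_erase _ _)))

lemma A_mem {p : ℕ} {q : ℤ} (i : Fin Q.V.kap) (hq : IsCoprime q (Q.WT:ℤ)) : i ∈ Q.A p (q - i.val * p) := by
  simp [A, hq]

lemma wt_eq_ff {p : ℕ} (hp : p ∈ Q.P1) {q : ℤ} (i : Fin Q.V.kap) (hq : IsCoprime q (Q.WT:ℤ)) (hs : ∀ s, ¬ (Q.V.sd s : ℤ) ∣ q) :
    Q.wt p (q - i.val * p) = Q.ff p i q := by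
  unfold wt ff
  set A := Q.A p (q - i.val * p) with hA
  have hi : i ∈ A := A_mem i hq
  congr 2
  have h0 : ∀ (s : ι) (a : Fin Q.V.kap), ((q - i.val * p : ℤ) : ZMod (Q.V.sd s)) + Q.sh p 0 s a = (q : ZMod (Q.V.sd s)) + Q.sh p i.val s a := by
    intro s a; unfold sh; push_cast; ring
  have hpe : (fun s => pat A (Q.sh p 0 s) ((q - i.val * p : ℤ) : ZMod (Q.V.sd s))) = fun s => pat (A.erase i) (Q.sh p i.val s) (q : ZMod (Q.V.sd s)) := by
    funext s
    refine pat_congr (sh_inj hp _ s) (sh_inj hp _ s) fun a => ?_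
    rw [h0, mem_erase]
    constructor
    · rintro ⟨h1, h2⟩
      refine ⟨⟨?_, h1⟩, h2⟩
      rintro rfl
      refine hs s ((ZMod.intCast_zmod_eq_zero_iff_dvd q _).1 ?_)
      unfold sh at h2; simpa using h2
    · rintro ⟨⟨_, h1⟩, h2⟩; exact ⟨h1, h2⟩
  rw [hpe]
  have h2 := Q.V.Lin_YY i (A.erase i) (notMem_erase _ _) (fun s => pat (A.erase i) (Q.sh p i.val s) (q : ZMod (Q.V.sd s))) (by
    intro s h; rw [pat_some _ _ (sh_inj hp _ s)] at h; exact (notMem_erase _ _) h.1)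
  rw [insert_erase hi] at h2
  exact h2

lemma co : Pairwise (Function.onFun Nat.Coprime Q.V.sd) := fun s t h =>
  (Nat.coprime_primes (Q.V.prime s) (Q.V.prime t)).2 fun e => h (Q.V.inj e)

lemma hunit (s : ι) : IsUnit ((Q.WT : ℤ) : ZMod (Q.V.sd s)) := by
  rw [Int.cast_natCast, ZMod.isUnit_iff_coprime]; exact Q.hWs s

lemma sum_range_mul_split (N W : ℕ) (f : ℤ → ℝ) :
    ∑ j ∈ range (N * W), f j = ∑ b ∈ range W, ∑ m ∈ range N, f (b + W * m) := by
  induction N with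
  | zero => simp
  | succ N ih =>
    rw [Nat.succ_mul, sum_range_add, ih, ← sum_add_distrib]
    refine sum_congr rfl fun b _ => ?_
    rw [sum_range_succ]; congr 2; push_cast; ring

lemma NN_pos (A : Finset (Fin Q.V.kap)) : 0 < Q.V.NN A := zero_lt_one.trans_le (Q.V.NN_one _)

lemma tot_class {p : ℕ} (hp : p ∈ Q.P1) (b : ℤ) (N : ℕ) :
    ∑ m ∈ range N, Q.wt p (b + Q.WT * m) ≤ N + 18 * Q.V.R ^ 6 := by
  set A := Q.A p b with hA
  have h1 : ∀ m : ℕ, Q.A p (b + Q.WT * m) = A := fun m => A_mod (by simp)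
  simp only [wt, h1]
  rw [← sum_div, div_le_iff₀ (NN_pos _)]
  have h2 := interval_single Q.V.sd co (fun s => pat A (Q.sh p 0 s)) A (Q.V.yy A) b Q.WT hunit N
  have h3 : (fun s => pden (Q.V.sd s) (pat A (Q.sh p 0 s))) = fun s => pr A (Q.V.q s) := by
    funext s; exact pden_pat A _ (sh_inj hp _ s)
  have h4 := Q.V.Eyy_le hcard A
  rw [h3] at h2
  have h5 := (abs_le.1 h2).2
  have h6 : 2 * S1 Q.V.sd (Q.V.yy A) ^ 2 ≤ 18 * Q.V.R ^ 6 := by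
    have := sq_bound (le_of_eq (abs_of_nonneg (show 0 ≤ S1 Q.V.sd (Q.V.yy A) from sum_nonneg fun v _ =>
      mul_nonneg (abs_nonneg _) (zero_le_one.trans (DD_pos Q.V.sd v))))) (Q.V.S1_yy hcard Q.h3 A)
    linarith
  have h7 : (N:ℝ) * EE (fun s => pr A (Q.V.q s)) (fun x => Lin A Q.V.q (Q.V.yy A) x ^ 2) ≤ N * Q.V.NN A :=
    mul_le_mul_of_nonneg_left h4 (Nat.cast_nonneg _)
  have h8 := Q.V.NN_one A
  have hR : 0 < Q.V.R := zero_lt_one.trans Q.hR1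
  have h9 : 18 * Q.V.R ^ 6 ≤ 18 * Q.V.R ^ 6 * Q.V.NN A := le_mul_of_one_le_right (by positivity) h8
  have h10 : ∑ m ∈ range N, (Lin A Q.V.q (Q.V.yy A) fun s => pat A (Q.sh p 0 s) ((b + Q.WT * m : ℤ) : ZMod (Q.V.sd s))) ^ 2
      - N * EE (fun s => pr A (Q.V.q s)) (fun x => Lin A Q.V.q (Q.V.yy A) x ^ 2) ≤ 2 * S1 Q.V.sd (Q.V.yy A) ^ 2 := h5
  linarith

lemma tot_all {p : ℕ} (hp : p ∈ Q.P1) (M : ℤ) (N : ℕ) :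
    ∑ j ∈ range (N * Q.WT), Q.wt p (M + j) ≤ Q.WT * (N + 18 * Q.V.R ^ 6) := by
  have := sum_range_mul_split N Q.WT (fun j => Q.wt p (M + j))
  rw [this]
  calc _ ≤ ∑ b ∈ range Q.WT, ((N:ℝ) + 18 * Q.V.R ^ 6) := sum_le_sum fun b _ => by
        have := tot_class hp (M + b) N
        simpa only [add_assoc] using this
    _ = _ := by simp; ring
end QS

namespace QS
variable {ι : Type} [Fintype ι] [DecidableEq ι] (Q : QS ι)

def Cc (b : ℤ) (p : ℕ) (i : Fin Q.V.kap) : Finset (Fin Q.V.kap) := (Q.A p (b - i.val * p)).erase i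
noncomputable def e (b : ℤ) (p : ℕ) (i : Fin Q.V.kap) : ℝ := Q.V.EY i (Q.Cc b p i) / Q.V.NN (Q.A p (b - i.val * p))
noncomputable def L0 (b : ℤ) (p : ℕ) (i : Fin Q.V.kap) (q : ℤ) : ℝ :=
  Lin (Q.Cc b p i) (fun s => 1 / (Q.V.sd s : ℝ)) (Q.V.YY i (Q.Cc b p i)) (fun s => pat (Q.Cc b p i) (Q.sh p i.val s) q) ^ 2
noncomputable def γ : ℝ := Q.V.GG ^ 2 / (16 * Q.V.I0)
variable {Q}

lemma ff_class (b : ℤ) (p : ℕ) (i : Fin Q.V.kap) (m : ℕ) :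
    Q.ff p i (b + Q.WT * m) = Q.L0 b p i (b + Q.WT * m) / Q.V.NN (Q.A p (b - i.val * p)) := by
  have : Q.A p (b + Q.WT * m - i.val * p) = Q.A p (b - i.val * p) := A_mod (by
    have : (b + Q.WT * m - i.val * p - (b - i.val * p) : ℤ) = Q.WT * m := by ring
    rw [this]; simp)
  unfold ff L0
  rw [this]; rfl

lemma S1sq (b : ℤ) (p : ℕ) (i : Fin Q.V.kap) : S1 Q.V.sd (Q.V.YY i (Q.Cc b p i)) ^ 2 ≤ 9 * Q.V.R ^ 6 :=
  sq_bound (le_of_eq (abs_of_nonneg (sum_nonneg fun v _ =>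
      mul_nonneg (abs_nonneg _) (zero_le_one.trans (DD_pos Q.V.sd v))))) (Q.V.S1_YY hcard Q.h3 _ _ (notMem_erase _ _))

lemma Cc_card (b : ℤ) {p : ℕ} (hp : p ∈ Q.P1) (i : Fin Q.V.kap) : (#(Q.Cc b p i) : ℝ) ≤ Q.V.kk := by
  refine le_trans ?_ (Q.hk p hp (b - i.val * p))
  exact_mod_cast card_le_card (erase_subset _ _)

lemma L1_nn : 0 ≤ Q.V.L1 := Q.V.L1_nonneg

lemma e_ge {b : ℤ} (hb : IsCoprime b (Q.WT:ℤ)) {p : ℕ} (hp : p ∈ Q.P1) (i : Fin Q.V.kap) : Q.γ ≤ Q.e b p i := by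
  unfold e γ
  rw [le_div_iff₀ (NN_pos _)]
  have h := Q.V.EY_ge hcard i (Q.Cc b p i) (notMem_erase _ _) (Cc_card b hp i)
    ((mul_le_mul_of_nonneg_right (Cc_card b hp i) (by have := L1_nn (Q := Q); positivity)).trans Q.hL1) Q.hR1
  rwa [Cc, insert_erase (A_mem i hb)] at h

lemma mean_class (b : ℤ) {p : ℕ} (hp : p ∈ Q.P1) (i : Fin Q.V.kap) (N : ℕ) :
    |∑ m ∈ range N, Q.ff p i (b + Q.WT * m) - N * Q.e b p i| ≤ 18 * Q.V.R ^ 6 := by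
  simp only [ff_class]
  have h2 := interval_single Q.V.sd co (fun s => pat (Q.Cc b p i) (Q.sh p i.val s)) (Q.Cc b p i) (Q.V.YY i (Q.Cc b p i)) b Q.WT hunit N
  have h3 : (fun s => pden (Q.V.sd s) (pat (Q.Cc b p i) (Q.sh p i.val s))) = fun s => pr (Q.Cc b p i) (Q.V.q s) := by
    funext s; exact pden_pat _ _ (sh_inj hp _ s)
  rw [h3] at h2
  have h4 : |∑ m ∈ range N, Q.L0 b p i (b + Q.WT * m) - N * Q.V.EY i (Q.Cc b p i)| ≤ 18 * Q.V.R ^ 6 :=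
    h2.trans (by linarith [S1sq b p i])
  have h5 := Q.V.NN_one (Q.A p (b - i.val * p))
  rw [← sum_div, e, ← mul_div_assoc, ← sub_div, abs_div, abs_of_pos (NN_pos _)]
  exact (div_le_self (abs_nonneg _) h5).trans h4

lemma badset {p p' : ℕ} (hp : p ∈ Q.P1) (hp' : p' ∈ Q.P1) (hne : p ≠ p') (b : ℤ) (i i' : Fin Q.V.kap) (S : Finset ι)
    (hS : ∀ s ∈ S, ∃ a ∈ Q.Cc b p i, ∃ a' ∈ Q.Cc b p' i', Q.sh p i.val s a = Q.sh p' i'.val s a') :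
    #S ≤ Q.V.kap ^ 2 * Q.Λ := by
  classical
  set T : Finset (Fin Q.V.kap × Fin Q.V.kap) := Q.Cc b p i ×ˢ Q.Cc b p' i' with hT
  have h1 : S ⊆ T.biUnion fun a => {s | (Q.V.sd s : ℤ) ∣ ((a.1.val:ℤ) - i.val) * p - ((a.2.val:ℤ) - i'.val) * p'} := by
    intro s hs
    obtain ⟨a, ha, a', ha', h⟩ := hS s hs
    refine mem_biUnion.2 ⟨(a, a'), mem_product.2 ⟨ha, ha'⟩, mem_filter.2 ⟨mem_univ _, ?_⟩⟩
    unfold sh at h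
    rw [ZMod.intCast_eq_intCast_iff_dvd_sub] at h
    rw [← dvd_neg]; simpa using h
  refine (card_le_card h1).trans (card_biUnion_le.trans ((sum_le_card_nsmul _ _ Q.Λ ?_).trans ?_))
  · rintro ⟨a, a'⟩ ha
    obtain ⟨ha1, ha2⟩ := mem_product.1 ha
    have n1 : a.val ≠ i.val := fun h => ((mem_erase.1 ha1).1 (Fin.ext h))
    have n2 : a'.val ≠ i'.val := fun h => ((mem_erase.1 ha2).1 (Fin.ext h))
    have := a.isLt; have := a'.isLt; have := i.isLt; have := i'.isLt
    refine Q.hΛ p hp p' hp' _ _ (by rw [abs_lt]; constructor <;> simp only <;> omega) (by rw [abs_lt]; constructor <;> simp only <;> omega) ?_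
    intro h0
    have h2 : (p:ℤ) ∣ ((a'.val:ℤ) - i'.val) * p' := ⟨(a.val:ℤ) - i.val, by simp only at h0; linarith⟩
    rcases (Nat.prime_iff_prime_int.1 (Q.hP p hp)).dvd_or_dvd h2 with h3 | h3
    · have := Q.hPκ p hp
      have := Int.eq_zero_of_abs_lt_dvd h3 (by rw [abs_lt]; constructor <;> omega)
      omega
    · rw [Int.natCast_dvd_natCast] at h3
      exact hne ((Nat.prime_dvd_prime_iff_eq (Q.hP p hp) (Q.hP p' hp')).1 h3)
  · rw [smul_eq_mul]
    refine Nat.mul_le_mul_right _ ?_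
    rw [hT, card_product, sq]
    exact Nat.mul_le_mul (card_le_univ _ |>.trans hcard) (card_le_univ _ |>.trans hcard)

noncomputable def JJ (Q : QS ι) (b : ℤ) (p p' : ℕ) (i i' : Fin Q.V.kap) : ℝ :=
  ∑ x : ι → Option (Fin Q.V.kap), ∑ x' : ι → Option (Fin Q.V.kap),
    (∏ s, pden (Q.V.sd s) (fun r => (pat (Q.Cc b p i) (Q.sh p i.val s) r, pat (Q.Cc b p' i') (Q.sh p' i'.val s) r)) (x s, x' s)) *
    (Lin (Q.Cc b p i) (fun s => 1 / (Q.V.sd s:ℝ)) (Q.V.YY i (Q.Cc b p i)) x ^ 2 *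
      Lin (Q.Cc b p' i') (fun s => 1 / (Q.V.sd s:ℝ)) (Q.V.YY i' (Q.Cc b p' i')) x' ^ 2)

lemma MY_nonneg (i : Fin Q.V.kap) (C : Finset (Fin Q.V.kap)) : 0 ≤ Q.V.MY i C := sum_nonneg fun v _ => mul_nonneg (sq_nonneg _)
    (prod_nonneg fun s _ => by unfold SV.q; split_ifs <;> positivity)

lemma JJ_le (b : ℤ) {p p' : ℕ} (hp : p ∈ Q.P1) (hp' : p' ∈ Q.P1) (hne : p ≠ p') (i i' : Fin Q.V.kap) :
    JJ Q b p p' i i' ≤ (Q.V.EY i (Q.Cc b p i) * Q.V.EY i' (Q.Cc b p' i')) * (1 + 4 * Q.ε) := by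
  classical
  set C := Q.Cc b p i with hC
  set C' := Q.Cc b p' i' with hC'
  have hcκ : ∀ C : Finset (Fin Q.V.kap), (#C : ℝ) ≤ Q.V.kap := fun C => by exact_mod_cast (card_le_univ C).trans hcard
  obtain ⟨t, ht⟩ : ∃ t : ι → ℝ, t = fun s => if ∃ a ∈ C, ∃ a' ∈ C', Q.sh p i.val s a = Q.sh p' i'.val s a' then 3 * (Q.V.kap:ℝ) * (1 / (Q.V.sd s : ℝ)) else 0 := ⟨_, rfl⟩
  have ht0 : ∀ s, 0 ≤ t s := fun s => by rw [ht]; dsimp only; split_ifs <;> positivity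
  have hρ := fun s => rho_exists C (Q.sh p i.val s) C' (Q.sh p' i'.val s) (sh_inj hp _ s) (sh_inj hp' _ s)
    (Q.V.kap : ℝ) (hcκ C) (hcκ C') (by exact_mod_cast (Q.V.kap_lt s).le) (t s) (ht0 s) (by
      intro h a ha a' ha' h2
      rw [ht] at h; dsimp only at h; rw [if_pos ⟨a, ha, a', ha', h2⟩] at h; exact lt_irrefl _ h)
  choose ρ hρ0 hρJ hρr using hρ
  obtain ⟨r, hr⟩ : ∃ r : ι → ℝ, r = fun s => 2 * (Q.V.kap:ℝ) ^ 2 * (1 / (Q.V.sd s : ℝ)) ^ 2 + t s := ⟨_, rfl⟩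
  have hr0 : ∀ s, 0 ≤ r s := fun s => by rw [hr]; exact add_nonneg (by positivity) (ht0 s)
  have hjb := joint_bound C C' Q.V.q (fun s => by unfold SV.q; positivity) (Q.V.card_q_le hcard C) (Q.V.card_q_le hcard C')
    (Q.V.YY i C) (Q.V.YY i C) (Q.V.YY i' C') (Q.V.YY i' C') (fun v => le_of_eq (abs_of_nonneg (Q.V.YY_nonneg _ _ _)))
    (fun v => le_of_eq (abs_of_nonneg (Q.V.YY_nonneg _ _ _))) (Q.V.YY_update i C) (Q.V.YY_update i' C')
    (fun s a b => pden (Q.V.sd s) (fun r => (pat C (Q.sh p i.val s) r, pat C' (Q.sh p' i'.val s) r)) (a, b)) ρ r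
    (fun s a b => pden_nonneg' _ _) hρ0 hρJ (fun s => by rw [hr]; exact hρr s)
  have hprod : ∏ s, (1 + 81 * r s) - 1 ≤ Q.ε := by
    have h1 : ∏ s, (1 + 81 * r s) ≤ Real.exp (∑ s, 81 * r s) := by
      rw [Real.exp_sum]
      refine prod_le_prod (fun s _ => ?_) fun s _ => by rw [add_comm]; exact Real.add_one_le_exp _
      have := hr0 s
      positivity
    have h2 : ∑ s, r s ≤ 2 * (Q.V.kap:ℝ) ^ 2 * Q.δ + (Q.V.kap:ℝ) ^ 2 * Q.Λ * (3 * Q.V.kap / Q.w) := by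
      simp only [hr, ht]
      rw [sum_add_distrib, ← mul_sum, ← sum_filter]
      refine add_le_add (mul_le_mul_of_nonneg_left Q.hδ (by positivity)) ?_
      refine (sum_le_card_nsmul _ _ (3 * Q.V.kap / Q.w) fun s _ => ?_).trans ?_
      · rw [mul_one_div]; exact div_le_div_of_nonneg_left (by positivity) Q.hw0 (Q.hw s)
      · rw [nsmul_eq_mul]
        refine mul_le_mul_of_nonneg_right ?_ (div_nonneg (by positivity) Q.hw0.le)
        exact_mod_cast badset hp hp' hne b i i' _ fun s hs => (mem_filter.1 hs).2
    rw [← mul_sum] at h1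
    have h3 := h1.trans (Real.exp_le_exp.2 (mul_le_mul_of_nonneg_left h2 (by norm_num)))
    linarith [Q.hε]
  have hεp : 0 ≤ ∏ s, (1 + 81 * r s) - 1 := by
    rw [sub_nonneg]
    have h0 : ∏ s : ι, (1:ℝ) ≤ ∏ s, (1 + 81 * r s) := by
      refine prod_le_prod (fun _ _ => zero_le_one) fun s _ => ?_
      have := hr0 s
      linarith
    rwa [prod_const_one] at h0
  have hM1 : Q.V.MY i C ≤ 2 * Q.V.EY i C := Q.V.MY_le i C (Cc_card b hp i)
  have hM2 : Q.V.MY i' C' ≤ 2 * Q.V.EY i' C' := Q.V.MY_le i' C' (Cc_card b hp' i')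
  have hE1 : 0 ≤ Q.V.EY i C := by linarith [MY_nonneg (Q := Q) i C]
  have hE2 : 0 ≤ Q.V.EY i' C' := by linarith [MY_nonneg (Q := Q) i' C']
  have hjb2 : JJ Q b p p' i i' ≤ Q.V.EY i C * Q.V.EY i' C' + Q.V.MY i C * Q.V.MY i' C' * (∏ s, (1 + 81 * r s) - 1) := hjb
  refine hjb2.trans ?_
  have hM0 : 0 ≤ Q.V.MY i' C' := MY_nonneg (Q := Q) _ _
  clear hjb hjb2
  generalize Q.V.EY i C = E1 at *
  generalize Q.V.EY i' C' = E2 at *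
  generalize Q.V.MY i C = M1 at *
  generalize Q.V.MY i' C' = M2 at *
  generalize ∏ s, (1 + 81 * r s) - 1 = ee at *
  have h4 : M1 * M2 ≤ (2 * E1) * (2 * E2) := mul_le_mul hM1 hM2 hM0 (by positivity)
  have h5 : M1 * M2 * ee ≤ (2 * E1) * (2 * E2) * Q.ε :=
    mul_le_mul h4 hprod hεp (by positivity)
  linarith

lemma L0_pair (b : ℤ) (p p' : ℕ) (i i' : Fin Q.V.kap) (N : ℕ) :
    ∑ m ∈ range N, Q.L0 b p i (b + Q.WT * m) * Q.L0 b p' i' (b + Q.WT * m) ≤ N * JJ Q b p p' i i' + 162 * Q.V.R ^ 12 := by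
  have h2 := (abs_le.1 (interval_double Q.V.sd co (fun s => pat (Q.Cc b p i) (Q.sh p i.val s)) (fun s => pat (Q.Cc b p' i') (Q.sh p' i'.val s)) (Q.Cc b p i) (Q.Cc b p' i')
    (Q.V.YY i (Q.Cc b p i)) (Q.V.YY i' (Q.Cc b p' i')) b Q.WT hunit N)).2
  have h8 : S1 Q.V.sd (Q.V.YY i (Q.Cc b p i)) ^ 2 * S1 Q.V.sd (Q.V.YY i' (Q.Cc b p' i')) ^ 2 ≤ (9 * Q.V.R ^ 6) * (9 * Q.V.R ^ 6) :=
    mul_le_mul (S1sq b p i) (S1sq b p' i') (sq_nonneg _) (by have := Q.hR1; positivity)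
  simp only [L0, JJ]
  have h13 : 2 * ((9 * Q.V.R ^ 6) * (9 * Q.V.R ^ 6)) = 162 * Q.V.R ^ 12 := by ring
  linarith

lemma pair_class (b : ℤ) {p p' : ℕ} (hp : p ∈ Q.P1) (hp' : p' ∈ Q.P1) (hne : p ≠ p') (i i' : Fin Q.V.kap) (N : ℕ) :
    ∑ m ∈ range N, Q.ff p i (b + Q.WT * m) * Q.ff p' i' (b + Q.WT * m) ≤
      N * (Q.e b p i * Q.e b p' i') * (1 + 4 * Q.ε) + 162 * Q.V.R ^ 12 := by
  simp only [ff_class]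
  have hJ3 := JJ_le b hp hp' hne i i'
  have h6 := L0_pair b p p' i i' N
  unfold e
  generalize Q.V.EY i (Q.Cc b p i) = E1 at *
  generalize Q.V.EY i' (Q.Cc b p' i') = E2 at *
  have hn1' := Q.V.NN_one (Q.A p (b - i.val * p))
  have hn2' := Q.V.NN_one (Q.A p' (b - i'.val * p'))
  generalize Q.V.NN (Q.A p (b - i.val * p)) = n1 at *
  generalize Q.V.NN (Q.A p' (b - i'.val * p')) = n2 at *
  have hn : 1 ≤ n1 * n2 := one_le_mul_of_one_le_of_one_le hn1' hn2'
  have h9 : ∑ m ∈ range N, Q.L0 b p i (b + Q.WT * m) / n1 * (Q.L0 b p' i' (b + Q.WT * m) / n2) =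
      (∑ m ∈ range N, Q.L0 b p i (b + Q.WT * m) * Q.L0 b p' i' (b + Q.WT * m)) / (n1 * n2) := by
    rw [sum_div]; refine sum_congr rfl fun m _ => ?_
    rw [div_mul_div_comm]
  rw [h9, div_le_iff₀ (by positivity)]
  have h10 : N * (E1 / n1 * (E2 / n2)) * (1 + 4 * Q.ε) * (n1 * n2) = N * ((E1 * E2) * (1 + 4 * Q.ε)) := by
    field_simp
  have h11 : 162 * Q.V.R ^ 12 ≤ 162 * Q.V.R ^ 12 * (n1 * n2) := le_mul_of_one_le_right (by have := Q.hR1; positivity) hn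
  rw [add_mul, h10]
  have h12 := mul_le_mul_of_nonneg_left hJ3 (Nat.cast_nonneg (α := ℝ) N)
  linarith

noncomputable def FF (Q : QS ι) (q : ℤ) : ℝ := ∑ p ∈ Q.P1, ∑ i, Q.ff p i q
noncomputable def mm (Q : QS ι) : ℝ := #Q.P1 * Q.V.kap * Q.γ

lemma var_class {b : ℤ} (hb : IsCoprime b (Q.WT:ℤ)) (hP0 : 0 < #Q.P1) (N : ℕ) :
    (#{m ∈ range N | Q.FF (b + Q.WT * (m:ℕ)) < Q.mm / 2} : ℝ) ≤ 16 * Q.ε * N + 1440 * Q.V.R ^ 12 + 36 * Q.V.R ^ 6 * N / #Q.P1 := by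
  classical
  have hR1 := Q.hR1
  have hR0 : 0 < Q.V.R := zero_lt_one.trans hR1
  have hR6 : Q.V.R ^ 6 ≤ Q.V.R ^ 12 := pow_le_pow_right₀ hR1.le (by norm_num)
  set K := Q.P1 ×ˢ (univ : Finset (Fin Q.V.kap)) with hK
  set E : ℕ × Fin Q.V.kap → ℝ := fun a => Q.e b a.1 a.2 with hE
  set f : ℕ × Fin Q.V.kap → ℕ → ℝ := fun a m => Q.ff a.1 a.2 (b + Q.WT * m) with hf
  set M := ∑ a ∈ K, E a with hM
  have hγ1 : 1 ≤ Q.γ := Q.hγ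
  have hκ1 := Q.hκ1
  have hε0 : 0 ≤ Q.ε := by
    have h1 := Q.hε
    have h2 : 0 ≤ Q.δ := (sum_nonneg fun s _ => sq_nonneg _).trans Q.hδ
    have h3 : (0:ℝ) ≤ 81 * (2 * Q.V.kap ^ 2 * Q.δ + Q.V.kap ^ 2 * Q.Λ * (3 * Q.V.kap / Q.w)) := by
      have := Q.hw0; positivity
    linarith [Real.one_le_exp h3]
  have hEγ : ∀ a ∈ K, Q.γ ≤ E a := fun a ha => e_ge hb (mem_product.1 ha).1 a.2
  have hE0 : ∀ a ∈ K, 0 ≤ E a := fun a ha => by linarith [hEγ a ha]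
  have hKc : (#K : ℝ) = #Q.P1 * Q.V.kap := by rw [hK, card_product]; simp
  have hMm : Q.mm ≤ M := by
    have := card_nsmul_le_sum K E Q.γ hEγ
    rw [nsmul_eq_mul, hKc] at this; exact this
  have hT0 : (0:ℝ) < #K := by rw [hKc]; positivity
  have hMT : (#K:ℝ) ≤ M := by
    refine le_trans ?_ hMm
    unfold mm; rw [hKc]; exact le_mul_of_one_le_right (by positivity) hγ1
  have hM0 : 0 < M := hT0.trans_le hMT
  have hFF : ∀ m : ℕ, Q.FF (b + Q.WT * m) = ∑ a ∈ K, f a m := fun m => by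
    rw [hK, sum_product]; rfl
  have hmean : ∀ a ∈ K, |∑ m ∈ range N, f a m - N * E a| ≤ 18 * Q.V.R ^ 6 := fun a ha =>
    mean_class b (mem_product.1 ha).1 a.2 N
  have hS1 : N * M - 18 * Q.V.R ^ 6 * #K ≤ ∑ m ∈ range N, Q.FF (b + Q.WT * m) := by
    simp only [hFF]; rw [sum_comm, hM, mul_sum, mul_comm, ← nsmul_eq_mul, ← sum_const, ← sum_sub_distrib]
    exact sum_le_sum fun a ha => by linarith [(abs_le.1 (hmean a ha)).1]
  have hpair : ∀ a ∈ K, ∀ a' ∈ K, ∑ m ∈ range N, f a m * f a' m ≤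
      (N * (E a * E a') * (1 + 4 * Q.ε) + 162 * Q.V.R ^ 12) +
        if a.1 = a'.1 then 9 * Q.V.R ^ 6 * (N * E a + 18 * Q.V.R ^ 6) else 0 := by
    intro a ha a' ha'
    have := hE0 a ha; have := hE0 a' ha'
    split_ifs with h
    · have h1 : ∑ m ∈ range N, f a m * f a' m ≤ 9 * Q.V.R ^ 6 * ∑ m ∈ range N, f a m := by
        rw [mul_sum]; refine sum_le_sum fun m _ => ?_
        rw [mul_comm]; exact mul_le_mul_of_nonneg_right (ff_le _ _ _) (ff_nonneg _ _ _)
      have h2 := (abs_le.1 (hmean a ha)).2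
      have h3 : ∑ m ∈ range N, f a m ≤ N * E a + 18 * Q.V.R ^ 6 := by linarith
      have h4 := mul_le_mul_of_nonneg_left h3 (show 0 ≤ 9 * Q.V.R ^ 6 by positivity)
      have h5 : 0 ≤ N * (E a * E a') * (1 + 4 * Q.ε) + 162 * Q.V.R ^ 12 := by positivity
      linarith
    · rw [add_zero]; exact pair_class b (mem_product.1 ha).1 (mem_product.1 ha').1 h a.2 a'.2 N
  have hS2 : ∑ m ∈ range N, Q.FF (b + Q.WT * m) ^ 2 ≤ N * M ^ 2 * (1 + 4 * Q.ε) + 162 * Q.V.R ^ 12 * #K ^ 2 +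
      Q.V.kap * (9 * Q.V.R ^ 6 * (N * M + 18 * Q.V.R ^ 6 * #K)) := by
    have h1 : ∑ m ∈ range N, Q.FF (b + Q.WT * m) ^ 2 = ∑ a ∈ K, ∑ a' ∈ K, ∑ m ∈ range N, f a m * f a' m := by
      simp only [hFF, sq, sum_mul_sum]
      rw [sum_comm]; refine sum_congr rfl fun a _ => ?_
      rw [sum_comm]
    rw [h1]
    refine (sum_le_sum fun a ha => sum_le_sum fun a' ha' => hpair a ha a' ha').trans ?_
    simp only [sum_add_distrib]
    refine add_le_add (add_le_add ?_ ?_) ?_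
    · refine le_of_eq ?_
      simp only [← sum_mul, ← mul_sum]
      rw [sq, hM]
    · simp only [sum_const, nsmul_eq_mul]; refine le_of_eq ?_; ring
    · have h2 : ∀ a ∈ K, ∑ a' ∈ K, (if a.1 = a'.1 then 9 * Q.V.R ^ 6 * (N * E a + 18 * Q.V.R ^ 6) else 0) =
          Q.V.kap * (9 * Q.V.R ^ 6 * (N * E a + 18 * Q.V.R ^ 6)) := by
        intro a ha
        rw [hK, sum_product, sum_comm]
        simp only [sum_ite_eq, (mem_product.1 ha).1, if_true, sum_const, card_univ, Fintype.card_fin, nsmul_eq_mul]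
      rw [sum_congr rfl h2, ← mul_sum, ← mul_sum, sum_add_distrib, ← mul_sum, sum_const, nsmul_eq_mul]
      refine le_of_eq ?_; ring
  have hvar : ∑ m ∈ range N, (Q.FF (b + Q.WT * m) - M) ^ 2 ≤ M ^ 2 * (4 * Q.ε * N + 360 * Q.V.R ^ 12 + 9 * Q.V.R ^ 6 * N / #Q.P1) := by
    have h1 : ∑ m ∈ range N, (Q.FF (b + Q.WT * m) - M) ^ 2 =
        ∑ m ∈ range N, Q.FF (b + Q.WT * m) ^ 2 - 2 * M * ∑ m ∈ range N, Q.FF (b + Q.WT * m) + N * M ^ 2 := by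
      simp only [sub_sq]
      rw [sum_add_distrib, sum_sub_distrib, mul_sum, sum_const, card_range, nsmul_eq_mul]
      congr 2; exact sum_congr rfl fun m _ => by ring
    rw [h1]
    have h2 := mul_le_mul_of_nonneg_left hS1 (show 0 ≤ 2 * M by positivity)
    have a1 : 162 * Q.V.R ^ 12 * (#K:ℝ) ^ 2 ≤ 162 * Q.V.R ^ 12 * M ^ 2 := by gcongr
    have a2 : (2 * M) * (18 * Q.V.R ^ 6 * #K) ≤ 36 * Q.V.R ^ 12 * M ^ 2 := by
      calc (2 * M) * (18 * Q.V.R ^ 6 * #K) ≤ (2 * M) * (18 * Q.V.R ^ 12 * M) := by gcongr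
        _ = _ := by ring
    have hκM : (Q.V.kap : ℝ) * #Q.P1 ≤ M := by rw [mul_comm, ← hKc]; exact hMT
    have hP1 : (1:ℝ) ≤ #Q.P1 := by exact_mod_cast hP0
    have a3 : Q.V.kap * (9 * Q.V.R ^ 6 * (18 * Q.V.R ^ 6 * #K)) ≤ 162 * Q.V.R ^ 12 * M ^ 2 := by
      calc (Q.V.kap:ℝ) * (9 * Q.V.R ^ 6 * (18 * Q.V.R ^ 6 * #K)) = 162 * Q.V.R ^ 12 * (Q.V.kap * #K) := by ring
        _ ≤ 162 * Q.V.R ^ 12 * (M * M) := by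
          gcongr
          exact le_trans (le_mul_of_one_le_right (by positivity) hP1) hκM
        _ = _ := by ring
    have a4 : Q.V.kap * (9 * Q.V.R ^ 6 * (N * M)) ≤ M ^ 2 * (9 * Q.V.R ^ 6 * N / #Q.P1) := by
      rw [← mul_div_assoc, le_div_iff₀ (by positivity)]
      calc Q.V.kap * (9 * Q.V.R ^ 6 * (N * M)) * #Q.P1 = (Q.V.kap * #Q.P1) * (9 * Q.V.R ^ 6 * (N * M)) := by ring
        _ ≤ M * (9 * Q.V.R ^ 6 * (N * M)) := by gcongr
        _ = _ := by ring
    nlinarith [hS2, h2, a1, a2, a3, a4]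
  have hcheb : (#{m ∈ range N | Q.FF (b + Q.WT * (m:ℕ)) < Q.mm / 2} : ℝ) * (M / 2) ^ 2 ≤ ∑ m ∈ range N, (Q.FF (b + Q.WT * m) - M) ^ 2 := by
    rw [← nsmul_eq_mul]
    refine (card_nsmul_le_sum _ (fun m : ℕ => (Q.FF (b + Q.WT * m) - M) ^ 2) _ fun m hm => ?_).trans
      (sum_le_sum_of_subset_of_nonneg (filter_subset _ _) fun _ _ _ => sq_nonneg _)
    have h1 := (mem_filter.1 hm).2
    rw [← neg_sub, neg_sq]
    exact pow_le_pow_left₀ (by positivity) (by linarith) 2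
  have h := hcheb.trans hvar
  have h2 : (#{m ∈ range N | Q.FF (b + Q.WT * (m:ℕ)) < Q.mm / 2} : ℝ) * (M / 2) ^ 2 ≤
     (16 * Q.ε * N + 1440 * Q.V.R ^ 12 + 36 * Q.V.R ^ 6 * N / #Q.P1) * (M / 2) ^ 2 := by
    refine h.trans (le_of_eq ?_); ring
  exact le_of_mul_le_mul_right h2 (by positivity)

theorem qc (hP0 : 0 < #Q.P1) (N : ℕ) :
    (#{q ∈ range (N * Q.WT) | IsCoprime ((q:ℕ):ℤ) (Q.WT:ℤ) ∧ Q.FF (q:ℕ) < Q.mm / 2} : ℝ) ≤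
      Q.WT * (16 * Q.ε * N + 1440 * Q.V.R ^ 12 + 36 * Q.V.R ^ 6 * N / #Q.P1) := by
  classical
  have hR1 := Q.hR1
  have h0 := sum_range_mul_split N Q.WT (fun q => if IsCoprime q (Q.WT:ℤ) ∧ Q.FF q < Q.mm / 2 then (1:ℝ) else 0)
  rw [← sum_filter, sum_const, nsmul_eq_mul, mul_one] at h0
  have h1 : ∀ b ∈ range Q.WT, ∑ m ∈ range N, (if IsCoprime ((b:ℤ) + Q.WT * m) (Q.WT:ℤ) ∧ Q.FF (b + Q.WT * m) < Q.mm / 2 then (1:ℝ) else 0)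
      ≤ 16 * Q.ε * N + 1440 * Q.V.R ^ 12 + 36 * Q.V.R ^ 6 * N / #Q.P1 := by
    intro b _
    by_cases hb : IsCoprime (b:ℤ) (Q.WT:ℤ)
    · refine le_trans (le_of_eq ?_) (var_class hb hP0 N)
      rw [← sum_filter, sum_const, nsmul_eq_mul, mul_one]
      congr 2; ext m; simp [hb]
    · have hε0 : 0 ≤ Q.ε := by
        have h1 := Q.hε
        have h2 : 0 ≤ Q.δ := (sum_nonneg fun s _ => sq_nonneg _).trans Q.hδ
        have h3 : (0:ℝ) ≤ 81 * (2 * Q.V.kap ^ 2 * Q.δ + Q.V.kap ^ 2 * Q.Λ * (3 * Q.V.kap / Q.w)) := by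
          have := Q.hw0; positivity
        linarith [Real.one_le_exp h3]
      refine le_trans (le_of_eq ?_) (show (0:ℝ) ≤ _ by positivity)
      refine sum_eq_zero fun m _ => if_neg ?_
      rw [IsCoprime.add_mul_left_left_iff]; exact fun h => hb h.1
  have h2 := h0.le.trans (sum_le_card_nsmul _ _ _ h1)
  rw [card_range, nsmul_eq_mul] at h2
  refine le_trans (le_of_eq ?_) h2
  congr!
end QS

lemma sum_inj_le {α β : Type*} {s : Finset α} {t : Finset β} {f : α → ℝ} {g : β → ℝ} (i : α → β)
    (hi : ∀ a ∈ s, i a ∈ t) (hinj : Set.InjOn i s) (h : ∀ a ∈ s, f a ≤ g (i a)) (hg : ∀ b ∈ t, 0 ≤ g b) :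
    ∑ a ∈ s, f a ≤ ∑ b ∈ t, g b := by
  classical
  calc _ ≤ ∑ a ∈ s, g (i a) := Finset.sum_le_sum h
    _ = ∑ b ∈ s.image i, g b := (Finset.sum_image hinj).symm
    _ ≤ _ := Finset.sum_le_sum_of_subset_of_nonneg (by
      intro b hb; obtain ⟨a, ha, rfl⟩ := mem_image.1 hb; exact hi a ha) (fun b hb _ => hg b hb)

/-- primes up to n -/
def PP (n : ℕ) : Finset ℕ := (range (n+1)).filter Nat.Prime

lemma mem_PP {n p : ℕ} : p ∈ PP n ↔ p.Prime ∧ p ≤ n := by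
  simp [PP, Nat.lt_succ_iff, and_comm]

lemma PP_pos {n p : ℕ} (h : p ∈ PP n) : (0:ℝ) < p := by exact_mod_cast (mem_PP.1 h).1.pos

lemma sum_log_div (n : ℕ) (hn : 1 ≤ n) : ∑ p ∈ PP n, Real.log p / p ≤ 2 * Real.log n := by
  have h1 : ∏ p ∈ PP n, p ^ (n / p) ∣ n.factorial := by
    apply Finset.prod_dvd_of_isRelPrime
    · intro p hp q hq hpq
      have := (Nat.coprime_primes (mem_PP.1 hp).1 (mem_PP.1 hq).1).2 hpq
      exact Nat.coprime_iff_isRelPrime.1 (Nat.Coprime.pow _ _ this)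
    · intro p hp
      have hpp := (mem_PP.1 hp).1
      rw [hpp.pow_dvd_factorial_iff (Nat.lt_succ_self (Nat.log p n))]
      have : 1 ∈ Ico 1 (Nat.log p n).succ := by
        simp only [mem_Ico, le_refl, true_and]
        have := Nat.log_pos hpp.one_lt (mem_PP.1 hp).2
        omega
      refine le_trans ?_ (Finset.single_le_sum (f := fun i => n / p ^ i) (fun _ _ => Nat.zero_le _) this)
      simp
  have h2 : ∏ p ∈ PP n, p ^ (n / p) ≤ n ^ n :=
    (Nat.le_of_dvd (Nat.factorial_pos _) h1).trans (Nat.factorial_le_pow n)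
  have h3 : ∑ p ∈ PP n, ((n / p : ℕ) : ℝ) * Real.log p ≤ n * Real.log n := by
    have : Real.log ((∏ p ∈ PP n, p ^ (n / p) : ℕ) : ℝ) ≤ Real.log ((n ^ n : ℕ) : ℝ) := by
      apply Real.log_le_log _ (by exact_mod_cast h2)
      exact_mod_cast Finset.prod_pos (fun p hp => pow_pos (mem_PP.1 hp).1.pos _)
    push_cast at this
    rw [Real.log_prod (fun p hp => (pow_pos (PP_pos hp) _).ne'), Real.log_pow] at this
    simpa using this
  have hn0 : (0:ℝ) < n := by exact_mod_cast hn
  have h4 : ∑ p ∈ PP n, (n / 2) * (Real.log p / p) ≤ n * Real.log n := by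
    refine le_trans (Finset.sum_le_sum fun p hp => ?_) h3
    have hp0 := PP_pos hp
    have hl : 0 ≤ Real.log p := Real.log_natCast_nonneg p
    have : (n:ℝ) / (2 * p) ≤ ((n / p : ℕ) : ℝ) := by
      rw [div_le_iff₀ (by positivity)]
      have hple := (mem_PP.1 hp).2
      have h5 := Nat.div_add_mod n p
      have h6 := Nat.mod_lt n (mem_PP.1 hp).1.pos
      have h7 : 1 ≤ n / p := Nat.div_pos hple (mem_PP.1 hp).1.pos
      have : n ≤ n / p * (2 * p) := by nlinarith
      exact_mod_cast this
    calc (n:ℝ) / 2 * (Real.log p / p) = n / (2 * p) * Real.log p := by field_simp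
      _ ≤ _ := by gcongr
  rw [← Finset.mul_sum] at h4
  have : (n:ℝ) * (∑ p ∈ PP n, Real.log p / p) ≤ n * (2 * Real.log n) := by linarith
  exact le_of_mul_le_mul_left this hn0

lemma sum_rpow_le (δ : ℝ) (hδ : 0 < δ) (M : ℕ) :
    ∑ m ∈ Icc 1 M, (m:ℝ) ^ (-1 - δ) ≤ 1 + 1 / δ := by
  have key : ∀ M : ℕ, ∑ m ∈ Icc 1 (M+1), (m:ℝ) ^ (-1 - δ) ≤ 1 + (1 - ((M+1:ℕ):ℝ) ^ (-δ)) / δ := by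
    intro M
    induction M with
    | zero => simp
    | succ k ih =>
      rw [Finset.sum_Icc_succ_top (by omega)]
      have hk : (0:ℝ) < (k+1:ℕ) := by positivity
      set a : ℝ := ((k+1:ℕ):ℝ) with ha
      have hb : ((k+1+1:ℕ):ℝ) = a + 1 := by push_cast [ha]; ring
      rw [hb]
      have h1 : (a+1) ^ (-δ) * (1 + δ / (a+1)) ≤ a ^ (-δ) := by
        have : a ^ (-δ) = (a+1) ^ (-δ) * Real.exp (δ * Real.log ((a+1)/a)) := by
          rw [Real.rpow_def_of_pos hk, Real.rpow_def_of_pos (by linarith), ← Real.exp_add, Real.log_div (by linarith) hk.ne']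
          ring_nf
        rw [this]
        apply mul_le_mul_of_nonneg_left _ (by positivity)
        have h2 : 1 / (a+1) ≤ Real.log ((a+1)/a) := by
          have := Real.one_sub_inv_le_log_of_pos (x := (a+1)/a) (by positivity)
          refine le_trans (le_of_eq ?_) this
          field_simp; ring
        have h3 := Real.add_one_le_exp (δ * Real.log ((a+1)/a))
        have : δ / (a+1) ≤ δ * Real.log ((a+1)/a) := by
          rw [div_eq_mul_one_div]; gcongr
        linarith
      have h2 : (a+1) ^ (-1-δ) = (a+1) ^ (-δ) / (a+1) := by
        rw [show (-1-δ) = -δ - 1 by ring, Real.rpow_sub_one (by linarith)]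
      rw [h2]
      have : (a+1) ^ (-δ) / (a+1) ≤ (a ^ (-δ) - (a+1) ^ (-δ)) / δ := by
        rw [le_div_iff₀ hδ]
        calc _ = (a+1) ^ (-δ) * (1 + δ / (a+1)) - (a+1) ^ (-δ) := by ring
          _ ≤ _ := by linarith
      calc _ ≤ 1 + (1 - a ^ (-δ)) / δ + (a ^ (-δ) - (a+1) ^ (-δ)) / δ := by linarith
        _ = _ := by ring
  rcases M with _ | M
  · simp; positivity
  · refine (key M).trans ?_
    gcongr
    have : (0:ℝ) ≤ ((M+1:ℕ):ℝ) ^ (-δ) := by positivity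
    linarith

lemma prodE_inj {n : ℕ} : Set.InjOn (fun E : Finset ℕ => ∏ p ∈ E, p) ((PP n).powerset : Set (Finset ℕ)) := by
  intro E hE F hF h
  have aux : ∀ E ∈ (PP n).powerset, (∏ p ∈ E, p).primeFactors = E := by
    intro E hE
    exact Nat.primeFactors_prod (fun p hp => (mem_PP.1 (mem_powerset.1 hE hp)).1)
  rw [← aux E hE, ← aux F hF]
  simp only at h
  rw [h]

lemma mertens_up (n : ℕ) (hn : 3 ≤ n) : ∏ p ∈ PP n, (1 + 1 / (p:ℝ)) ≤ 16 * Real.log n := by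
  have hl : 1 ≤ Real.log n := by
    rw [Real.le_log_iff_exp_le (by positivity)]
    have : (3:ℝ) ≤ n := by exact_mod_cast hn
    linarith [Real.exp_one_lt_d9]
  set δ := 1 / Real.log n with hδ
  have hδ0 : 0 < δ := by positivity
  have h1 : ∏ p ∈ PP n, (1 + (p:ℝ) ^ (-1-δ)) ≤ 1 + 1 / δ := by
    rw [Finset.prod_one_add]
    have : ∀ E ∈ (PP n).powerset, ∏ p ∈ E, (p:ℝ) ^ (-1-δ) = ((∏ p ∈ E, p : ℕ) : ℝ) ^ (-1-δ) := by
      intro E hE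
      push_cast
      rw [Real.finsetProd_rpow _ _ (fun _ _ => by positivity)]
    rw [Finset.sum_congr rfl this, ← Finset.sum_image (f := fun m : ℕ => (m:ℝ) ^ (-1-δ)) prodE_inj]
    refine le_trans (Finset.sum_le_sum_of_subset_of_nonneg ?_ (fun _ _ _ => by positivity)) (sum_rpow_le δ hδ0 (∏ p ∈ PP n, p))
    intro m hm
    obtain ⟨E, hE, rfl⟩ := Finset.mem_image.1 hm
    rw [mem_powerset] at hE
    rw [mem_Icc]
    have hp : ∀ p ∈ PP n, 1 ≤ p := fun p hp => (mem_PP.1 hp).1.pos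
    exact ⟨Nat.one_le_iff_ne_zero.2 (Finset.prod_ne_zero_iff.2 fun p h => by have := hp p (hE h); omega), Finset.prod_le_prod_of_subset_of_one_le' hE (fun p h _ => hp p h)⟩
  have h2 : ∏ p ∈ PP n, (1 + 1 / (p:ℝ)) ≤ ∏ p ∈ PP n, ((1 + (p:ℝ) ^ (-1-δ)) * Real.exp (δ * (Real.log p / p))) := by
    apply Finset.prod_le_prod (fun _ _ => by positivity)
    intro p hp
    have hp0 := PP_pos hp
    have h3 : 1 / (p:ℝ) * (1 - δ * Real.log p) ≤ (p:ℝ) ^ (-1-δ) := by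
      rw [show (-1-δ) = -δ - 1 by ring, Real.rpow_sub_one hp0.ne', Real.rpow_def_of_pos hp0, one_div_mul_eq_div]
      apply div_le_div_of_nonneg_right _ hp0.le
      have := Real.add_one_le_exp (Real.log p * -δ)
      linarith
    have h4 : 0 ≤ (p:ℝ) ^ (-1-δ) := by positivity
    have h5 := Real.add_one_le_exp (δ * (Real.log p / p))
    have h6 : 0 ≤ δ * (Real.log p / p) := by have := Real.log_natCast_nonneg p; positivity
    have h7 : 1 / (p:ℝ) * (1 - δ * Real.log p) = 1 / p - δ * (Real.log p / p) := by ring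
    nlinarith
  rw [Finset.prod_mul_distrib, ← Real.exp_sum, ← Finset.mul_sum] at h2
  have h3 : δ * ∑ p ∈ PP n, Real.log p / p ≤ 2 := by
    calc _ ≤ δ * (2 * Real.log n) := by gcongr; exact sum_log_div n (by omega)
      _ = 2 := by rw [hδ]; field_simp
  have h4 : Real.exp 2 ≤ 8 := by
    have := Real.exp_one_lt_d9
    rw [show (2:ℝ) = 1 + 1 by norm_num, Real.exp_add]
    nlinarith [Real.exp_pos 1]
  calc _ ≤ _ := h2
    _ ≤ (1 + 1/δ) * Real.exp 2 := by gcongr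
    _ ≤ (1 + 1/δ) * 8 := by gcongr
    _ ≤ _ := by rw [hδ]; simp only [one_div_one_div]; linarith

/-- sum of reciprocals of squarefree products -/
noncomputable def UU (S : Finset ℕ) (T : ℝ) : ℝ :=
  ∑ E ∈ S.powerset, if (∏ p ∈ E, (p:ℝ)) ≤ T then ∏ p ∈ E, 1 / (p:ℝ) else 0

lemma UU_nonneg (S : Finset ℕ) (T : ℝ) : 0 ≤ UU S T := by
  unfold UU
  refine Finset.sum_nonneg fun E _ => ?_
  split_ifs <;> positivity

lemma UU_all (T : ℝ) (hT : 1 ≤ T) : Real.log T / 2 ≤ UU (PP ⌊T⌋₊) T := by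
  set N := ⌊T⌋₊ with hN
  have h1 : Real.log T ≤ ∑ i ∈ Icc 1 N, 1 / (i:ℝ) := by
    have := log_add_one_le_harmonic N
    rw [harmonic_eq_sum_Icc] at this
    push_cast at this
    simp only [one_div]
    refine le_trans (Real.log_le_log (by linarith) ?_) this
    exact (Nat.lt_floor_add_one T).le
  have h2 : ∑ m ∈ Icc 1 N, 1 / (m:ℝ)^2 ≤ 2 := by
    have := sum_rpow_le 1 one_pos N
    refine le_trans (Finset.sum_le_sum fun m _ => le_of_eq ?_) (this.trans (by norm_num))
    rw [show (-1 - 1 : ℝ) = -((2:ℕ):ℝ) by norm_num, Real.rpow_neg (by positivity), Real.rpow_natCast, one_div]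
  have h3 : ∑ i ∈ Icc 1 N, 1 / (i:ℝ) ≤ (∑ m ∈ Icc 1 N, 1 / (m:ℝ)^2) * UU (PP N) T := by
    unfold UU
    rw [← Finset.sum_filter, Finset.sum_mul_sum, ← Finset.sum_product']
    choose a b hab hsq using fun n : ℕ => Nat.sq_mul_squarefree n
    apply sum_inj_le (fun n => (b n, (a n).primeFactors))
    · intro i hi
      rw [mem_Icc] at hi
      have hi0 : i ≠ 0 := by omega
      have hb0 : b i ≠ 0 := by intro h; have := hab i; rw [h] at this; simp at this; omega
      have ha0 : a i ≠ 0 := by intro h; have := hab i; rw [h] at this; simp at this; omega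
      have hbi : b i ≤ i := by
        have := hab i
        have h1 : 1 ≤ b i := Nat.one_le_iff_ne_zero.2 hb0
        have h2 : 1 ≤ a i := Nat.one_le_iff_ne_zero.2 ha0
        nlinarith
      have hai : a i ≤ i := by
        have := hab i
        have h1 : 1 ≤ b i ^ 2 := Nat.one_le_iff_ne_zero.2 (pow_ne_zero _ hb0)
        nlinarith
      have hpa : ∏ p ∈ (a i).primeFactors, p = a i := Nat.prod_primeFactors_of_squarefree (hsq i)
      rw [mem_product, mem_Icc, mem_filter, mem_powerset]
      refine ⟨⟨by omega, by omega⟩, fun p hp => ?_, ?_⟩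
      · exact mem_PP.2 ⟨Nat.prime_of_mem_primeFactors hp, (Nat.le_of_mem_primeFactors hp).trans (hai.trans hi.2)⟩
      · have : (∏ p ∈ (a i).primeFactors, (p:ℝ)) = a i := by rw [← Nat.cast_prod, hpa]
        simp only [this]
        have h4 : ((a i : ℕ):ℝ) ≤ N := by exact_mod_cast hai.trans hi.2
        exact h4.trans (Nat.floor_le (by linarith))
    · intro i hi j hj h
      simp only [Prod.mk.injEq] at h
      have hpa : ∀ i, ∏ p ∈ (a i).primeFactors, p = a i := fun i => Nat.prod_primeFactors_of_squarefree (hsq i)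
      rw [← hab i, ← hab j, ← hpa i, ← hpa j, h.1, h.2]
    · intro i hi
      have hpa : (∏ p ∈ (a i).primeFactors, (p:ℝ)) = a i := by
        rw [← Nat.cast_prod, Nat.prod_primeFactors_of_squarefree (hsq i)]
      have : (i:ℝ) = (b i : ℝ) ^ 2 * a i := by exact_mod_cast (hab i).symm
      simp only [Finset.prod_div_distrib, Finset.prod_const_one, hpa]
      conv_lhs => rw [this]
      rw [one_div_mul_one_div]
    · intro b _; positivity
  have := UU_nonneg (PP N) T
  nlinarith

lemma UU_le_prod (S : Finset ℕ) (hS : ∀ p ∈ S, 1 ≤ p) (T : ℝ) : UU S T ≤ ∏ p ∈ S.filter (fun p : ℕ => (p:ℝ) ≤ T), (1 + 1 / (p:ℝ)) := by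
  rw [Finset.prod_one_add]
  unfold UU
  rw [← Finset.sum_filter]
  apply Finset.sum_le_sum_of_subset_of_nonneg
  · intro E hE
    rw [mem_filter, mem_powerset] at hE
    rw [mem_powerset]
    intro p hp
    rw [mem_filter]
    refine ⟨hE.1 hp, le_trans ?_ hE.2⟩
    rw [← Finset.mul_prod_erase _ _ hp]
    have : (1:ℝ) ≤ ∏ x ∈ E.erase p, (x:ℝ) := by
      apply Finset.one_le_prod
      intro i hi
      exact_mod_cast hS i (hE.1 (mem_of_mem_erase hi))
    nlinarith [(Nat.cast_nonneg p : (0:ℝ) ≤ p)]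
  · intro _ _ _; positivity

lemma UU_split (w : ℕ) (T : ℝ) : UU (PP ⌊T⌋₊) T ≤ (∏ p ∈ PP w, (1 + 1 / (p:ℝ))) * UU ((PP ⌊T⌋₊).filter (w < ·)) T := by
  rw [Finset.prod_one_add]
  unfold UU
  rw [← Finset.sum_filter, ← Finset.sum_filter, Finset.sum_mul_sum, ← Finset.sum_product']
  apply sum_inj_le (fun E => (E.filter (· ≤ w), E.filter (w < ·)))
  · intro E hE
    rw [mem_filter, mem_powerset] at hE
    rw [mem_product, mem_powerset, mem_filter, mem_powerset]
    refine ⟨fun p hp => ?_, fun p hp => ?_, ?_⟩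
    · rw [mem_filter] at hp
      exact mem_PP.2 ⟨(mem_PP.1 (hE.1 hp.1)).1, hp.2⟩
    · rw [mem_filter] at hp ⊢
      exact ⟨hE.1 hp.1, hp.2⟩
    · refine le_trans ?_ hE.2
      apply Finset.prod_le_prod_of_subset_of_one_le (filter_subset _ _)
      · intro i _; positivity
      · intro i hi _
        exact_mod_cast (mem_PP.1 (hE.1 hi)).1.pos
  · intro E _ F _ h
    simp only [Prod.mk.injEq] at h
    rw [← Finset.filter_union_filter_not_eq (· ≤ w) E, ← Finset.filter_union_filter_not_eq (· ≤ w) F]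
    simp only [not_le]
    rw [h.1, h.2]
  · intro E _
    rw [← Finset.prod_filter_mul_prod_filter_not E (· ≤ w)]
    simp only [not_le]
    exact le_rfl
  · intro b _; positivity

/-- primes in (w,n] -/
def PI (w n : ℕ) : Finset ℕ := (PP n).filter (w < ·)

lemma mem_PI {w n p : ℕ} : p ∈ PI w n ↔ p.Prime ∧ p ≤ n ∧ w < p := by
  rw [PI, mem_filter, mem_PP, and_assoc]

lemma prod_PP_ge (w : ℕ) (hw : 1 ≤ w) : Real.log w / 2 ≤ ∏ p ∈ PP w, (1 + 1 / (p:ℝ)) := by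
  have h := UU_all w (by exact_mod_cast hw)
  rw [Nat.floor_natCast] at h
  refine h.trans ((UU_le_prod _ (fun p hp => (mem_PP.1 hp).1.pos) _).trans ?_)
  rw [Finset.filter_true_of_mem]
  intro p hp
  exact_mod_cast (mem_PP.1 hp).2

lemma prod_PI_le {w n : ℕ} (hw : 3 ≤ w) (hn : w ≤ n) :
    ∏ p ∈ PI w n, (1 + 1 / (p:ℝ)) ≤ 32 * (Real.log n / Real.log w) := by
  have hl : 0 < Real.log w := Real.log_pos (by exact_mod_cast (by omega : 1 < w))
  have h1 : (∏ p ∈ PP w, (1 + 1 / (p:ℝ))) * ∏ p ∈ PI w n, (1 + 1 / (p:ℝ)) = ∏ p ∈ PP n, (1 + 1 / (p:ℝ)) := by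
    rw [← Finset.prod_filter_mul_prod_filter_not (PP n) (· ≤ w)]
    congr 1
    · congr 1
      ext p
      simp only [mem_filter, mem_PP]
      constructor
      · intro h; exact ⟨⟨h.1, h.2.trans hn⟩, h.2⟩
      · intro h; exact ⟨h.1.1, h.2⟩
    · simp only [not_le]; rfl
  have h2 := mertens_up n (by omega)
  have h3 := prod_PP_ge w (by omega)
  have h4 : 0 ≤ ∏ p ∈ PI w n, (1 + 1 / (p:ℝ)) := by positivity
  rw [← mul_div_assoc, le_div_iff₀ hl]
  nlinarith

lemma UU_upper {w n : ℕ} {T : ℝ} (hw : 3 ≤ w) (hT : w ≤ T) :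
    UU (PI w n) T ≤ 32 * (Real.log T / Real.log w) := by
  have hw0 : (3:ℝ) ≤ w := by exact_mod_cast hw
  have hl : 0 < Real.log w := Real.log_pos (by linarith)
  have hf : (⌊T⌋₊:ℝ) ≤ T := Nat.floor_le (by linarith)
  have hwf : w ≤ ⌊T⌋₊ := Nat.le_floor hT
  refine (UU_le_prod _ (fun p hp => (mem_PI.1 hp).1.pos) T).trans ?_
  refine le_trans (Finset.prod_le_prod_of_subset_of_one_le (t := PI w ⌊T⌋₊) ?_ ?_ ?_) ((prod_PI_le hw hwf).trans ?_)
  · intro p hp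
    rw [mem_filter, mem_PI] at hp
    exact mem_PI.2 ⟨hp.1.1, Nat.le_floor hp.2, hp.1.2.2⟩
  · intro _ _; positivity
  · intro p _ _
    have : (0:ℝ) ≤ 1 / p := by positivity
    linarith
  · gcongr
    exact_mod_cast (by omega : 0 < ⌊T⌋₊)

lemma UU_lower {w n : ℕ} {T : ℝ} (hw : 3 ≤ w) (hT : 1 ≤ T) (hTn : ⌊T⌋₊ ≤ n) :
    Real.log T / Real.log w / 32 ≤ UU (PI w n) T := by
  have hw0 : (3:ℝ) ≤ w := by exact_mod_cast hw
  have hl : 0 < Real.log w := Real.log_pos (by linarith)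
  have h1 := UU_all T hT
  have h2 := UU_split w T
  have h3 := mertens_up w hw
  have h4 : UU (PI w ⌊T⌋₊) T ≤ UU (PI w n) T := by
    apply Finset.sum_le_sum_of_subset_of_nonneg
    · apply Finset.powerset_mono.2
      intro p hp
      rw [mem_PI] at hp ⊢
      exact ⟨hp.1, hp.2.1.trans hTn, hp.2.2⟩
    · intro E _ _; split_ifs <;> positivity
  have h5 := UU_nonneg (PI w ⌊T⌋₊) T
  change _ ≤ _ * UU (PI w ⌊T⌋₊) T at h2
  refine le_trans ?_ h4
  rw [div_div, div_le_iff₀ (by positivity)]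
  nlinarith

noncomputable def lay (J : ℕ) (t0 r : ℝ) : ℝ :=
  ∑ j ∈ range (J+1), (1/2:ℝ) ^ j * (if r ≤ Real.exp (t0 * 2 ^ j) then 1 else 0)
noncomputable def gl (J : ℕ) (t0 r : ℝ) : ℝ := lay J t0 r / ∑ j ∈ range (J+1), (1/2:ℝ) ^ j

lemma c0_ge (J : ℕ) : (1:ℝ) ≤ ∑ j ∈ range (J+1), (1/2:ℝ) ^ j := by
  rw [Finset.sum_range_succ']
  have : (0:ℝ) ≤ ∑ k ∈ range J, (1/2:ℝ) ^ (k+1) := by positivity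
  simp; simpa using this

lemma geo2 (J : ℕ) : ∑ j ∈ range J, (1/2:ℝ) ^ j ≤ 2 := by
  have := sum_geometric_two_le J
  simpa using this

lemma lay_nonneg (J : ℕ) (t0 r : ℝ) : 0 ≤ lay J t0 r := by
  unfold lay
  refine Finset.sum_nonneg fun j _ => mul_nonneg (by positivity) ?_
  split_ifs <;> norm_num

lemma gl_nonneg (J : ℕ) (t0 r : ℝ) : 0 ≤ gl J t0 r :=
  div_nonneg (lay_nonneg J t0 r) (by have := c0_ge J; linarith)

lemma gl_anti (J : ℕ) (t0 : ℝ) : Antitone (gl J t0) := by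
  intro a b hab
  unfold gl
  apply div_le_div_of_nonneg_right _ (by have := c0_ge J; linarith)
  unfold lay
  refine Finset.sum_le_sum fun j _ => mul_le_mul_of_nonneg_left ?_ (by positivity)
  by_cases h : b ≤ Real.exp (t0 * 2 ^ j)
  · rw [if_pos h, if_pos (hab.trans h)]
  · rw [if_neg h]; split_ifs <;> norm_num

lemma gl_eq_one {J : ℕ} {t0 r : ℝ} (ht : 0 ≤ t0) (h : r ≤ Real.exp t0) : gl J t0 r = 1 := by
  unfold gl lay
  rw [div_eq_one_iff_eq (by have := c0_ge J; linarith)]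
  refine Finset.sum_congr rfl fun j _ => ?_
  rw [if_pos, mul_one]
  refine h.trans (Real.exp_le_exp.2 ?_)
  have : (1:ℝ) ≤ 2 ^ j := one_le_pow₀ (by norm_num)
  nlinarith

lemma gl_zero {J : ℕ} {t0 r : ℝ} (ht : 0 ≤ t0) (h : Real.exp (t0 * 2 ^ J) < r) : gl J t0 r = 0 := by
  unfold gl lay
  rw [Finset.sum_eq_zero, zero_div]
  intro j hj
  rw [if_neg, mul_zero]
  push Not
  refine lt_of_le_of_lt (Real.exp_le_exp.2 ?_) h
  have hj : j ≤ J := by have := mem_range.1 hj; omega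
  gcongr
  norm_num

lemma lay_sq_aux (n : ℕ) : ∀ b : ℕ → ℝ, (∀ j, 0 ≤ b j ∧ b j ≤ 1) → (∀ j, b j ^ 2 = b j) →
    (∑ j ∈ range n, (1/2:ℝ) ^ j * b j) ^ 2 ≤ 4 * ∑ j ∈ range n, (1/4:ℝ) ^ j * b j := by
  induction n with
  | zero => intro b _ _; simp
  | succ n ih =>
    intro b hb hb2
    have h1 := ih (fun j => b (j+1)) (fun j => hb _) (fun j => hb2 _)
    have hA : ∑ j ∈ range n, (1/2:ℝ) ^ j * b (j+1) ≤ 2 :=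
      (Finset.sum_le_sum fun j _ => mul_le_of_le_one_right (by positivity) (hb _).2).trans (geo2 n)
    have h2 : ∑ j ∈ range n, (1/2:ℝ) ^ (j+1) * b (j+1) = 1/2 * ∑ j ∈ range n, (1/2:ℝ) ^ j * b (j+1) := by
      rw [Finset.mul_sum]; exact Finset.sum_congr rfl fun j _ => by ring
    have h3 : ∑ j ∈ range n, (1/4:ℝ) ^ (j+1) * b (j+1) = 1/4 * ∑ j ∈ range n, (1/4:ℝ) ^ j * b (j+1) := by
      rw [Finset.mul_sum]; exact Finset.sum_congr rfl fun j _ => by ring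
    rw [Finset.sum_range_succ', Finset.sum_range_succ', h2, h3]
    have := hb2 0
    have := (hb 0).1
    simp only [pow_zero, one_mul]
    nlinarith

lemma gl_sq_le (J : ℕ) (t0 r : ℝ) (ht : 0 ≤ t0) :
    gl J t0 r ^ 2 ≤ 4 * ∑ j ∈ range (J+1), (1/4:ℝ) ^ j * (if r ≤ Real.exp (t0 * 2 ^ j) then 1 else 0) := by
  have h1 : gl J t0 r ≤ lay J t0 r := div_le_self (lay_nonneg _ _ _) (c0_ge J)
  calc gl J t0 r ^ 2 ≤ lay J t0 r ^ 2 := by gcongr; exact gl_nonneg _ _ _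
    _ ≤ _ := by
      apply lay_sq_aux
      all_goals intro j; split_ifs <;> norm_num

lemma sum_transfer (S : Finset ℕ) (f : Finset ℕ → ℝ) :
    ∑ E : Finset ↥S, f (E.map (Function.Embedding.subtype _)) = ∑ E ∈ S.powerset, f E := by
  apply Finset.sum_bij (fun E _ => E.map (Function.Embedding.subtype _))
  · intro E _
    rw [mem_powerset]
    intro p hp
    obtain ⟨a, _, rfl⟩ := mem_map.1 hp
    exact a.2
  · intro E _ F _ h; exact Finset.map_injective _ h
  · intro E hE
    rw [mem_powerset] at hE
    refine ⟨E.subtype (· ∈ S), mem_univ _, ?_⟩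
    rw [Finset.subtype_map, Finset.filter_true_of_mem (fun x hx => hE hx)]
  · intro _ _; rfl

section
variable {w n J : ℕ} {t0 : ℝ} (V : SV ↥(PI w n)) (hsd : ∀ s, V.sd s = s) (hg : V.g = gl J t0)
include hsd

lemma pE_eq (E : Finset ↥(PI w n)) : V.pE E = ∏ p ∈ E.map (Function.Embedding.subtype _), (p:ℝ) := by
  unfold SV.pE; rw [Finset.prod_map]; simp [hsd]
lemma qE_eq (E : Finset ↥(PI w n)) : V.qE E = ∏ p ∈ E.map (Function.Embedding.subtype _), 1 / (p:ℝ) := by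
  unfold SV.qE; rw [Finset.prod_map]; simp [hsd, SV.q]

lemma UU_eq (T : ℝ) : ∑ E, (if V.pE E ≤ T then 1 else 0) * V.qE E = UU (PI w n) T := by
  unfold UU
  rw [← sum_transfer]
  refine Finset.sum_congr rfl fun E _ => ?_
  rw [pE_eq V hsd, qE_eq V hsd]
  split_ifs <;> simp

include hg

lemma GG_ge (hw : 3 ≤ w) (ht : 0 ≤ t0) (hn : ⌊Real.exp (t0 * 2 ^ J)⌋₊ ≤ n) :
    (J+1) * t0 / (64 * Real.log w) ≤ V.GG := by
  have hl : 0 < Real.log w := Real.log_pos (by exact_mod_cast (by omega : 1 < w))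
  have h1 : V.GG = (∑ j ∈ range (J+1), (1/2:ℝ) ^ j * UU (PI w n) (Real.exp (t0 * 2 ^ j))) / ∑ j ∈ range (J+1), (1/2:ℝ) ^ j := by
    simp_rw [← UU_eq V hsd, Finset.mul_sum]
    rw [Finset.sum_comm, Finset.sum_div]
    unfold SV.GG
    refine Finset.sum_congr rfl fun E _ => ?_
    rw [hg]
    unfold gl lay
    rw [div_mul_eq_mul_div, Finset.sum_mul]
    simp_rw [mul_assoc]
  rw [h1, le_div_iff₀ (by have := c0_ge J; linarith)]
  have h2 := geo2 (J+1)
  calc _ ≤ (J+1) * t0 / (64 * Real.log w) * 2 := by gcongr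
    _ = ∑ j ∈ range (J+1), (1/2:ℝ) ^ j * (Real.log (Real.exp (t0 * 2 ^ j)) / Real.log w / 32) := by
      rw [Finset.sum_congr rfl (g := fun _ => t0 / Real.log w / 32)]
      · simp; field_simp; ring
      · intro j _
        rw [Real.log_exp]
        have : (1/2:ℝ) ^ j * 2 ^ j = 1 := by rw [← mul_pow]; norm_num
        linear_combination (t0 / Real.log w / 32) * this
    _ ≤ _ := by
      refine Finset.sum_le_sum fun j hj => ?_
      gcongr
      apply UU_lower hw (Real.one_le_exp (by positivity))
      refine le_trans (Nat.floor_le_floor (Real.exp_le_exp.2 ?_)) hn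
      have hj : j ≤ J := by have := mem_range.1 hj; omega
      gcongr
      norm_num

lemma I0_ge (hw : 3 ≤ w) (ht : 0 ≤ t0) (hn : ⌊Real.exp (t0 * 2 ^ J)⌋₊ ≤ n) :
    t0 / (32 * Real.log w) ≤ V.I0 := by
  have h0 : t0 ≤ t0 * 2 ^ J := by
    have : (1:ℝ) ≤ 2 ^ J := one_le_pow₀ (by norm_num)
    nlinarith
  have h1 := UU_lower (n := n) hw (Real.one_le_exp ht) ((Nat.floor_le_floor (Real.exp_le_exp.2 h0)).trans hn)
  rw [Real.log_exp, div_div, mul_comm] at h1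
  refine h1.trans ?_
  rw [← UU_eq V hsd]
  unfold SV.I0
  refine Finset.sum_le_sum fun E _ => ?_
  have : 0 ≤ V.qE E := Finset.prod_nonneg fun _ _ => V.q_nonneg _
  gcongr
  split_ifs with h
  · rw [hg, gl_eq_one ht h]; norm_num
  · positivity

lemma I0_le (hw : 3 ≤ w) (ht : Real.log w ≤ t0) :
    V.I0 ≤ 256 * (t0 / Real.log w) := by
  have hw3 : (3:ℝ) ≤ w := by exact_mod_cast hw
  have hl : 0 < Real.log w := Real.log_pos (by linarith)
  calc V.I0 ≤ ∑ E, (4 * ∑ j ∈ range (J+1), (1/4:ℝ) ^ j * (if V.pE E ≤ Real.exp (t0 * 2 ^ j) then 1 else 0)) * V.qE E := by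
        unfold SV.I0
        refine Finset.sum_le_sum fun E _ => ?_
        have : 0 ≤ V.qE E := Finset.prod_nonneg fun _ _ => V.q_nonneg _
        gcongr
        rw [hg]; exact gl_sq_le _ _ _ (by linarith)
    _ = 4 * ∑ j ∈ range (J+1), (1/4:ℝ) ^ j * UU (PI w n) (Real.exp (t0 * 2 ^ j)) := by
        simp_rw [← UU_eq V hsd, Finset.mul_sum, Finset.sum_mul]
        rw [Finset.sum_comm]
        simp_rw [mul_assoc]
    _ ≤ 4 * ∑ j ∈ range (J+1), (1/2:ℝ) ^ j * (32 * (t0 / Real.log w)) := by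
        refine mul_le_mul_of_nonneg_left (Finset.sum_le_sum fun j _ => ?_) (by norm_num)
        have h1 := UU_upper (n := n) (T := Real.exp (t0 * 2 ^ j)) hw (by
          rw [← Real.log_le_iff_le_exp (by linarith)]
          have : (1:ℝ) ≤ 2 ^ j := one_le_pow₀ (by norm_num)
          nlinarith)
        rw [Real.log_exp] at h1
        calc _ ≤ (1/4:ℝ) ^ j * _ := mul_le_mul_of_nonneg_left h1 (by positivity)
          _ = ((1/4:ℝ) ^ j * 2 ^ j) * (32 * (t0 / Real.log w)) := by ring
          _ = _ := by rw [← mul_pow]; norm_num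
    _ ≤ _ := by
        rw [← Finset.sum_mul]
        have := geo2 (J+1)
        have h2 : 0 ≤ t0 / Real.log w := div_nonneg (by linarith) hl.le
        nlinarith

lemma L1_le (hw : 3 ≤ w) (ht : Real.log w ≤ t0) :
    V.L1 ≤ 128 * (J+1) * (t0 ^ 2 / Real.log w) := by
  have hw3 : (3:ℝ) ≤ w := by exact_mod_cast hw
  have hl : 0 < Real.log w := Real.log_pos (by linarith)
  calc V.L1 ≤ ∑ E, (4 * ∑ j ∈ range (J+1), (1/4:ℝ) ^ j * (t0 * 2 ^ j) * (if V.pE E ≤ Real.exp (t0 * 2 ^ j) then 1 else 0)) * V.qE E := by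
        unfold SV.L1
        refine Finset.sum_le_sum fun E _ => ?_
        have : 0 ≤ V.qE E := Finset.prod_nonneg fun _ _ => V.q_nonneg _
        refine mul_le_mul_of_nonneg_right ?_ this
        have hp1 : 1 ≤ V.pE E := Finset.one_le_prod fun s _ => by exact_mod_cast (V.prime s).pos
        calc _ ≤ (4 * ∑ j ∈ range (J+1), (1/4:ℝ) ^ j * (if V.pE E ≤ Real.exp (t0 * 2 ^ j) then 1 else 0)) * Real.log (V.pE E) := by
              refine mul_le_mul_of_nonneg_right ?_ (Real.log_nonneg hp1)
              rw [hg]; exact gl_sq_le _ _ _ (by linarith)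
          _ ≤ _ := by
              rw [mul_assoc, Finset.sum_mul]
              refine mul_le_mul_of_nonneg_left (Finset.sum_le_sum fun j _ => ?_) (by norm_num)
              split_ifs with h
              · rw [mul_one, mul_one]
                refine mul_le_mul_of_nonneg_left ?_ (by positivity)
                exact (Real.log_le_iff_le_exp (by linarith)).2 h
              · simp
    _ = 4 * ∑ j ∈ range (J+1), (1/4:ℝ) ^ j * (t0 * 2 ^ j) * UU (PI w n) (Real.exp (t0 * 2 ^ j)) := by
        simp_rw [← UU_eq V hsd, Finset.mul_sum, Finset.sum_mul]
        rw [Finset.sum_comm]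
        simp_rw [mul_assoc]
    _ ≤ 4 * ∑ j ∈ range (J+1), (32 * (t0 ^ 2 / Real.log w)) := by
        refine mul_le_mul_of_nonneg_left (Finset.sum_le_sum fun j _ => ?_) (by norm_num)
        have h1 := UU_upper (n := n) (T := Real.exp (t0 * 2 ^ j)) hw (by
          rw [← Real.log_le_iff_le_exp (by linarith)]
          have : (1:ℝ) ≤ 2 ^ j := one_le_pow₀ (by norm_num)
          nlinarith)
        rw [Real.log_exp] at h1
        have h0 : 0 ≤ t0 := by linarith
        calc _ ≤ (1/4:ℝ) ^ j * (t0 * 2 ^ j) * _ := mul_le_mul_of_nonneg_left h1 (by positivity)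
          _ = ((1/4:ℝ) * 2 * 2) ^ j * (32 * (t0 ^ 2 / Real.log w)) := by rw [mul_pow, mul_pow]; ring
          _ = _ := by norm_num
    _ = _ := by simp; ring
end

lemma tiny_sieve (w : ℕ) (hw : 2 ≤ w) (p : ℕ) (hp : p.Prime) (hwp : w < p) (n : ℤ) (κ : ℕ) :
    (#{h : Fin κ | IsCoprime (n + h.val * p) ((∏ s ∈ PP w, s : ℕ):ℤ)} : ℝ) ≤ 2 * κ / Real.log w + 2 * w ^ 4 := by
  classical
  set sd : ↥(PP w) → ℕ := fun s => s with hsd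
  have hspr : ∀ s, (sd s).Prime := fun s => (mem_PP.1 s.2).1
  have : ∀ s, NeZero (sd s) := fun s => ⟨(hspr s).ne_zero⟩
  set y : (↥(PP w) → Option Unit) → ℝ := fun v => if DD sd v ≤ w then 1 else 0 with hy
  set X : (s : ↥(PP w)) → ZMod (sd s) → Option Unit := fun s => pat {()} (fun _ => 0) with hX
  set H : ℝ := ∑ v, y v * Wt (fun s => 1 / (sd s:ℝ)) v with hH
  have hlw : 0 < Real.log w := Real.log_pos (by exact_mod_cast (by omega : 1 < w))
  have hDW : ∀ v : ↥(PP w) → Option Unit, DD sd v * Wt (fun s => 1 / (sd s:ℝ)) v = 1 := by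
    intro v
    unfold DD Wt
    rw [← Finset.prod_mul_distrib]
    refine Finset.prod_eq_one fun s _ => ?_
    have : (sd s : ℝ) ≠ 0 := by exact_mod_cast (hspr s).ne_zero
    split_ifs
    · norm_num
    · field_simp
  have hD1 : ∀ v : ↥(PP w) → Option Unit, 1 ≤ DD sd v := fun v => DD_pos sd v
  have hW0 : ∀ v : ↥(PP w) → Option Unit, 0 ≤ Wt (fun s => 1 / (sd s:ℝ)) v := by
    intro v; unfold Wt; refine Finset.prod_nonneg fun s _ => ?_; split_ifs <;> positivity
  have hH0 : Real.log w / 2 ≤ H := by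
    have h1 := UU_all w (by exact_mod_cast (by omega : 1 ≤ w))
    rw [Nat.floor_natCast] at h1
    refine h1.trans ?_
    unfold UU
    rw [← sum_transfer]
    apply sum_inj_le (fun E => fun s => if s ∈ E then some () else none) (fun _ _ => mem_univ _)
    · intro E _ F _ h
      ext s
      have := congrFun h s
      by_cases h1 : s ∈ E <;> by_cases h2 : s ∈ F <;> simp_all
    · intro E _
      have e1 : DD sd (fun s => if s ∈ E then some () else none) = ∏ p ∈ E.map (Function.Embedding.subtype _), (p:ℝ) := by
        unfold DD
        rw [Finset.prod_map, ← Finset.prod_subset (Finset.subset_univ E)]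
        · refine Finset.prod_congr rfl fun s hs => by simp [hs, hsd]
        · intro s _ hs; simp [hs]
      have e2 : Wt (fun s => 1 / (sd s:ℝ)) (fun s => if s ∈ E then some () else none) = ∏ p ∈ E.map (Function.Embedding.subtype _), 1 / (p:ℝ) := by
        unfold Wt
        rw [Finset.prod_map, ← Finset.prod_subset (Finset.subset_univ E)]
        · refine Finset.prod_congr rfl fun s hs => by simp [hs, hsd]
        · intro s _ hs; simp [hs]
      simp only [hy]
      rw [e1, e2]
      split_ifs <;> simp
    · intro v _
      refine mul_nonneg ?_ (hW0 v)
      simp only [hy]; split_ifs <;> norm_num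
  have hHpos : 0 < H := by linarith
  have hS : S1 sd y ≤ w ^ 2 * H := by
    unfold S1
    rw [hH, Finset.mul_sum]
    refine Finset.sum_le_sum fun v _ => ?_
    simp only [hy]
    split_ifs with h
    · have e := hDW v
      have := hW0 v
      have h1 : DD sd v ^ 2 ≤ (w:ℝ) ^ 2 := by have := hD1 v; gcongr
      calc _ = DD sd v ^ 2 * Wt (fun s => 1 / (sd s:ℝ)) v := by rw [pow_two, mul_assoc, e]; simp
        _ ≤ _ := by rw [one_mul]; gcongr
    · simp
  have hS0 : 0 ≤ S1 sd y := by
    unfold S1; exact Finset.sum_nonneg fun v _ => mul_nonneg (abs_nonneg _) (by linarith [hD1 v])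
  have hint := interval_single sd (fun s t hst => (Nat.coprime_primes (hspr s) (hspr t)).2 (fun h => hst (Subtype.ext h)))
    X {()} y n p (fun s => by
      rw [Int.cast_natCast, ZMod.isUnit_iff_coprime]
      refine (Nat.coprime_primes hp (hspr s)).2 ?_
      have := (mem_PP.1 s.2).2
      intro h; simp only [hsd] at h; omega) κ
  have hup := sieve_upper ({()} : Finset Unit) (fun s => 1 / (sd s:ℝ)) (fun s => by positivity)
    (fun s => by
      have : (1:ℝ) ≤ sd s := by exact_mod_cast (hspr s).pos
      simp only [card_singleton, Nat.cast_one, one_mul]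
      rw [div_le_one (by linarith)]; exact this) y
  have hpd : (fun s => pden (sd s) (X s)) = fun s => pr ({()} : Finset Unit) (1 / (sd s : ℝ)) := by
    funext s
    exact pden_pat _ _ (fun _ _ _ => rfl)
  rw [hpd] at hint
  have hup2 : (EE (fun s => pr ({()} : Finset Unit) (1 / (sd s : ℝ))) fun x => Lin {()} (fun s => 1 / (sd s:ℝ)) y x ^ 2) ≤ H := by
    refine hup.trans (le_of_eq ?_)
    refine Finset.sum_congr rfl fun v _ => ?_
    simp only [hy]; split_ifs <;> simp
  have hlow : (#{h : Fin κ | IsCoprime (n + h.val * p) ((∏ s ∈ PP w, s : ℕ):ℤ)} : ℝ) * H ^ 2 ≤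
      ∑ m ∈ range κ, (Lin {()} (fun s => 1 / (sd s:ℝ)) y fun s => X s ((n + p * m : ℤ))) ^ 2 := by
    rw [← Fin.sum_univ_eq_sum_range (fun m => (Lin {()} (fun s => 1 / (sd s:ℝ)) y fun s => X s ((n + p * m : ℤ))) ^ 2) κ,
      ← nsmul_eq_mul, ← Finset.sum_const]
    refine le_trans (le_of_eq (Finset.sum_congr rfl fun h hh => ?_))
      (Finset.sum_le_sum_of_subset_of_nonneg (Finset.subset_univ _) (fun _ _ _ => sq_nonneg _))
    rw [mem_filter] at hh
    congr 1
    have hnone : ∀ s, X s ((n + p * h.val : ℤ)) = none := by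
      intro s
      simp only [hX, pat]
      rw [dif_neg]
      rintro ⟨_, _, h0⟩
      rw [add_zero, ZMod.intCast_zmod_eq_zero_iff_dvd] at h0
      have h2 : ((sd s : ℕ):ℤ) ∣ ((∏ s ∈ PP w, s : ℕ):ℤ) := by
        rw [Int.natCast_dvd_natCast]; exact Finset.dvd_prod_of_mem (fun s => s) s.2
      have h3 : ((sd s : ℕ):ℤ) ∣ n + h.val * p := by rw [mul_comm]; exact h0
      have := hh.2.isUnit_of_dvd' h3 h2
      rw [Int.isUnit_iff_natAbs_eq] at this
      simp at this
      exact (hspr s).one_lt.ne' this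
    unfold Lin
    refine Finset.sum_congr rfl fun v _ => ?_
    congr 1
    unfold Wt
    refine Finset.prod_congr rfl fun s _ => ?_
    beta_reduce
    rw [hnone s]
    rcases hv : v s with _ | u <;> simp [ee]
  have h1 := (abs_le.1 hint).2
  have h2 : (κ:ℝ) * (EE (fun s => pr ({()} : Finset Unit) (1 / (sd s : ℝ))) fun x => Lin {()} (fun s => 1 / (sd s:ℝ)) y x ^ 2) ≤ κ * H := by gcongr
  have h3 : S1 sd y ^ 2 ≤ (w ^ 2 * H) ^ 2 := by gcongr
  set a := (#{h : Fin κ | IsCoprime (n + h.val * p) ((∏ s ∈ PP w, s : ℕ):ℤ)} : ℝ) with ha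
  have h4 : a * H ^ 2 ≤ (κ / H + 2 * w ^ 4) * H ^ 2 := by
    calc a * H ^ 2 ≤ κ * H + 2 * (w ^ 2 * H) ^ 2 := by linarith
      _ = _ := by field_simp
  have h5 := le_of_mul_le_mul_right h4 (by positivity)
  have h6 : κ / H ≤ 2 * κ / Real.log w := by
    calc κ / H ≤ κ / (Real.log w / 2) := by gcongr
      _ = _ := by field_simp
  linarith

lemma sum_inv_PP (z : ℕ) (hz : 3 ≤ z) : ∑ p ∈ PP z, 1 / (p:ℝ) ≤ 2 * Real.log (16 * Real.log z) := by
  have h1 := mertens_up z hz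
  have h2 : Real.log (∏ p ∈ PP z, (1 + 1 / (p:ℝ))) ≤ Real.log (16 * Real.log z) :=
    Real.log_le_log (by positivity) h1
  rw [Real.log_prod (fun p _ => by positivity)] at h2
  have h3 : ∑ p ∈ PP z, 1 / (p:ℝ) ≤ 2 * ∑ p ∈ PP z, Real.log (1 + 1 / (p:ℝ)) := by
    rw [Finset.mul_sum]
    refine Finset.sum_le_sum fun p hp => ?_
    have hp1 : (1:ℝ) ≤ p := by exact_mod_cast (mem_PP.1 hp).1.pos
    have := Real.one_sub_inv_le_log_of_pos (x := 1 + 1 / (p:ℝ)) (by positivity)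
    have h4 : 1 - (1 + 1 / (p:ℝ))⁻¹ = 1 / (p + 1) := by field_simp; ring
    have h5 : 1 / (p:ℝ) ≤ 2 * (1 / (p+1)) := by
      rw [mul_one_div, div_le_div_iff₀ (by linarith) (by linarith)]; linarith
    linarith
  linarith

lemma rankin (z y : ℕ) (hz : 3 ≤ z) (hy : 1 ≤ y) (η : ℝ) (h0 : 0 < η) (h1 : η ≤ 1/2) :
    (#{n ∈ Icc 1 y | ∀ p ∈ n.primeFactors, p ≤ z} : ℝ) ≤
      y * Real.exp (-(η * Real.log y) + 8 * Real.log (16 * Real.log z) + 8 * Real.exp (η * Real.log z)) := by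
  set σ := 1 - η with hσ
  have hlz : 0 < Real.log z := Real.log_pos (by exact_mod_cast (by omega : 1 < z))
  have hy0 : (0:ℝ) < y := by exact_mod_cast hy
  let f : ℕ →* ℝ :=
    { toFun := fun n => (n:ℝ) ^ (-σ)
      map_one' := by simp
      map_mul' := by intro a b; push_cast; rw [Real.mul_rpow (by positivity) (by positivity)] }
  have hf : ∀ n, f n = (n:ℝ) ^ (-σ) := fun n => rfl
  have hf0 : ∀ n, 0 ≤ f n := fun n => by rw [hf]; positivity
  have hfp : ∀ {p : ℕ}, p.Prime → f p ≤ 3/4 := by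
    intro p hp
    have h2 : (2:ℝ) ≤ p := by exact_mod_cast hp.two_le
    rw [hf]
    calc (p:ℝ) ^ (-σ) ≤ 2 ^ (-σ) := Real.rpow_le_rpow_of_nonpos (by norm_num) h2 (by linarith)
      _ ≤ 2 ^ (-(1/2:ℝ)) := Real.rpow_le_rpow_of_exponent_le (by norm_num) (by linarith)
      _ ≤ 3/4 := by
        rw [Real.rpow_neg (by norm_num), ← Real.sqrt_eq_rpow]
        rw [inv_le_comm₀ (by positivity) (by norm_num)]
        apply Real.le_sqrt_of_sq_le; norm_num
  obtain ⟨hs1, hs2⟩ := EulerProduct.summable_and_hasSum_smoothNumbers_prod_primesBelow_geometric (f := f)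
    (fun {p} hp => by rw [Real.norm_of_nonneg (hf0 p)]; linarith [hfp hp]) (z+1)
  have hPB : (z+1).primesBelow = PP z := rfl
  rw [hPB] at hs2
  -- count
  have hc : (#{n ∈ Icc 1 y | ∀ p ∈ n.primeFactors, p ≤ z} : ℝ) ≤ (y:ℝ) ^ σ * ∏ p ∈ PP z, (1 - f p)⁻¹ := by
    set T := {n ∈ Icc 1 y | ∀ p ∈ n.primeFactors, p ≤ z} with hT
    have hTs : ∀ n ∈ T, n ∈ (z+1).smoothNumbers := by
      intro n hn
      rw [hT, mem_filter, mem_Icc] at hn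
      rw [Nat.mem_smoothNumbers']
      intro p hp hpn
      exact Nat.lt_succ_of_le (hn.2 p (Nat.mem_primeFactors.2 ⟨hp, hpn, by omega⟩))
    have h3 : ∑ n ∈ T, f n ≤ ∏ p ∈ PP z, (1 - f p)⁻¹ := by
      have := sum_le_hasSum (T.attach.map ⟨fun n => (⟨n.1, hTs n.1 n.2⟩ : (z+1).smoothNumbers), fun a b h => Subtype.ext (by simpa using h)⟩)
        (fun _ _ => hf0 _) hs2
      rw [Finset.sum_map] at this
      refine le_trans (le_of_eq ?_) this
      exact (Finset.sum_attach T (fun n => f n)).symm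
    have h4 : (#T : ℝ) ≤ (y:ℝ) ^ σ * ∑ n ∈ T, f n := by
      rw [Finset.mul_sum, ← nsmul_one, ← Finset.sum_const]
      refine Finset.sum_le_sum fun n hn => ?_
      rw [hT, mem_filter, mem_Icc] at hn
      have hn0 : (0:ℝ) < n := by exact_mod_cast hn.1.1
      rw [hf, Real.rpow_neg hn0.le, ← div_eq_mul_inv, one_le_div (by positivity)]
      apply Real.rpow_le_rpow hn0.le (by exact_mod_cast hn.1.2) (by linarith)
    refine h4.trans ?_
    gcongr
  have hprod : ∏ p ∈ PP z, (1 - f p)⁻¹ ≤ Real.exp (4 * ∑ p ∈ PP z, f p) := by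
    rw [Finset.mul_sum, Real.exp_sum]
    apply Finset.prod_le_prod
    · intro p hp
      have := hfp (mem_PP.1 hp).1
      exact inv_nonneg.2 (by linarith)
    · intro p hp
      have h5 := hfp (mem_PP.1 hp).1
      have h6 := hf0 p
      have h7 := Real.add_one_le_exp (4 * f p)
      have h8 : (1 - f p)⁻¹ ≤ 4 * f p + 1 := by
        rw [inv_le_iff_one_le_mul₀ (by linarith)]
        nlinarith
      linarith
  have hsum : ∑ p ∈ PP z, f p ≤ 2 * Real.log (16 * Real.log z) + 2 * Real.exp (η * Real.log z) := by
    have h5 : ∀ p ∈ PP z, f p ≤ 1 / (p:ℝ) + Real.exp (η * Real.log z) / Real.log z * (Real.log p / p) := by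
      intro p hp
      have hp0 := PP_pos hp
      have hlp : 0 ≤ Real.log p := Real.log_natCast_nonneg p
      have hle : Real.log p ≤ Real.log z := Real.log_le_log hp0 (by exact_mod_cast (mem_PP.1 hp).2)
      have h6 : f p = Real.exp (η * Real.log p) / p := by
        rw [hf, hσ, show -(1-η) = η - 1 by ring, Real.rpow_sub_one hp0.ne', Real.rpow_def_of_pos hp0, mul_comm]
      have h7 : Real.exp (η * Real.log p) ≤ 1 + Real.exp (η * Real.log z) / Real.log z * Real.log p := by
        have hcv := convexOn_exp.2 (Set.mem_univ 0) (Set.mem_univ (η * Real.log z))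
          (show 0 ≤ 1 - Real.log p / Real.log z by rw [sub_nonneg, div_le_one hlz]; exact hle)
          (show 0 ≤ Real.log p / Real.log z by positivity) (by ring)
        simp only [smul_eq_mul, mul_zero, zero_add, Real.exp_zero, mul_one] at hcv
        have e1 : Real.log p / Real.log z * (η * Real.log z) = η * Real.log p := by field_simp
        rw [e1] at hcv
        have : 0 ≤ Real.log p / Real.log z := by positivity
        calc _ ≤ _ := hcv
          _ ≤ 1 + Real.log p / Real.log z * Real.exp (η * Real.log z) := by linarith
          _ = _ := by ring
      rw [h6]
      calc _ ≤ (1 + Real.exp (η * Real.log z) / Real.log z * Real.log p) / p := by gcongr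
        _ = _ := by ring
    refine (Finset.sum_le_sum h5).trans ?_
    rw [Finset.sum_add_distrib, ← Finset.mul_sum]
    have h8 := sum_inv_PP z hz
    have h9 := sum_log_div z (by omega)
    have h10 : Real.exp (η * Real.log z) / Real.log z * ∑ p ∈ PP z, Real.log p / p ≤ Real.exp (η * Real.log z) / Real.log z * (2 * Real.log z) := by
      gcongr
    have h11 : Real.exp (η * Real.log z) / Real.log z * (2 * Real.log z) = 2 * Real.exp (η * Real.log z) := by
      field_simp
    linarith
  have hyy : (y:ℝ) ^ σ = y * Real.exp (-(η * Real.log y)) := by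
    rw [Real.rpow_def_of_pos hy0]
    conv_rhs => rw [← Real.exp_log hy0, ← Real.exp_add, Real.exp_log hy0]
    rw [hσ]; ring_nf
  calc _ ≤ _ := hc
    _ ≤ (y * Real.exp (-(η * Real.log y))) * Real.exp (4 * (2 * Real.log (16 * Real.log z) + 2 * Real.exp (η * Real.log z))) := by
      rw [hyy]
      gcongr
      exact hprod.trans (Real.exp_le_exp.2 (by linarith))
    _ = _ := by rw [mul_assoc, ← Real.exp_add]; ring_nf

lemma gap_of_cover (x y : ℕ) (X : ℝ) (r : ℕ → ℤ)
    (hc : ∀ n ∈ Icc 1 y, ∃ p ∈ PP x, (p:ℤ) ∣ (n:ℤ) - r p) (hX : 2 * ((x:ℝ) + 3) * 4 ^ x ≤ X) : (y:ℝ) ≤ G X := by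
  have hpp : Set.Pairwise (PP x : Set ℕ) (Function.onFun Nat.Coprime (fun p : ℕ => p)) := fun p hp q hq h =>
    (Nat.coprime_primes (mem_PP.1 hp).1 (mem_PP.1 hq).1).2 h
  have hne : ∀ p ∈ PP x, p ≠ 0 := fun p hp => (mem_PP.1 hp).1.ne_zero
  set b0 := Nat.chineseRemainderOfFinset (fun p => ((-r p) % p).toNat) (fun p => p) (PP x) hne hpp with hb0
  have hlt := Nat.chineseRemainderOfFinset_lt_prod (fun p => ((-r p) % p).toNat) (fun p => p) hne hpp
  rw [← hb0] at hlt
  set Pm := ∏ p ∈ PP x, p with hPm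
  have hP4 : Pm ≤ 4 ^ x := primorial_le_four_pow x
  have hP1 : 1 ≤ Pm := Nat.one_le_iff_ne_zero.2 (Finset.prod_ne_zero_iff.2 hne)
  set b : ℕ := b0 + Pm * (x+2) with hb
  have hbx : x + 2 ≤ b := by nlinarith
  have hbX : b ≤ (x+3) * 4 ^ x := by nlinarith
  have hcomp : ∀ n ∈ Icc 1 y, ¬ (b + n).Prime := by
    intro n hn hpr
    obtain ⟨p, hp, hd⟩ := hc n hn
    have h1 : (p:ℤ) ∣ (b:ℤ) + r p := by
      have h2 := b0.2 p hp
      have h3 : ((b0:ℕ):ℤ) ≡ (((-r p) % p).toNat : ℤ) [ZMOD p] := Int.natCast_modEq_iff.2 h2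
      rw [Int.toNat_of_nonneg (Int.emod_nonneg _ (by exact_mod_cast hne p hp))] at h3
      have h4 := h3.trans (Int.mod_modEq _ _)
      have h5 : (p:ℤ) ∣ (Pm:ℤ) := Int.natCast_dvd_natCast.2 (Finset.dvd_prod_of_mem (fun p => p) hp)
      have h6 := h4.symm.dvd
      have : (b:ℤ) + r p = ((b0:ℕ):ℤ) - -r p + Pm * (x+2) := by push_cast [hb]; ring
      rw [this]
      exact dvd_add h6 (h5.mul_right _)
    have h2 : (p:ℤ) ∣ ((b + n : ℕ):ℤ) := by
      have : ((b + n : ℕ):ℤ) = (b + r p) + (n - r p) := by push_cast; ring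
      rw [this]; exact dvd_add h1 hd
    rw [Int.natCast_dvd_natCast, Nat.prime_dvd_prime_iff_eq (mem_PP.1 hp).1 hpr] at h2
    have := (mem_PP.1 hp).2
    omega
  set k := Nat.count Nat.Prime (b+1) with hk
  have hk1 : 1 ≤ k := by
    have : Nat.count Nat.Prime 3 ≤ k := Nat.count_monotone _ (by omega)
    have h3 : Nat.count Nat.Prime 3 = 1 := by decide
    omega
  have h1 : Nat.nth Nat.Prime (k-1) < b + 1 := Nat.nth_lt_of_lt_count (by omega)
  have h2 : b + 1 ≤ Nat.nth Nat.Prime k := by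
    apply Nat.le_nth_count'
    obtain ⟨q, hq, hq2⟩ := Nat.exists_infinite_primes (b+1)
    exact ⟨q, hq2, hq⟩
  have hpr : (Nat.nth Nat.Prime k).Prime := Nat.prime_nth_prime k
  have h3 : b + y + 1 ≤ Nat.nth Nat.Prime k := by
    by_contra hcon
    apply hcomp (Nat.nth Nat.Prime k - b) (by rw [mem_Icc]; omega)
    rwa [Nat.add_sub_cancel' (by omega)]
  obtain ⟨q, hq, hq1, hq2⟩ := Nat.exists_prime_lt_and_le_two_mul b (by omega)
  have h4 : Nat.nth Nat.Prime k ≤ q := by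
    rw [← Nat.nth_count hq]
    exact Nat.nth_monotone Nat.infinite_setOfPred_prime (Nat.count_monotone _ (by omega))
  have h5 : (Nat.nth Nat.Prime k : ℝ) ≤ X := by
    have : (Nat.nth Nat.Prime k : ℝ) ≤ ((2 * ((x+3) * 4 ^ x) : ℕ):ℝ) := by exact_mod_cast (by omega)
    push_cast at this
    linarith
  unfold G
  refine le_trans ?_ (le_csSup ?_ ⟨k, hk1, ?_, rfl⟩)
  · simp only [nthPrime, Nat.add_sub_cancel]
    have h6 : ((y:ℕ):ℝ) + Nat.nth Nat.Prime (k-1) ≤ Nat.nth Nat.Prime k := by exact_mod_cast (by omega)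
    linarith
  · refine ⟨X, ?_⟩
    rintro d ⟨n, _, hn, rfl⟩
    have : (0:ℝ) ≤ nthPrime n := Nat.cast_nonneg _
    linarith
  · simpa only [nthPrime, Nat.add_sub_cancel] using h5

lemma card_dvd_le {ι : Type} [Fintype ι] (sd : ι → ℕ) (hp : ∀ s, (sd s).Prime) (hi : Function.Injective sd)
    (D : ℤ) (hD : D ≠ 0) (Λ : ℕ) (h : |D| ≤ 2 ^ Λ) : #{s | (sd s : ℤ) ∣ D} ≤ Λ := by
  classical
  have h1 : ∏ s ∈ ({s | (sd s : ℤ) ∣ D} : Finset ι), sd s ∣ D.natAbs := by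
    refine Finset.prod_dvd_of_isRelPrime ?_ (fun s hs => Int.natCast_dvd.1 (mem_filter.1 hs).2)
    intro s _ t _ hst
    exact Nat.coprime_iff_isRelPrime.1 <| (Nat.coprime_primes (hp s) (hp t)).2 (fun e => hst (hi e))
  have h2 := Nat.le_of_dvd (Int.natAbs_pos.2 hD) h1
  have h3 : 2 ^ #{s | (sd s : ℤ) ∣ D} ≤ ∏ s ∈ ({s | (sd s : ℤ) ∣ D} : Finset ι), sd s :=
    Finset.pow_card_le_prod _ _ _ (fun s _ => (hp s).two_le)
  have h4 : D.natAbs ≤ 2 ^ Λ := by zify; simpa using h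
  exact (Nat.pow_le_pow_iff_right (by norm_num)).1 (h3.trans (h2.trans h4))

lemma one_sub_sum_le {ι : Type} (Z : Finset ι) (f : ι → ℝ) (h0 : ∀ s, 0 ≤ f s) (h1 : ∀ s, f s ≤ 1) :
    1 - ∑ s ∈ Z, f s ≤ ∏ s ∈ Z, (1 - f s) := by
  classical
  induction Z using Finset.induction_on with
  | empty => simp
  | insert a Z ha ih =>
    rw [sum_insert ha, prod_insert ha]
    have hs : 0 ≤ ∑ s ∈ Z, f s := sum_nonneg fun s _ => h0 s
    have := mul_le_mul_of_nonneg_left ih (sub_nonneg.2 (h1 a))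
    nlinarith [h0 a]

lemma sum_inv_sq_PI (w n : ℕ) (hw : 1 ≤ w) : ∑ s : PI w n, (1 / ((s:ℕ):ℝ)) ^ 2 ≤ 1 / (w:ℝ) := by
  rw [Finset.sum_coe_sort (PI w n) (fun s : ℕ => (1 / (s:ℝ)) ^ (2:ℕ))]
  rcases le_total w n with h | h
  · have h1 : ∑ s ∈ PI w n, (1 / (s:ℝ)) ^ 2 ≤ ∑ s ∈ Ioc w n, (((s:ℝ)) ^ 2)⁻¹ := by
      refine (sum_le_sum_of_subset_of_nonneg (t := Ioc w n) (fun s hs => ?_) (fun _ _ _ => by positivity)).trans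
        (le_of_eq (sum_congr rfl fun s _ => by simp))
      have := mem_PI.1 hs; simp; omega
    have h2 := sum_Ioc_inv_sq_le_sub (α := ℝ) (k := w) (n := n) (by omega) h
    have : (0:ℝ) ≤ (n:ℝ)⁻¹ := by positivity
    rw [one_div]; linarith
  · have : PI w n = ∅ := by
      ext s; simp only [mem_PI, notMem_empty, iff_false]; rintro ⟨_, a, b⟩; omega
    simp [this]

lemma card_le_of_prod {ι : Type} (Z : Finset ι) (f : ι → ℕ) (h2 : ∀ s, 2 ≤ f s) (T : ℝ)
    (h : ∏ s ∈ Z, (f s : ℝ) ≤ Real.exp T) : (#Z : ℝ) ≤ 2 * T := by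
  have h3 : (2:ℝ) ^ #Z ≤ ∏ s ∈ Z, (f s : ℝ) := by
    exact_mod_cast Finset.pow_card_le_prod _ _ _ (fun s _ => h2 s)
  have h4 : Real.log ((2:ℝ) ^ #Z) ≤ T := by
    rw [Real.log_le_iff_le_exp (by positivity)]; linarith
  rw [Real.log_pow] at h4
  have := Real.log_two_gt_d9
  have h0 : (0:ℝ) ≤ #Z := by positivity
  nlinarith

set_option maxHeartbeats 1600000 in
theorem QS_exists (a w1 w x Λ : ℕ) (ℓ ε : ℝ) (P1 : Finset ℕ) (hw1 : 2 ≤ w1) (hww : w1 ≤ w) (hw3 : 3 ≤ w)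
    (hkk : (2 * (2:ℝ) ^ a / Real.log w1 + 2 * w1 ^ 4) * 32768 * (a + 22) ≤ 2 ^ (a + 22))
    (ht0 : Real.log w ≤ ℓ / 2 ^ (a + 22)) (hℓ : 1 ≤ ℓ) (hfew : 2 ^ 24 * 2 ^ a * ℓ ≤ w)
    (hP : ∀ p ∈ P1, p.Prime ∧ 2 ^ a < p ∧ w1 < p ∧ ⌊Real.exp ℓ⌋₊ < p ∧ p ≤ x)
    (hΛ : 2 * 2 ^ a * x ≤ 2 ^ Λ) (hΛ1 : 1 ≤ Λ) (hε1 : ε ≤ 1)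
    (hε : 405 * (2 ^ a) ^ 3 * Λ / w ≤ ε / 2)
    (hγ : 2 ^ 24 * Real.log w ≤ (a + 22) ^ 2 * (ℓ / 2 ^ (a + 22))) :
    ∃ Q : QS (PI w ⌊Real.exp ℓ⌋₊), (∀ s, Q.V.sd s = s) ∧ Q.V.kap = 2 ^ a ∧ Q.V.R = Real.exp ℓ ∧
      Q.WT = ∏ p ∈ PP w1, p ∧ Q.P1 = P1 ∧ Q.ε = ε ∧
      (a + 22) ^ 2 * (ℓ / 2 ^ (a + 22)) / (2 ^ 24 * Real.log w) ≤ Q.γ := by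
  set κ : ℕ := 2 ^ a with hκ
  have hκ1 : 1 ≤ κ := Nat.one_le_two_pow
  have hκ1' : (1:ℝ) ≤ 2 ^ a := one_le_pow₀ (by norm_num)
  have hκc : ((κ:ℕ):ℝ) = 2 ^ a := by simp [hκ]
  set t0 : ℝ := ℓ / 2 ^ (a + 22) with ht
  set kk : ℝ := 2 * (2:ℝ) ^ a / Real.log w1 + 2 * w1 ^ 4 with hkkd
  have hw0 : (0:ℝ) < w := by positivity
  have hlw1 : 0 ≤ Real.log w1 := Real.log_natCast_nonneg _
  have hlw : 1 ≤ Real.log w := by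
    rw [Real.le_log_iff_exp_le hw0]
    have := Real.exp_one_lt_d9
    have : (3:ℝ) ≤ w := by exact_mod_cast hw3
    linarith
  have hkk0 : 0 ≤ kk := by positivity
  have hkkκ : kk ≤ 2 ^ 22 * 2 ^ a := by
    rw [pow_add] at hkk
    have : 0 ≤ kk * (32767 + 32768 * (a + 21)) := by positivity
    nlinarith
  have ht00 : 0 ≤ t0 := by positivity
  have htl : t0 * 2 ^ (a + 22) = ℓ := by rw [ht]; field_simp
  have htl2 : t0 * 2 ^ (a + 21) = ℓ / 2 := by rw [← htl]; ring
  have hsw : ∀ s : PI w ⌊Real.exp ℓ⌋₊, (w:ℝ) ≤ ((s:ℕ):ℝ) := fun s => by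
    exact_mod_cast (mem_PI.1 s.2).2.2.le
  have hq : ∀ s : PI w ⌊Real.exp ℓ⌋₊, 1 / ((s:ℕ):ℝ) ≤ 1 / w := fun s =>
    one_div_le_one_div_of_le hw0 (hsw s)
  have hκw : (2:ℝ) ^ a * 2 ^ 24 ≤ w := by nlinarith
  have hqk : ∀ s : PI w ⌊Real.exp ℓ⌋₊, kk * (1 / ((s:ℕ):ℝ)) ≤ 2 ^ 22 * 2 ^ a / w := fun s => by
    have := mul_le_mul hkkκ (hq s) (by positivity) (by positivity)
    rwa [mul_one_div (2 ^ 22 * 2 ^ a : ℝ)] at this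
  have hsm : 2 ^ 22 * (2:ℝ) ^ a / w ≤ 1 := by rw [div_le_one hw0]; linarith
  have hp2 : ∀ s : PI w ⌊Real.exp ℓ⌋₊, 2 ≤ (s:ℕ) := fun s => (mem_PI.1 s.2).1.two_le
  obtain ⟨V, hsd, hg, hR, hkap, hVk⟩ : ∃ V : SV (PI w ⌊Real.exp ℓ⌋₊), (∀ s, V.sd s = s) ∧ V.g = gl (a + 21) t0 ∧
      V.R = Real.exp ℓ ∧ V.kap = κ ∧ V.kk = kk := ⟨
  { sd := fun s => s
    g := gl (a + 21) t0
    R := Real.exp ℓ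
    kap := κ
    kk := kk
    prime := fun s => (mem_PI.1 s.2).1
    inj := Subtype.val_injective
    g_nonneg := fun r => gl_nonneg _ _ _
    g_anti := gl_anti _ _
    g_one := gl_eq_one ht00 (Real.one_le_exp ht00)
    g_big := fun r h1 hr => by
      refine gl_zero ht00 ?_
      rw [htl2]
      by_contra! h
      have : r ^ 2 ≤ Real.exp (ℓ / 2) ^ 2 := by gcongr
      rw [← Real.exp_nat_mul] at this
      have e : ((2:ℕ):ℝ) * (ℓ / 2) = ℓ := by push_cast; ring
      rw [e] at this; linarith
    hR := Real.one_le_exp (by linarith)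
    kap_lt := fun s => by
      have h1 := hsw s
      have : (κ:ℝ) < ((s:ℕ):ℝ) := by rw [hκc]; linarith
      exact_mod_cast this
    few := fun Z hZ => by
      rw [← Real.exp_nat_mul] at hZ
      have h1 := card_le_of_prod Z _ hp2 _ hZ
      calc ∑ s ∈ Z, 1 / ((s:ℕ):ℝ) ≤ ∑ s ∈ Z, 1 / (w:ℝ) := sum_le_sum fun s _ => hq s
        _ = #Z / w := by rw [sum_const, nsmul_eq_mul]; ring
        _ ≤ 1 / 2 := by
          rw [div_le_iff₀ hw0]; rw [hκc] at h1; nlinarith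
    few2 := fun Z hZ => by
      have h1 := card_le_of_prod Z _ hp2 _ hZ
      refine le_trans ?_ (one_sub_sum_le Z _ (fun s => by positivity) (fun s => (hqk s).trans hsm))
      have : ∑ s ∈ Z, kk * (1 / ((s:ℕ):ℝ)) ≤ 1 / 2 :=
        calc _ ≤ ∑ s ∈ Z, 2 ^ 22 * (2:ℝ) ^ a / w := sum_le_sum fun s _ => hqk s
          _ = #Z * (2 ^ 22 * (2:ℝ) ^ a) / w := by rw [sum_const, nsmul_eq_mul]; ring
          _ ≤ 1 / 2 := by
            rw [div_le_iff₀ hw0]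
            have := mul_le_mul_of_nonneg_right h1 (by positivity : (0:ℝ) ≤ 2 ^ 22 * 2 ^ a)
            nlinarith
      linarith
    kk_le := fun s => (hqk s).trans hsm }, fun s => rfl, rfl, rfl, rfl, rfl⟩
  have hn : ⌊Real.exp (t0 * 2 ^ (a + 21))⌋₊ ≤ ⌊Real.exp ℓ⌋₊ := by
    rw [htl2]; exact Nat.floor_mono (Real.exp_le_exp.2 (by linarith))
  have hGG := GG_ge V hsd hg hw3 ht00 hn
  have hI := I0_ge V hsd hg hw3 ht00 hn
  have hI' := I0_le V hsd hg hw3 ht0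
  have hL := L1_le V hsd hg hw3 ht0
  have htp : 0 < t0 := by positivity
  have hIp : 0 < V.I0 := lt_of_lt_of_le (by positivity) hI
  have hJ : (((a + 21 : ℕ):ℝ) + 1) = a + 22 := by push_cast; ring
  rw [hJ] at hGG hL
  have hγ' : (a + 22 : ℝ) ^ 2 * t0 / (2 ^ 24 * Real.log w) ≤ V.GG ^ 2 / (16 * V.I0) := by
    calc _ = ((a + 22) * t0 / (64 * Real.log w)) ^ 2 / (16 * (256 * (t0 / Real.log w))) := by
          field_simp; norm_num
      _ ≤ _ := div_le_div₀ (sq_nonneg _) (pow_le_pow_left₀ (by positivity) hGG 2) (by linarith) (by linarith)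
  have hδ : ∑ s, V.q s ^ 2 ≤ 1 / (w:ℝ) := by
    refine le_trans (le_of_eq (sum_congr rfl fun s _ => ?_)) (sum_inv_sq_PI w ⌊Real.exp ℓ⌋₊ (by omega))
    rw [SV.q, hsd]
  let Q : QS (PI w ⌊Real.exp ℓ⌋₊) :=
  { V := V
    WT := ∏ p ∈ PP w1, p
    hWT := prod_pos fun p hp => (mem_PP.1 hp).1.pos
    hWs := fun s => Nat.Coprime.prod_left fun p hp => by
      rw [hsd]
      refine (Nat.coprime_primes (mem_PP.1 hp).1 (mem_PI.1 s.2).1).2 ?_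
      have := (mem_PP.1 hp).2; have := (mem_PI.1 s.2).2.2; omega
    P1 := P1
    hP := fun p hp => (hP p hp).1
    hPκ := fun p hp => hkap ▸ (hP p hp).2.1
    hPs := fun p hp s => by rw [hsd]; exact lt_of_le_of_lt (mem_PI.1 s.2).2.1 (hP p hp).2.2.2.1
    hκ1 := hkap ▸ hκ1
    hk := fun p hp n => by
      have := tiny_sieve w1 hw1 p (hP p hp).1 (hP p hp).2.2.1 n V.kap
      refine this.trans (le_of_eq ?_)
      rw [hVk, hkap, hκc]
    hL1 := by
      have e1 : Real.log V.R = ℓ := by rw [hR]; exact Real.log_exp ℓ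
      rw [e1, hVk]
      have h1 : kk * (2 * V.L1) ≤ kk * (2 * (128 * (a + 22) * (t0 ^ 2 / Real.log w))) := by gcongr
      have h2 : ℓ / 4 * (t0 / (32 * Real.log w)) ≤ ℓ / 4 * V.I0 := by gcongr
      refine h1.trans (le_trans ?_ h2)
      have h3 : kk * 32768 * (a + 22) * t0 ≤ 2 ^ (a + 22) * t0 := by gcongr
      have h4 : kk * 32768 * (a + 22) * t0 ≤ ℓ := by linarith
      have e2 : kk * (2 * (128 * (a + 22) * (t0 ^ 2 / Real.log w))) =
        (kk * 32768 * (a + 22) * t0) / 4 * (t0 / (32 * Real.log w)) := by field_simp; ring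
      rw [e2]; gcongr
    hR1 := by rw [hR]; exact Real.one_lt_exp_iff.2 (by linarith)
    h3 := by
      rw [hkap]
      have : ∏ s, (1 + (κ:ℝ) * V.q s ^ 2) ≤ Real.exp (∑ s, (κ:ℝ) * V.q s ^ 2) := by
        rw [Real.exp_sum]
        exact prod_le_prod (fun s _ => by positivity) (fun s _ => by rw [add_comm]; exact Real.add_one_le_exp _)
      refine this.trans (le_trans (Real.exp_le_exp.2 (?_ : _ ≤ (1:ℝ))) (by have := Real.exp_one_lt_d9; linarith))
      rw [← mul_sum, hκc]
      calc _ ≤ (2:ℝ) ^ a * (1 / w) := by gcongr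
        _ ≤ 1 := by rw [mul_one_div, div_le_one hw0]; linarith
    hγ := le_trans (by rw [le_div_iff₀ (by positivity)]; linarith) hγ'
    w := w
    hw0 := hw0
    hw := fun s => by rw [hsd]; exact hsw s
    δ := 1 / w
    hδ := hδ
    Λ := Λ
    hΛ := fun p hp p' hp' d d' hd hd' h0 => by
      rw [hkap] at hd hd'
      refine card_dvd_le V.sd V.prime V.inj _ h0 Λ ?_
      have hx : (p:ℤ) ≤ x := by exact_mod_cast (hP p hp).2.2.2.2
      have hx' : (p':ℤ) ≤ x := by exact_mod_cast (hP p' hp').2.2.2.2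
      have b : ∀ (d : ℤ) (p : ℕ), |d| < (κ:ℤ) → (p:ℤ) ≤ x → |d * p| ≤ κ * x := fun d p h h' => by
        rw [abs_mul, Nat.abs_cast]; exact mul_le_mul h.le h' (by positivity) (by positivity)
      have h1 := b d p hd hx
      have h2 := b d' p' hd' hx'
      have h3 : (2:ℤ) * κ * x ≤ 2 ^ Λ := by exact_mod_cast hΛ
      have := abs_sub (d * p) (d' * p')
      linarith
    ε := ε
    hε := by
      rw [hkap]
      have hΛ' : (1:ℝ) ≤ Λ := by exact_mod_cast hΛ1
      have h1 : 81 * (2 * (κ:ℝ) ^ 2 * (1 / w) + (κ:ℝ) ^ 2 * Λ * (3 * κ / w)) ≤ ε / 2 := by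
        refine le_trans ?_ hε
        rw [hκc]
        have e : 81 * (2 * ((2:ℝ) ^ a) ^ 2 * (1 / w) + ((2:ℝ) ^ a) ^ 2 * Λ * (3 * 2 ^ a / w)) =
          (162 * ((2:ℝ) ^ a) ^ 2 * 1 + 243 * ((2:ℝ) ^ a) ^ 3 * Λ) / w := by ring
        rw [e]
        gcongr
        have : ((2:ℝ) ^ a) ^ 2 * 1 ≤ (2 ^ a) ^ 3 * Λ := by
          rw [pow_succ _ 2, mul_assoc]
          exact mul_le_mul_of_nonneg_left (one_le_mul_of_one_le_of_one_le hκ1' hΛ') (sq_nonneg _)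
        linarith
      have h0 : 0 ≤ 81 * (2 * (κ:ℝ) ^ 2 * (1 / w) + (κ:ℝ) ^ 2 * Λ * (3 * κ / w)) := by positivity
      have h2 := Real.exp_bound_div_one_sub_of_interval (x := ε / 2) (by linarith) (by linarith)
      refine (Real.exp_le_exp.2 h1).trans (h2.trans ?_)
      rw [div_le_iff₀ (by linarith)]
      nlinarith }
  exact ⟨Q, hsd, hkap, hR, rfl, rfl, rfl, hγ'⟩

lemma sig_exp_mono {s s' c : ℝ} (hs : 0 < s) (h : s ≤ s') (hc : 0 ≤ c) :
    s * Real.exp (-(c / s)) ≤ s' * Real.exp (-(c / s')) := by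
  have : c / s' ≤ c / s := by gcongr
  gcongr
  linarith

lemma Ico_img (M : ℤ) (T : ℕ) : Finset.Ico M (M + T) = (range T).image (fun j : ℕ => M + j) := by
  ext k
  simp only [mem_Ico, mem_image, mem_range]
  constructor
  · rintro ⟨h1, h2⟩; exact ⟨(k - M).toNat, by omega, by omega⟩
  · rintro ⟨j, h1, rfl⟩; omega

lemma Ico_dvd_count (M : ℤ) (T p : ℕ) (hp : 0 < p) (n : ℤ) :
    (#{n' ∈ Finset.Ico M (M + T) | (p:ℤ) ∣ n' - n} : ℝ) ≤ T / p + 1 := by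
  have e : #{n' ∈ Finset.Ico M (M + T) | (p:ℤ) ∣ n' - n} = #{n' ∈ Finset.Ico M (M + T) | n' ≡ n [ZMOD p]} := by
    congr 1; ext k; simp only [mem_filter, and_congr_right_iff]; intro _
    rw [Int.modEq_comm, Int.modEq_iff_dvd]
  have h := Int.Ico_filter_modEq_card M (M + T) (r := (p:ℤ)) (by exact_mod_cast hp) n
  rw [e]
  have h2 : ((#{n' ∈ Finset.Ico M (M + T) | n' ≡ n [ZMOD p]} : ℤ) : ℚ) ≤ T / p + 1 := by
    rw [h]
    have hp' : (0:ℚ) < p := by exact_mod_cast hp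
    push_cast
    refine max_le ?_ (by positivity)
    have h1 := Int.ceil_lt_add_one (((M:ℚ) + T - n) / p)
    have h2 := Int.le_ceil (((M:ℚ) - n) / p)
    have h3 : ((M:ℚ) + T - n) / p = ((M:ℚ) - n) / p + T / p := by ring
    linarith
  have h3 : ((#{n' ∈ Finset.Ico M (M + T) | n' ≡ n [ZMOD p]} : ℚ)) ≤ T / p + 1 := by exact_mod_cast h2
  have h4 : (((#{n' ∈ Finset.Ico M (M + T) | n' ≡ n [ZMOD p]} : ℚ)) : ℝ) ≤ ((T / p + 1 : ℚ) : ℝ) := by exact_mod_cast h3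
  push_cast at h4; exact h4

lemma hbeta {κ w Λ : ℕ} {ε : ℝ} (h2 : 2 * κ ≤ w) (hw : 0 < w) (hε1 : ε ≤ 1)
    (hε : 405 * (κ:ℝ) ^ 3 * Λ / w ≤ ε / 2) : (1 / (1 - (κ:ℝ) / w)) ^ (κ ^ 2 * Λ) ≤ 1 + ε := by
  have hw0 : (0:ℝ) < w := by exact_mod_cast hw
  have ht : (κ:ℝ) / w ≤ 1 / 2 := by
    rw [div_le_iff₀ hw0]; have : (2:ℝ) * κ ≤ w := by exact_mod_cast h2
    linarith
  have ht0 : (0:ℝ) ≤ (κ:ℝ) / w := by positivity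
  have h1 : 1 / (1 - (κ:ℝ) / w) ≤ Real.exp (2 * (κ / w)) := by
    refine le_trans ?_ (Real.add_one_le_exp _)
    rw [div_le_iff₀ (by linarith)]; nlinarith
  have hε0 : (0:ℝ) ≤ 405 * (κ:ℝ) ^ 3 * Λ / w := by positivity
  calc _ ≤ (Real.exp (2 * (κ / w))) ^ (κ ^ 2 * Λ) := by
        refine pow_le_pow_left₀ ?_ h1 _
        exact one_div_nonneg.2 (by linarith)
    _ = Real.exp (2 * ((κ:ℝ) ^ 3 * Λ / w)) := by
        rw [← Real.exp_nat_mul]; congr 1; push_cast; ring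
    _ ≤ Real.exp (ε / 2) := Real.exp_le_exp.2 (le_trans ?_ hε)
    _ ≤ 1 + ε := by
      refine (Real.exp_bound_div_one_sub_of_interval (x := ε / 2) (by linarith) (by linarith)).trans ?_
      rw [div_le_iff₀ (by linarith)]; nlinarith
  have : (0:ℝ) ≤ (κ:ℝ) ^ 3 * Λ / w := by positivity
  have e : 405 * (κ:ℝ) ^ 3 * Λ / w = 405 * ((κ:ℝ) ^ 3 * Λ / w) := by ring
  linarith

lemma hS_aux {κ j s : ℕ} (hj : j ≤ κ) (hs : 2 * κ ≤ s) (hs0 : 0 < s) :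
    1 ≤ (1 + 1 / (s:ℝ)) ^ (2 * κ) * (1 - (j:ℝ) / s) := by
  have hs' : (0:ℝ) < s := by exact_mod_cast hs0
  have h1 : 1 + 2 * (κ:ℝ) * (1 / s) ≤ (1 + 1 / (s:ℝ)) ^ (2 * κ) := by
    have := one_add_mul_le_pow (a := 1 / (s:ℝ)) (by have : (0:ℝ) ≤ 1 / s := by positivity
                                                    linarith) (2 * κ)
    push_cast at this; exact this
  have hκ : (2:ℝ) * κ ≤ s := by exact_mod_cast hs
  have hj' : (j:ℝ) ≤ κ := by exact_mod_cast hj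
  have ht : (κ:ℝ) / s ≤ 1 / 2 := by rw [div_le_iff₀ hs']; linarith
  have ht0 : (0:ℝ) ≤ (κ:ℝ) / s := by positivity
  have h2 : 1 - (κ:ℝ) / s ≤ 1 - (j:ℝ) / s := by gcongr
  have e : 1 + 2 * (κ:ℝ) * (1 / s) = 1 + 2 * (κ / s) := by ring
  rw [e] at h1
  calc (1:ℝ) ≤ (1 + 2 * ((κ:ℝ) / s)) * (1 - (κ:ℝ) / s) := by nlinarith
    _ ≤ _ := mul_le_mul h1 h2 (by linarith) (by positivity)

set_option maxHeartbeats 1600000 in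
open Classical in
theorem cover_primes {ι : Type} [Fintype ι] (Q : QS ι) (w z x y Λ κ : ℕ) (S σ' : ℝ) (hκ : Q.V.kap = κ)
    (h2κ : 2 * κ < w) (hx : 0 < x) (hPx : ∀ p ∈ Q.P1, x < 16 * p ∧ p ≤ x ∧ z < p)
    (hQs : ∀ s, Q.V.sd s * 16 ≤ x) (hWTp : ∀ p : ℕ, p.Prime → p ∣ Q.WT → p * 16 ≤ x)
    (htot : (κ:ℝ) * x + Q.WT * (1 + 18 * Q.V.R ^ 6) ≤ y) (hΛ : y + 2 * κ * x + Q.WT ≤ 2 ^ Λ)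
    (hε0 : 0 ≤ Q.ε) (hε1 : Q.ε ≤ 1) (hε : 405 * (κ:ℝ) ^ 3 * Λ / w ≤ Q.ε / 2)
    (hS : (∏ s ∈ PI w z, (1 + 1 / (s:ℝ))) ^ (2 * κ) ≤ S) (hP0 : 0 < #Q.P1)
    (hσ : 1 ≤ σ' * ∏ s ∈ PI w z, (1 + 1 / (s:ℝ)))
    (num1 : S * (32 * y / x + 1) * (9 * Q.V.R ^ 6) ≤ Q.ε * y)
    (num2 : κ * (9 * Q.V.R ^ 6) * S ≤ Q.ε * (Q.mm / 2)) :
    ∃ r : ℕ → ℤ, (#{q ∈ PP y | x < 16 * q ∧ ∀ p, p ∈ PI w z ∨ p ∈ Q.P1 → ¬ (p:ℤ) ∣ q - r p} : ℝ) ≤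
      σ' * #(PP y) * Real.exp (-(Q.mm / (32 * σ' * y))) + 8 * Q.ε * #(PP y) + 768 * Q.ε * y +
      (16 * Q.ε * (y + Q.WT) + 1440 * Q.WT * Q.V.R ^ 12 + 36 * Q.V.R ^ 6 * (y + Q.WT) / #Q.P1) := by
  subst hκ
  set κ := Q.V.kap with hκd
  have hR1 := Q.hR1
  have hWT := Q.hWT
  have hWTr : (0:ℝ) < Q.WT := by exact_mod_cast hWT
  have hy : (0:ℝ) < y := lt_of_lt_of_le (by positivity) htot
  have hxr : (0:ℝ) < x := by exact_mod_cast hx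
  have hγ1 : 1 ≤ Q.γ := Q.hγ
  have hκ1 : 1 ≤ κ := Q.hκ1
  set N := (y + κ * x) / Q.WT + 1 with hN
  have hT1 : y + κ * x < N * Q.WT := by
    rw [hN, add_mul, one_mul]; exact Nat.lt_div_mul_add hWT
  have hT2 : N * Q.WT ≤ y + κ * x + Q.WT := by
    rw [hN, add_mul, one_mul]; gcongr; exact Nat.div_mul_le_self _ _
  have hT2r : (N:ℝ) * Q.WT ≤ y + κ * x + Q.WT := by exact_mod_cast hT2
  have hT3 : (N:ℝ) * Q.WT ≤ 2 * y := by nlinarith [pow_pos (zero_lt_one.trans hR1) 6]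
  set M : ℤ := -((κ * x : ℕ) : ℤ) with hM
  have hcop : ∀ q : ℕ, q.Prime → x < 16 * q → IsCoprime (q:ℤ) (Q.WT:ℤ) := fun q hq hxq => by
    rw [Nat.isCoprime_iff_coprime, hq.coprime_iff_not_dvd]
    intro h; have := hWTp q hq h; omega
  have hnd : ∀ q : ℕ, q.Prime → x < 16 * q → ∀ s, ¬ (Q.V.sd s : ℤ) ∣ q := fun q hq hxq s h => by
    have h1 := (Nat.prime_dvd_prime_iff_eq (Q.V.prime s) hq).1 (by exact_mod_cast h)
    have := hQs s; omega
  have hFF : ∀ q : ℕ, q.Prime → x < 16 * q → ∑ p ∈ Q.P1, ∑ i ∈ range κ, Q.wt p ((q:ℤ) - i * p) = Q.FF q :=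
    fun q hq hxq => by
    unfold QS.FF
    refine sum_congr rfl fun p hp => ?_
    rw [Finset.sum_range]
    exact sum_congr rfl fun i _ => Q.wt_eq_ff hp i (hcop q hq hxq) (hnd q hq hxq)
  set QQ : Finset ℕ := {q ∈ PP y | x < 16 * q ∧ Q.mm / 2 ≤ Q.FF q} with hQQ
  have hmm : 0 < Q.mm := by
    unfold QS.mm
    have : (0:ℝ) < #Q.P1 := by exact_mod_cast hP0
    have : (0:ℝ) < κ := by exact_mod_cast hκ1
    positivity
  let V : AC (PI w z) :=
  { sd := fun s => s
    prime := fun s => (mem_PI.1 s.2).1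
    κ := κ
    w := w
    hκ := hκ1
    hκw := by exact_mod_cast (by omega : κ < w)
    hw := fun s => by exact_mod_cast (mem_PI.1 s.2).2.2.le
    P1 := Q.P1
    hP := Q.hP
    hPκ := Q.hPκ
    hPs := fun p hp s => lt_of_le_of_lt (mem_PI.1 s.2).2.1 (hPx p hp).2.2
    A := fun p n => (Q.A p n).image Fin.val
    hA := fun p n k hk => by
      obtain ⟨i, _, rfl⟩ := mem_image.1 hk
      exact mem_range.2 i.2
    wt := Q.wt
    wt0 := Q.wt_nonneg
    B := 9 * Q.V.R ^ 6
    wtB := Q.wt_le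
    N0 := Finset.Ico M (M + (N * Q.WT : ℕ))
    hN0 := by rw [Finset.nonempty_Ico]; push_cast; have : 0 < N * Q.WT := by omega
              zify at this; linarith
    y := y
    hy := hy
    tot := fun p hp => by
      rw [Ico_img, sum_image (fun a _ b _ h => by simpa using h)]
      refine (Q.tot_all hp M N).trans ?_
      linarith
    Q := QQ.image (fun q : ℕ => (q:ℤ))
    hQN := fun q hq p hp i hi => by
      obtain ⟨q, hq', rfl⟩ := mem_image.1 hq
      have h1 := (mem_PP.1 (mem_filter.1 hq').1).2
      have h2 : i * p ≤ κ * x := Nat.mul_le_mul hi.le (hPx p hp).2.1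
      rw [mem_Ico, hM]
      zify at h1 h2 hT1
      push_cast
      constructor
      · linarith
      · have : (0:ℤ) ≤ i * p := by positivity
        linarith
    hQA := fun q hq p hp i hi => by
      obtain ⟨q, hq', rfl⟩ := mem_image.1 hq
      have h1 := mem_filter.1 hq'
      exact mem_image.2 ⟨⟨i, hi⟩, Q.A_mem ⟨i, hi⟩ (hcop q (mem_PP.1 h1.1).1 h1.2.1), rfl⟩
    Λ := Λ
    hΛ := fun p hp p' hp' n hn n' hn' h hh h' hh' h0 => by
      refine card_dvd_le _ (fun s => (mem_PI.1 s.2).1) Subtype.val_injective _ h0 Λ ?_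
      have h2 : h * p ≤ κ * x := Nat.mul_le_mul hh.le (hPx p hp).2.1
      have h3 : h' * p' ≤ κ * x := Nat.mul_le_mul hh'.le (hPx p' hp').2.1
      have h4 := mem_Ico.1 hn
      have h5 := mem_Ico.1 hn'
      have h6 : N * Q.WT + κ * x ≤ 2 ^ Λ := by nlinarith
      zify at h2 h3 h6
      push_cast at h4 h5
      have : (0:ℤ) ≤ h * p := by positivity
      have : (0:ℤ) ≤ h' * p' := by positivity
      rw [abs_le]; constructor <;> linarith
    ε := Q.ε
    hε := hε0
    hβ := hbeta h2κ.le (by omega) hε1 hε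
    S := S
    hS := fun j hj => by
      refine le_trans ?_ (mul_le_mul_of_nonneg_right hS ?_)
      · rw [← Finset.prod_coe_sort (PI w z), ← Finset.prod_pow, ← Finset.prod_mul_distrib]
        have : ∀ s : PI w z, (1:ℝ) ≤ (1 + 1 / ((s:ℕ):ℝ)) ^ (2 * κ) * (1 - (j:ℝ) / ((s:ℕ):ℝ)) := fun s =>
          hS_aux hj (by have := (mem_PI.1 s.2).2.2; omega) (mem_PI.1 s.2).1.pos
        calc (1:ℝ) = ∏ s : PI w z, (1:ℝ) := by simp
          _ ≤ _ := prod_le_prod (fun _ _ => zero_le_one) (fun s _ => this s)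
      · refine prod_nonneg fun s _ => sub_nonneg.2 (div_le_one_of_le₀ ?_ (by positivity))
        exact_mod_cast (by have := (mem_PI.1 s.2).2.2; omega : j ≤ (s:ℕ))
    m := Q.mm
    hm0 := hmm
    hF := fun q hq => by
      obtain ⟨q, hq', rfl⟩ := mem_image.1 hq
      have h1 := mem_filter.1 hq'
      rw [hFF q (mem_PP.1 h1.1).1 h1.2.1]
      exact h1.2.2
    Nc := 32 * y / x + 1
    hNc := fun p hp n hn => by
      refine (Ico_dvd_count M _ p (Q.hP p hp).pos n).trans ?_
      have hp0 : (0:ℝ) < p := by exact_mod_cast (Q.hP p hp).pos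
      have : (x:ℝ) ≤ 16 * p := by exact_mod_cast (hPx p hp).1.le
      refine add_le_add_left ?_ 1
      rw [div_le_div_iff₀ hp0 hxr]
      push_cast
      nlinarith
    num1 := num1
    num2 := num2
    num3 := by
      unfold QS.mm
      have : (0:ℝ) ≤ #Q.P1 * κ := by positivity
      nlinarith }
  obtain ⟨a, n, han⟩ := V.main
  let r : ℕ → ℤ := fun p => if h : p ∈ PI w z then ((a ⟨p, h⟩).val : ℤ) else n p
  refine ⟨r, ?_⟩
  have hqc := Q.qc hP0 (y / Q.WT + 1)
  have hsub : ({q ∈ PP y | x < 16 * q ∧ ∀ p, p ∈ PI w z ∨ p ∈ Q.P1 → ¬ (p:ℤ) ∣ q - r p} : Finset ℕ) ⊆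
      (({q ∈ V.Q | (∀ s, (q : ZMod (V.sd s)) ≠ a s) ∧ ∀ p ∈ V.P1, ¬ (p:ℤ) ∣ q - n p} : Finset ℤ).image Int.toNat) ∪
      {q ∈ range ((y / Q.WT + 1) * Q.WT) | IsCoprime ((q:ℕ):ℤ) (Q.WT:ℤ) ∧ Q.FF (q:ℕ) < Q.mm / 2} := by
    intro q hq
    obtain ⟨h1, h2, h3⟩ := mem_filter.1 hq
    have hqp := mem_PP.1 h1
    rw [mem_union]
    rcases le_or_gt (Q.mm / 2) (Q.FF q) with h | h
    · left
      refine mem_image.2 ⟨(q:ℤ), mem_filter.2 ⟨mem_image.2 ⟨q, mem_filter.2 ⟨h1, h2, h⟩, rfl⟩, ?_, ?_⟩, by simp⟩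
      · intro s hs
        apply h3 s.1 (Or.inl s.2)
        have e : r s.1 = ((a s).val : ℤ) := by simp only [r]; rw [dif_pos s.2]
        rw [e]
        have : NeZero ((s:ℕ)) := ⟨(mem_PI.1 s.2).1.ne_zero⟩
        rw [← ZMod.intCast_zmod_eq_zero_iff_dvd]
        push_cast
        have e2 : (((a s).val : ℕ) : ZMod (s:ℕ)) = a s := ZMod.natCast_zmod_val (n := (s:ℕ)) (a s)
        rw [e2, sub_eq_zero]
        exact_mod_cast hs
      · intro p hp
        have := h3 p (Or.inr hp)
        have hnp : p ∉ PI w z := fun h => by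
          have := (mem_PI.1 h).2.1; have := (hPx p hp).2.2; omega
        simp only [r] at this
        rwa [dif_neg hnp] at this
    · right
      refine mem_filter.2 ⟨mem_range.2 (lt_of_le_of_lt hqp.2 ?_), hcop q hqp.1 h2, h⟩
      rw [add_mul, one_mul]; exact Nat.lt_div_mul_add hWT
  have hcard : (#{q ∈ PP y | x < 16 * q ∧ ∀ p, p ∈ PI w z ∨ p ∈ Q.P1 → ¬ (p:ℤ) ∣ q - r p} : ℝ) ≤
      #{q ∈ V.Q | (∀ s, (q : ZMod (V.sd s)) ≠ a s) ∧ ∀ p ∈ V.P1, ¬ (p:ℤ) ∣ q - n p} +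
      #{q ∈ range ((y / Q.WT + 1) * Q.WT) | IsCoprime ((q:ℕ):ℤ) (Q.WT:ℤ) ∧ Q.FF (q:ℕ) < Q.mm / 2} := by
    have := (card_le_card hsub).trans ((card_union_le _ _).trans (Nat.add_le_add_right card_image_le _))
    exact_mod_cast this
  have hQc : (#V.Q : ℝ) ≤ #(PP y) := by
    exact_mod_cast card_image_le.trans (card_le_card (filter_subset _ _))
  have hσ1 : V.σ 1 ≤ σ' := by
    have hE : 0 < ∏ s ∈ PI w z, (1 + 1 / (s:ℝ)) := prod_pos fun s _ => by positivity
    have : V.σ 1 * ∏ s ∈ PI w z, (1 + 1 / (s:ℝ)) ≤ 1 := by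
      rw [← Finset.prod_coe_sort (PI w z)]
      change (∏ s : PI w z, (1 - ((1:ℕ):ℝ) / ((s:ℕ):ℝ))) * _ ≤ 1
      rw [← prod_mul_distrib]
      refine prod_le_one (fun s _ => ?_) (fun s _ => ?_)
      all_goals
        have h0 : (0:ℝ) ≤ 1 / ((s:ℕ):ℝ) := by positivity
        have h1 : 1 / ((s:ℕ):ℝ) ≤ 1 := by
          rw [div_le_one (by exact_mod_cast (mem_PI.1 s.2).1.pos)]
          exact_mod_cast (mem_PI.1 s.2).1.one_le
        push_cast
        nlinarith
    exact le_of_mul_le_mul_right (this.trans hσ) hE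
  have hσ0 : 0 < V.σ 1 := AC.σ_pos V.hκ
  have hNW : ((y / Q.WT + 1 : ℕ):ℝ) * Q.WT ≤ y + Q.WT := by
    have : (y / Q.WT + 1) * Q.WT ≤ y + Q.WT := by rw [add_mul, one_mul]; gcongr; exact Nat.div_mul_le_self _ _
    exact_mod_cast this
  have hb1 : V.σ 1 * #V.Q * Real.exp (-(V.m / (32 * V.σ 1 * V.y))) ≤
      σ' * #(PP y) * Real.exp (-(Q.mm / (32 * σ' * y))) := by
    have h1 := sig_exp_mono hσ0 hσ1 (c := Q.mm / (32 * y)) (by positivity)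
    have e1 : V.m / (32 * V.σ 1 * V.y) = Q.mm / (32 * y) / V.σ 1 := by
      rw [div_div]; congr 1; change _ = 32 * V.y * _; ring
    have e2 : Q.mm / (32 * σ' * y) = Q.mm / (32 * y) / σ' := by rw [div_div]; congr 1; ring
    rw [e1, e2]
    calc _ = (V.σ 1 * Real.exp (-(Q.mm / (32 * y) / V.σ 1))) * #V.Q := by ring
      _ ≤ (σ' * Real.exp (-(Q.mm / (32 * y) / σ'))) * #(PP y) := by
        refine mul_le_mul h1 hQc (by positivity) ?_
        have := hσ0.le.trans hσ1
        positivity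
      _ = _ := by ring
  have hb2 : 8 * V.ε * #V.Q ≤ 8 * Q.ε * #(PP y) := mul_le_mul_of_nonneg_left hQc (by linarith)
  have hb3 : Q.WT * (16 * Q.ε * (y / Q.WT + 1 : ℕ) + 1440 * Q.V.R ^ 12 + 36 * Q.V.R ^ 6 * (y / Q.WT + 1 : ℕ) / #Q.P1) ≤
      16 * Q.ε * (y + Q.WT) + 1440 * Q.WT * Q.V.R ^ 12 + 36 * Q.V.R ^ 6 * (y + Q.WT) / #Q.P1 := by
    have hR6 : 0 ≤ Q.V.R ^ 6 := by positivity
    calc _ = 16 * Q.ε * (((y / Q.WT + 1 : ℕ):ℝ) * Q.WT) + 1440 * Q.WT * Q.V.R ^ 12 +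
          36 * Q.V.R ^ 6 * (((y / Q.WT + 1 : ℕ):ℝ) * Q.WT) / #Q.P1 := by ring
      _ ≤ _ := by gcongr
  have hb4 : 768 * V.ε * V.y = 768 * Q.ε * y := rfl
  linarith

open Classical in
lemma cover_all (x y w z : ℕ) (P1 P2 : Finset ℕ) (r0 : ℕ → ℤ)
    (hP1 : ∀ p ∈ P1, p.Prime ∧ x < 16 * p ∧ p ≤ x) (hP2 : ∀ p ∈ P2, p.Prime ∧ x < 16 * p ∧ p ≤ x)
    (hd : Disjoint P1 P2) (hwz : w ≤ z) (hz : 16 * z ≤ x) (hy : 16 * y ≤ w * x)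
    (hc : #{q ∈ PP y | x < 16 * q ∧ ∀ p, p ∈ PI w z ∨ p ∈ P1 → ¬ (p:ℤ) ∣ q - r0 p} +
      #{n ∈ Icc 1 y | ∀ p ∈ n.primeFactors, p ≤ z} ≤ #P2) :
    ∃ r : ℕ → ℤ, ∀ n ∈ Icc 1 y, ∃ p ∈ PP x, (p:ℤ) ∣ (n:ℤ) - r p := by
  set r1 : ℕ → ℤ := fun p => if p ∈ PI w z ∨ p ∈ P1 then r0 p else 0 with hr1
  set U : Finset ℕ := {n ∈ Icc 1 y | ∀ p ∈ PP x, p ∉ P2 → ¬ (p:ℤ) ∣ (n:ℤ) - r1 p} with hU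
  have hsmall : ∀ n ∈ U, ∀ p, p.Prime → 16 * p ≤ x → p ∣ n → p ∈ PI w z := fun n hn p hp hpx hpn => by
    by_contra h
    have h1 : p ∉ P1 := fun h => by have := (hP1 p h).2.1; omega
    have h2 : p ∉ P2 := fun h => by have := (hP2 p h).2.1; omega
    refine (mem_filter.1 hn).2 p (mem_PP.2 ⟨hp, by omega⟩) h2 ?_
    have : r1 p = 0 := if_neg (by tauto)
    rw [this, sub_zero]; exact_mod_cast hpn
  have hUs : U ⊆ ({q ∈ PP y | x < 16 * q ∧ ∀ p, p ∈ PI w z ∨ p ∈ P1 → ¬ (p:ℤ) ∣ q - r0 p} : Finset ℕ) ∪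
      {n ∈ Icc 1 y | ∀ p ∈ n.primeFactors, p ≤ z} := by
    intro n hn
    have hn1 := (mem_filter.1 hn).1
    have hn1' := mem_Icc.1 hn1
    rw [mem_union]
    by_cases hs : ∀ p ∈ n.primeFactors, p ≤ z
    · right; exact mem_filter.2 ⟨hn1, hs⟩
    left
    push Not at hs
    obtain ⟨p, hpn, hpz⟩ := hs
    have hp := Nat.prime_of_mem_primeFactors hpn
    have hpd := Nat.dvd_of_mem_primeFactors hpn
    have hpx : x < 16 * p := by
      by_contra! h
      have := (mem_PI.1 (hsmall n hn p hp h hpd)).2.1; omega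
    obtain ⟨m, hm⟩ := hpd
    have hm0 : m ≠ 0 := by rintro rfl; omega
    have hm1 : m = 1 := by
      by_contra h1
      obtain ⟨p', hp', hd'⟩ := Nat.exists_prime_and_dvd h1
      have hmw : m < w := by
        by_contra! h
        have h3 : w * x < w * (16 * p) ∨ w = 0 := by
          rcases Nat.eq_zero_or_pos w with h | h
          · right; exact h
          · left; exact Nat.mul_lt_mul_of_pos_left hpx h
        have h4 : 16 * (p * w) ≤ 16 * (p * m) := by gcongr
        rcases h3 with h3 | h3
        · nlinarith
        · subst h3; omega
      have h5 := Nat.le_of_dvd (Nat.pos_of_ne_zero hm0) hd'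
      have := (mem_PI.1 (hsmall n hn p' hp' (by omega) (hm ▸ Dvd.dvd.mul_left hd' p))).2.2
      omega
    rw [hm1, mul_one] at hm
    subst hm
    refine mem_filter.2 ⟨mem_PP.2 ⟨hp, hn1'.2⟩, hpx, fun s hs => ?_⟩
    have e : r1 s = r0 s := if_pos hs
    rw [← e]
    refine (mem_filter.1 hn).2 s ?_ ?_
    · rcases hs with h | h
      · have := mem_PI.1 h; exact mem_PP.2 ⟨this.1, by omega⟩
      · exact mem_PP.2 ⟨(hP1 s h).1, (hP1 s h).2.2⟩
    · rcases hs with h | h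
      · intro h2; have := (hP2 s h2).2.1; have := (mem_PI.1 h).2.1; omega
      · exact Finset.disjoint_left.1 hd h
  have hUc : #U ≤ #P2 := ((card_le_card hUs).trans (card_union_le _ _)).trans hc
  obtain ⟨f⟩ : Nonempty (U ↪ P2) := Function.Embedding.nonempty_of_card_le (by simpa using hUc)
  let r : ℕ → ℤ := fun p => if h : ∃ u : U, ((f u : P2) : ℕ) = p then ((h.choose : U) : ℕ) else r1 p
  refine ⟨r, fun n hn => ?_⟩
  by_cases hnU : n ∈ U
  · refine ⟨f ⟨n, hnU⟩, ?_, ?_⟩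
    · have := hP2 _ (f ⟨n, hnU⟩).2; exact mem_PP.2 ⟨this.1, this.2.2⟩
    · have h : ∃ u : U, ((f u : P2) : ℕ) = (f ⟨n, hnU⟩ : P2) := ⟨_, rfl⟩
      have h2 : h.choose = ⟨n, hnU⟩ := f.injective (Subtype.ext h.choose_spec)
      have : r (f ⟨n, hnU⟩ : P2) = n := by simp only [r]; rw [dif_pos h, h2]
      rw [this]; simp
  · have : ∃ p ∈ PP x, p ∉ P2 ∧ (p:ℤ) ∣ (n:ℤ) - r1 p := by
      by_contra! h
      exact hnU (mem_filter.2 ⟨hn, fun p hp hp2 => h p hp hp2⟩)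
    obtain ⟨p, hp, hp2, h⟩ := this
    refine ⟨p, hp, ?_⟩
    have : r p = r1 p := by
      simp only [r]; rw [dif_neg]; rintro ⟨u, rfl⟩; exact hp2 (f u).2
    rwa [this]

lemma card_PP (n : ℕ) : #(PP n) = Nat.primeCounting n := by
  rw [Nat.primeCounting, Nat.primeCounting', Nat.count_eq_card_filter_range]; rfl

lemma PP_upper : ∀ᶠ y : ℕ in Filter.atTop, (#(PP y) : ℝ) ≤ 4 * y / Real.log y := by
  have h := tendsto_natCast_atTop_atTop (R := ℝ) |>.eventually (Chebyshev.eventually_primeCounting_le (ε := 1) one_pos)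
  filter_upwards [h] with y hy
  rw [Nat.floor_natCast] at hy
  rw [card_PP]
  refine hy.trans ?_
  have h4 : Real.log 4 = 2 * Real.log 2 := by rw [← Real.log_rpow two_pos]; norm_num
  have := Real.log_two_lt_d9
  have hl : 0 ≤ Real.log y := Real.log_natCast_nonneg y
  gcongr; linarith

lemma P_lower : ∀ᶠ x : ℕ in Filter.atTop, (x:ℝ) / (2 * Real.log x) ≤ #{p ∈ PP x | x < 16 * p} := by
  have h1 : ∀ᶠ x : ℝ in Filter.atTop, ‖Real.log x‖ ≤ 1/100 * ‖x ^ (1/4:ℝ)‖ :=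
    (isLittleO_log_rpow_atTop (by norm_num : (0:ℝ) < 1/4)).bound (by norm_num)
  have h2 := tendsto_natCast_atTop_atTop (R := ℝ) |>.eventually h1
  filter_upwards [h2, Filter.eventually_ge_atTop 16] with x hx h16
  have hx16 : (16:ℝ) ≤ x := by exact_mod_cast h16
  have hx0 : (0:ℝ) < x := by linarith
  have hl : 1 ≤ Real.log x := by
    rw [Real.le_log_iff_exp_le hx0]; have := Real.exp_one_lt_d9; linarith
  have hth := Chebyshev.theta_ge x
  have hth2 := Chebyshev.theta_le_log4_mul_x (x := (x:ℝ) / 16) (by positivity)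
  have h4 : Real.log 4 = 2 * Real.log 2 := by rw [← Real.log_rpow two_pos]; norm_num
  have hl1 := Real.log_two_lt_d9
  have hl2 := Real.log_two_gt_d9
  set u := (x:ℝ) ^ (1/4:ℝ) with hu
  have hu0 : 0 < u := by positivity
  have hu4 : u ^ 4 = x := by rw [hu, ← Real.rpow_natCast, ← Real.rpow_mul hx0.le]; norm_num
  have hu1 : 2 ≤ u := by
    by_contra! h
    have : u ^ 4 < 2 ^ 4 := by gcongr
    linarith
  have hs : √(x:ℝ) = u ^ 2 := by
    rw [← hu4, show u ^ 4 = (u ^ 2) ^ 2 by ring, Real.sqrt_sq (by positivity)]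
  have hxl : Real.log x ≤ 1/100 * u := by
    rw [Real.norm_of_nonneg (by linarith), Real.norm_of_nonneg hu0.le] at hx; exact hx
  have hl3 : Real.log (x + 1) ≤ 1 + Real.log x := by
    have : Real.log ((x:ℝ) + 1) ≤ Real.log (2 * x) := Real.log_le_log (by linarith) (by linarith)
    rw [Real.log_mul (by norm_num) (by linarith)] at this; linarith
  have hsum : Chebyshev.theta x - Chebyshev.theta ((x:ℝ)/16) ≤ #{p ∈ PP x | x < 16 * p} * Real.log x := by
    rw [Chebyshev.theta_eq_sum_Icc, Chebyshev.theta_eq_sum_Icc, Nat.floor_natCast, sub_le_iff_le_add]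
    have hsub : ({p ∈ Icc 0 x | p.Prime} : Finset ℕ) ⊆ {p ∈ PP x | x < 16 * p} ∪ {p ∈ Icc 0 ⌊(x:ℝ)/16⌋₊ | p.Prime} := by
      intro p hp
      have hp := mem_filter.1 hp
      have hp2 := (mem_Icc.1 hp.1).2
      rw [mem_union]
      by_cases h : x < 16 * p
      · left; exact mem_filter.2 ⟨mem_PP.2 ⟨hp.2, hp2⟩, h⟩
      · right
        refine mem_filter.2 ⟨mem_Icc.2 ⟨by omega, Nat.le_floor ?_⟩, hp.2⟩
        rw [le_div_iff₀ (by norm_num)]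
        have : p * 16 ≤ x := by omega
        exact_mod_cast this
    have hnn : ∀ p : ℕ, 0 ≤ Real.log p := fun p => Real.log_natCast_nonneg p
    refine (sum_le_sum_of_subset_of_nonneg hsub fun p _ _ => hnn p).trans ?_
    have hui := sum_union_inter (s₁ := ({p ∈ PP x | x < 16 * p} : Finset ℕ)) (s₂ := ({p ∈ Icc 0 ⌊(x:ℝ)/16⌋₊ | p.Prime} : Finset ℕ))
      (f := fun p : ℕ => Real.log p)
    have hin : 0 ≤ ∑ p ∈ ({p ∈ PP x | x < 16 * p} : Finset ℕ) ∩ ({p ∈ Icc 0 ⌊(x:ℝ)/16⌋₊ | p.Prime} : Finset ℕ), Real.log p :=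
      sum_nonneg fun p _ => hnn p
    suffices hc : ∑ p ∈ PP x with x < 16 * p, Real.log p ≤ #{p ∈ PP x | x < 16 * p} * Real.log x by linarith
    rw [← nsmul_eq_mul]
    refine sum_le_card_nsmul _ _ _ fun p hp => ?_
    have := mem_PP.1 (mem_filter.1 hp).1
    exact Real.log_le_log (by exact_mod_cast this.1.pos) (by exact_mod_cast this.2)
  rw [div_le_iff₀ (by linarith)]
  rw [hs] at hth
  rw [h4] at hth2
  have e1 : 2 * u ^ 2 * Real.log x ≤ x / 100 := by
    calc 2 * u ^ 2 * Real.log x ≤ 2 * u ^ 2 * (1/100 * u) := by gcongr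
      _ ≤ u ^ 4 / 100 := by nlinarith [pow_pos hu0 3]
      _ = x / 100 := by rw [hu4]
  have e2 : Real.log (x + 1) ≤ x / 16 + x/100 := by
    have : u ≤ x := by rw [← hu4]; nlinarith [pow_pos hu0 3, pow_le_pow_left₀ (by norm_num) hu1 3]
    linarith
  nlinarith

lemma prod_PI_ge {w z : ℕ} (hw : 3 ≤ w) (hz : w ≤ z) :
    Real.log z / (32 * Real.log w) ≤ ∏ s ∈ PI w z, (1 + 1 / (s:ℝ)) := by
  have h1 := prod_PP_ge z (by omega)
  have h2 := mertens_up w hw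
  have hl : 0 < Real.log w := Real.log_pos (by exact_mod_cast (by omega : 1 < w))
  have e : (∏ p ∈ PP w, (1 + 1 / (p:ℝ))) * ∏ p ∈ PI w z, (1 + 1 / (p:ℝ)) = ∏ p ∈ PP z, (1 + 1 / (p:ℝ)) := by
    rw [← prod_union]
    · refine prod_congr ?_ fun _ _ => rfl
      ext p; simp only [mem_union, mem_PP, mem_PI]; constructor
      · rintro (⟨h, h'⟩ | ⟨h, h', _⟩); exacts [⟨h, by omega⟩, ⟨h, h'⟩]
      · rintro ⟨h, h'⟩; rcases le_or_gt p w with h3 | h3; exacts [Or.inl ⟨h, h3⟩, Or.inr ⟨h, h', h3⟩]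
    · rw [disjoint_left]; intro p hp hp'; have := (mem_PP.1 hp).2; have := (mem_PI.1 hp').2.2; omega
  have hE : 0 ≤ ∏ p ∈ PI w z, (1 + 1 / (p:ℝ)) := prod_nonneg fun p _ => by positivity
  rw [div_le_iff₀ (by positivity)]
  rw [← e] at h1
  have := mul_le_mul_of_nonneg_right h2 hE
  nlinarith

lemma WT_le (w : ℕ) : (((∏ p ∈ PP w, p : ℕ)) : ℝ) ≤ Real.exp (2 * w) := by
  have h : ∏ p ∈ PP w, p ≤ 4 ^ w := primorial_le_four_pow w
  have h2 : (((∏ p ∈ PP w, p : ℕ)) : ℝ) ≤ (4:ℝ) ^ w := by exact_mod_cast h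
  refine h2.trans ?_
  have : (4:ℝ) ≤ Real.exp 2 := by
    have h1 := Real.exp_one_gt_d9
    rw [show (2:ℝ) = 1 + 1 by norm_num, Real.exp_add]; nlinarith
  calc (4:ℝ) ^ w ≤ (Real.exp 2) ^ w := by gcongr
    _ = _ := by rw [← Real.exp_nat_mul]; congr 1; ring

structure Pm (b : ℕ) (A x L R : ℝ) : Prop where
  hb : 1000 ≤ b
  hA : A = 2 ^ b
  hL1 : A ^ 100 ≤ L
  hL2 : L ≤ 2 ^ 100 * A ^ 100
  hR : R = Real.exp (L / 200)
  hx : x = R ^ 200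

namespace Pm
variable {b : ℕ} {A x L R : ℝ}

lemma A2 (h : Pm b A x L R) : 2 ^ 200 ≤ A := by
  rw [h.hA]; exact pow_le_pow_right₀ (by norm_num) (by have := h.hb; omega)

lemma A0 (h : Pm b A x L R) : 1 ≤ A := le_trans (one_le_pow₀ (by norm_num)) h.A2

lemma bA (h : Pm b A x L R) : (b:ℝ) ≤ A := by
  rw [h.hA]; exact_mod_cast (Nat.lt_two_pow_self (n := b)).le

lemma b1 (h : Pm b A x L R) : (1000:ℝ) ≤ b := by exact_mod_cast h.hb

lemma cA (h : Pm b A x L R) (m : ℕ) {n : ℕ} {c : ℝ} (hc : c ≤ 2 ^ 200) (hn : m < n) : c * A ^ m ≤ A ^ n :=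
  calc c * A ^ m ≤ A * A ^ m := by have := h.A0; gcongr; exact hc.trans h.A2
    _ = A ^ (m + 1) := by ring
    _ ≤ A ^ n := pow_le_pow_right₀ h.A0 hn

lemma cA' (h : Pm b A x L R) {n : ℕ} {c : ℝ} (hc : c ≤ 2 ^ 200) (hn : 0 < n) : c ≤ A ^ n := by
  simpa using h.cA 0 hc hn

lemma LA (h : Pm b A x L R) : L ≤ A ^ 101 := h.hL2.trans (h.cA 100 (by norm_num) (by norm_num))

lemma L0 (h : Pm b A x L R) : 1 ≤ L := le_trans (one_le_pow₀ h.A0) h.hL1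

lemma expR (h : Pm b A x L R) {t : ℝ} (ht : 200 * t ≤ L) : Real.exp t ≤ R := by
  rw [h.hR]; exact Real.exp_le_exp.2 (by linarith)

lemma AR (h : Pm b A x L R) : A ^ 10000 ≤ R := by
  have h1 : A = Real.exp (b * Real.log 2) := by rw [h.hA, mul_comm, ← Real.rpow_def_of_pos two_pos, Real.rpow_natCast]
  have h2 : A ^ 10000 = Real.exp (10000 * (b * Real.log 2)) := by
    conv_lhs => rw [h1]
    rw [← Real.exp_nat_mul]; norm_num
  rw [h2]
  refine h.expR ?_
  have h3 := Real.log_two_lt_d9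
  have h4 := h.cA (c := 2000000) 1 (n := 100) (by norm_num) (by norm_num)
  have h5 := h.bA
  have h6 : b * Real.log 2 ≤ A := by nlinarith [h.b1]
  linarith [h.hL1]

lemma ApR (h : Pm b A x L R) {n : ℕ} (hn : n ≤ 10000) : A ^ n ≤ R := (pow_le_pow_right₀ h.A0 hn).trans h.AR

lemma cR (h : Pm b A x L R) {c : ℝ} (hc : c ≤ 2 ^ 200) : c ≤ R := (h.cA' hc (n := 1) (by norm_num)).trans (h.ApR (by norm_num))

lemma R0 (h : Pm b A x L R) : 1 ≤ R := h.cR (by norm_num)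

lemma Rx (h : Pm b A x L R) {n : ℕ} (hn : n ≤ 200) : R ^ n ≤ x := by rw [h.hx]; exact pow_le_pow_right₀ h.R0 hn

lemma x0 (h : Pm b A x L R) : 1 ≤ x := h.Rx (n := 0) (by norm_num)

lemma logb (h : Pm b A x L R) : 1 ≤ Real.log b ∧ Real.log b ≤ b := by
  have := h.b1
  refine ⟨?_, (Real.log_le_sub_one_of_pos (by linarith)).trans (by linarith)⟩
  rw [Real.le_log_iff_exp_le (by linarith)]; have := Real.exp_one_lt_d9; linarith

lemma logA (h : Pm b A x L R) : Real.log A ≤ 7/10 * b ∧ b ≤ 2 * Real.log A := by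
  have h3 := Real.log_two_lt_d9
  have h4 := Real.log_two_gt_d9
  rw [h.hA, Real.log_pow]; constructor <;> nlinarith [h.b1]

end Pm

/-- the sifting level -/
lemma Pm.zz {b : ℕ} {A x L R : ℝ} (h : Pm b A x L R) {T : ℝ} (hT : T = L * Real.log b / (1024 * b)) :
    A ^ 98 ≤ T ∧ T ≤ L / 1024 ∧ ((⌊Real.exp T⌋₊ : ℕ):ℝ) ≤ R ∧ T / 2 ≤ Real.log ⌊Real.exp T⌋₊ ∧
      Real.log ⌊Real.exp T⌋₊ ≤ T ∧ A ^ 1000 ≤ ((⌊Real.exp T⌋₊ : ℕ):ℝ) := by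
  have hb0 : (0:ℝ) < b := by linarith [h.b1]
  have hl := h.logb
  have hL := h.L0
  have hA := h.A0
  have e1 : A ^ 98 ≤ T := by
    rw [hT, le_div_iff₀ (by positivity)]
    calc A ^ 98 * (1024 * b) ≤ A ^ 98 * (1024 * A) := by have := h.bA; gcongr
      _ = 1024 * A ^ 99 := by ring
      _ ≤ A ^ 100 := h.cA 99 (by norm_num) (by norm_num)
      _ ≤ L := h.hL1
      _ ≤ L * Real.log b := by nlinarith
  have e2 : T ≤ L / 1024 := by
    rw [hT, div_le_div_iff₀ (by positivity) (by norm_num)]; nlinarith [hl.2]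
  have hT0 : 4 ≤ T := le_trans (h.cA' (by norm_num) (by norm_num)) e1
  have e3 : ((⌊Real.exp T⌋₊ : ℕ):ℝ) ≤ Real.exp T := Nat.floor_le (Real.exp_pos _).le
  have e4 : Real.exp (T / 2) ≤ ((⌊Real.exp T⌋₊ : ℕ):ℝ) := by
    have h1 := Nat.lt_floor_add_one (Real.exp T)
    have h2 : Real.exp T = Real.exp (T / 2) * Real.exp (T / 2) := by rw [← Real.exp_add]; ring_nf
    have h3 := Real.add_one_le_exp (T / 2)
    nlinarith
  have hz0 : (0:ℝ) < ((⌊Real.exp T⌋₊ : ℕ):ℝ) := (Real.exp_pos _).trans_le e4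
  refine ⟨e1, e2, e3.trans (h.expR (by linarith)), (Real.le_log_iff_exp_le hz0).2 e4, (Real.log_le_iff_le_exp hz0).2 e3, le_trans ?_ e4⟩
  rw [← Real.log_le_iff_le_exp (by positivity), Real.log_pow]
  have := h.cA (c := 2000) 1 (n := 98) (by norm_num) (by norm_num)
  have := h.bA
  have := h.logA.1
  push_cast; linarith

lemma Pm.yy {b : ℕ} {A x L R y : ℝ} (h : Pm b A x L R) (h1 : x * L / (2 ^ 97 * b) ≤ y) (h2 : y ≤ x * L / (2 ^ 96 * b)) :
    x * A ^ 98 ≤ y ∧ y ≤ x * L := by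
  have hb0 : (1:ℝ) ≤ b := by linarith [h.b1]
  have hL := h.L0
  have hA := h.A0
  have hx := h.x0
  constructor
  · refine le_trans ?_ h1
    rw [le_div_iff₀ (by positivity)]
    calc x * A ^ 98 * (2 ^ 97 * b) ≤ x * A ^ 98 * (2 ^ 97 * A) := by have := h.bA; gcongr
      _ = x * (2 ^ 97 * A ^ 99) := by ring
      _ ≤ x * A ^ 100 := by gcongr; exact h.cA 99 (by norm_num) (by norm_num)
      _ ≤ _ := by gcongr; exact h.hL1
  · refine h2.trans (div_le_self (by positivity) ?_)
    nlinarith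

/-- the error terms -/
lemma Pm.errs {b : ℕ} {A x L R y W c1 N ε : ℝ} (h : Pm b A x L R) (h1 : x * A ^ 98 ≤ y) (h2 : y ≤ x * L)
    (hW : W ≤ R) (hW0 : 0 ≤ W) (hc1 : x / (8 * L) ≤ c1) (hN : N ≤ y) (hε : ε = 1 / A ^ 500) :
    8 * ε * N + 768 * ε * y + (16 * ε * (y + W) + 1440 * W * R ^ 12 + 36 * R ^ 6 * (y + W) / c1) ≤ 3 * (x / (64 * L)) := by
  have hL := h.L0
  have hA := h.A0
  have hx := h.x0
  have hR := h.R0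
  have hWy : W ≤ y := by
    have : x * 1 ≤ x * A ^ 98 := by gcongr; exact one_le_pow₀ hA
    have := h.Rx (n := 1) (by norm_num)
    linarith
  have hy0 : 0 ≤ y := hW0.trans hWy
  have hε0 : 0 ≤ ε := by rw [hε]; positivity
  have e1 : 8 * ε * N + 768 * ε * y + 16 * ε * (y + W) ≤ x / (64 * L) := by
    have : 8 * ε * N + 768 * ε * y + 16 * ε * (y + W) ≤ 8 * ε * y + 768 * ε * y + 16 * ε * (y + y) := by gcongr
    have h3 : ε * y * (2 ^ 10 * (64 * L)) ≤ x := by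
      rw [hε, one_div, inv_mul_eq_div, div_mul_eq_mul_div, div_le_iff₀ (by positivity)]
      calc y * (2 ^ 10 * (64 * L)) ≤ (x * L) * (2 ^ 10 * (64 * L)) := by gcongr
        _ = x * (2 ^ 16 * (L * L)) := by ring
        _ ≤ x * (2 ^ 16 * (A ^ 101 * A ^ 101)) := by have := h.LA; gcongr
        _ = x * (2 ^ 16 * A ^ 202) := by ring
        _ ≤ x * A ^ 500 := by gcongr; exact h.cA _ (by norm_num) (by norm_num)
    rw [le_div_iff₀ (by positivity)]
    have : 0 ≤ ε * y * L := by positivity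
    nlinarith
  have hLR : 64 * L ≤ R ^ 2 := by
    have : 64 * L ≤ R * R := by
      have h3 := h.cR (c := 64) (by norm_num)
      have h4 := h.LA.trans (h.ApR (n := 101) (by norm_num))
      gcongr
    nlinarith
  have hRx : R ^ 14 ≤ x / (64 * L) := by
    rw [le_div_iff₀ (by positivity)]
    calc R ^ 14 * (64 * L) ≤ R ^ 14 * R ^ 2 := by gcongr
      _ = R ^ 16 := by ring
      _ ≤ x := h.Rx (by norm_num)
  have e2 : 1440 * W * R ^ 12 ≤ x / (64 * L) := by
    refine le_trans ?_ hRx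
    have h3 := h.cR (c := 1440) (by norm_num)
    calc 1440 * W * R ^ 12 ≤ R * R * R ^ 12 := by gcongr
      _ = R ^ 14 := by ring
  have e3 : 36 * R ^ 6 * (y + W) / c1 ≤ x / (64 * L) := by
    refine le_trans ?_ hRx
    have hc0 : 0 < c1 := lt_of_lt_of_le (by positivity) hc1
    rw [div_le_iff₀ hc0]
    calc 36 * R ^ 6 * (y + W) ≤ 36 * R ^ 6 * (x * L + x * L) := by gcongr; linarith
      _ = 576 * R ^ 6 * (L * L) * (x / (8 * L)) := by field_simp; ring
      _ ≤ R * R ^ 6 * (R * R) * c1 := by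
        have h3 := h.cR (c := 576) (by norm_num)
        have h4 := h.LA.trans (h.ApR (n := 101) (by norm_num))
        gcongr
      _ = R ^ 9 * c1 := by ring
      _ ≤ R ^ 14 * c1 := by gcongr <;> first | exact hR | norm_num
  linarith

/-- the main term -/
lemma Pm.main {b : ℕ} {A x L R y mm N σ : ℝ} (h : Pm b A x L R) (h1 : 0 < y) (h2 : y ≤ x * L / (2 ^ 96 * b))
    (hσ : σ = 2 ^ 26 * (b:ℝ) ^ 2 / (L * Real.log b)) (hN : N ≤ 4 * y / L) (hmm : b * x / 2 ^ 62 ≤ mm) :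
    σ * N * Real.exp (-(mm / (32 * σ * y))) ≤ x / (64 * L) := by
  have hL := h.L0
  have hx := h.x0
  have hl := h.logb.1
  have hb0 : (1:ℝ) ≤ b := by linarith [h.b1]
  have hσ0 : 0 < σ := by rw [hσ]; positivity
  have e1 : Real.log b ≤ mm / (32 * σ * y) := by
    rw [le_div_iff₀ (by positivity)]
    refine le_trans ?_ hmm
    calc Real.log b * (32 * σ * y) ≤ Real.log b * (32 * σ * (x * L / (2 ^ 96 * b))) := by gcongr
      _ = b * x / 2 ^ 65 := by rw [hσ]; field_simp; norm_num
      _ ≤ b * x / 2 ^ 62 := by gcongr <;> norm_num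
  have e2 : Real.exp (-(mm / (32 * σ * y))) ≤ 1 / b := by
    rw [Real.exp_neg, one_div]
    gcongr
    rwa [← Real.log_le_iff_le_exp (by linarith)]
  calc σ * N * Real.exp (-(mm / (32 * σ * y))) ≤ σ * (4 * (x * L / (2 ^ 96 * b)) / L) * (1 / b) := by
        have : N ≤ 4 * (x * L / (2 ^ 96 * b)) / L := hN.trans (by gcongr)
        gcongr
    _ = x / (2 ^ 68 * L * Real.log b) := by rw [hσ]; field_simp; norm_num
    _ ≤ x / (64 * L) := by
      gcongr x / ?_; nlinarith

/-- smooth numbers -/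
lemma Pm.smooth {b : ℕ} {A x L R y T lz : ℝ} (h : Pm b A x L R) (h1 : x ≤ y) (h2 : y ≤ x * L) (hxL : Real.log x = L)
    (hT : T = L * Real.log b / (1024 * b)) (hlz : lz ≤ T) (hlz0 : 1 ≤ lz) (hTL : T ≤ L) :
    y * Real.exp (-(1024 * b / L * Real.log y) + 8 * Real.log (16 * lz) + 8 * Real.exp (1024 * b / L * lz)) ≤ x / (64 * L) := by
  have hL := h.L0
  have hx := h.x0
  have hA := h.A0
  have hb0 : (1000:ℝ) ≤ b := h.b1
  have e1 : 1024 * b ≤ 1024 * b / L * Real.log y := by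
    have : L ≤ Real.log y := by rw [← hxL]; exact Real.log_le_log (by linarith) h1
    calc (1024:ℝ) * b = 1024 * b / L * L := by field_simp
      _ ≤ _ := by gcongr
  have e2 : Real.exp (1024 * b / L * lz) ≤ b := by
    rw [← Real.le_log_iff_exp_le (by linarith)]
    calc 1024 * b / L * lz ≤ 1024 * b / L * T := by gcongr
      _ = Real.log b := by rw [hT]; field_simp
  have e3 : Real.log (16 * lz) ≤ 102 * b := by
    have : 16 * lz ≤ A ^ 102 := by
      have := h.LA
      have := h.cA (c := 16) 101 (n := 102) (by norm_num) (by norm_num)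
      linarith
    have := Real.log_le_log (by positivity) this
    rw [Real.log_pow] at this
    push_cast at this; linarith [h.logA.1]
  have e4 : Real.exp (-(1024 * b / L * Real.log y) + 8 * Real.log (16 * lz) + 8 * Real.exp (1024 * b / L * lz)) ≤ 1 / A ^ 203 := by
    rw [one_div, ← Real.le_log_iff_exp_le (by positivity), Real.log_inv, Real.log_pow]
    push_cast; linarith [h.logA.1]
  calc _ ≤ x * L * (1 / A ^ 203) := by gcongr
    _ ≤ x / (64 * L) := by
      rw [mul_one_div, div_le_div_iff₀ (by positivity) (by positivity)]
      calc x * L * (64 * L) = x * (64 * (L * L)) := by ring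
        _ ≤ x * (64 * (A ^ 101 * A ^ 101)) := by have := h.LA; gcongr
        _ = x * (64 * A ^ 202) := by ring
        _ ≤ x * A ^ 203 := by gcongr; exact h.cA _ (by norm_num) (by norm_num)

lemma Pm.exp4 {b : ℕ} {A x L R : ℝ} (h : Pm b A x L R) : R ^ 202 ≤ 2 ^ (2 ^ (100 * b + 103)) := by
  have h2 : (2:ℝ) ^ (2 ^ (100 * b + 103)) = Real.exp (((2 ^ (100 * b + 103) : ℕ):ℝ) * Real.log 2) := by
    generalize 2 ^ (100 * b + 103) = M
    rw [mul_comm, ← Real.rpow_def_of_pos two_pos, Real.rpow_natCast]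
  rw [h2, h.hR, ← Real.exp_nat_mul, Real.exp_le_exp]
  have h3 : ((2 ^ (100 * b + 103) : ℕ):ℝ) = 8 * (2 ^ 100 * A ^ 100) := by
    rw [h.hA]; push_cast; rw [pow_add, mul_comm 100 b, pow_mul]; generalize ((2:ℝ) ^ b) ^ 100 = u; ring
  rw [h3]
  have := h.hL2
  clear h2 h3
  have := h.L0
  have := Real.log_two_gt_d9
  push_cast; nlinarith

lemma Pm.getQ {b : ℕ} {A L R : ℝ} {x : ℕ} (h : Pm b A x L R) (P1 : Finset ℕ) (hP : ∀ p ∈ P1, p.Prime ∧ x < 16 * p ∧ p ≤ x) :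
    ∃ Q : QS (PI (2 ^ (1000 * b)) ⌊R⌋₊), (∀ s, Q.V.sd s = s) ∧ Q.V.kap = 2 ^ (5 * b) ∧ Q.V.R = R ∧
      Q.WT = ∏ p ∈ PP (2 ^ b), p ∧ Q.P1 = P1 ∧ Q.ε = 1 / A ^ 500 ∧ b * L / 2 ^ 59 ≤ Q.V.kap * Q.γ := by
  have hA := h.A0
  have hL := h.L0
  have hb := h.b1
  have hbA := h.bA
  have hla := h.logA
  have hl0 : 0 < Real.log A := by linarith
  have hw : (((2 ^ (1000 * b) : ℕ)):ℝ) = A ^ 1000 := by rw [h.hA, ← pow_mul, mul_comm]; push_cast; rfl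
  have hw1 : (((2 ^ b : ℕ)):ℝ) = A := by rw [h.hA]; push_cast; rfl
  have hκ : (2:ℝ) ^ (5 * b) = A ^ 5 := by rw [h.hA, ← pow_mul, mul_comm]
  have hκ22 : (2:ℝ) ^ (5 * b + 22) = 2 ^ 22 * A ^ 5 := by rw [pow_add, hκ, mul_comm]
  have hΛ : ((2 ^ (100 * b + 103) : ℕ):ℝ) = 2 ^ 103 * A ^ 100 := by
    rw [h.hA, ← pow_mul, ← pow_add]; push_cast; congr 1; ring
  have hlw : Real.log (((2 ^ (1000 * b) : ℕ)):ℝ) = 1000 * Real.log A := by rw [hw, Real.log_pow]; norm_num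
  have h2b : 2 ≤ 2 ^ b := by simpa using Nat.pow_le_pow_right (n := 2) (by norm_num) (show 1 ≤ b from by have := h.hb; omega)
  have hww : 2 ^ b ≤ 2 ^ (1000 * b) := Nat.pow_le_pow_right (by norm_num) (by omega)
  have hbig : 2 ^ 24 * (1000 * Real.log A) ≤ L / 200 / (2 ^ 22 * A ^ 5) := by
    rw [le_div_iff₀ (by positivity), le_div_iff₀ (by norm_num)]
    calc 2 ^ 24 * (1000 * Real.log A) * (2 ^ 22 * A ^ 5) * 200 ≤ 2 ^ 24 * (1000 * A) * (2 ^ 22 * A ^ 5) * 200 := by gcongr; linarith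
      _ = 2 ^ 46 * 200000 * A ^ 6 := by ring
      _ ≤ A ^ 100 := h.cA _ (by norm_num) (by norm_num)
      _ ≤ L := h.hL1
  have hRR := h.R0
  have hRx : 16 * R ≤ x := by
    have h1 := h.cR (c := 16) (by norm_num)
    calc 16 * R ≤ R * R := by gcongr
      _ = R ^ 2 := by ring
      _ ≤ x := h.Rx (by norm_num)
  have hεr : 405 * (2 ^ (5 * b)) ^ 3 * ((2 ^ (100 * b + 103) : ℕ):ℝ) / ((2 ^ (1000 * b) : ℕ):ℝ) ≤ 1 / A ^ 500 / 2 := by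
    rw [hκ, hΛ, hw, div_div, div_le_div_iff₀ (by positivity) (by positivity)]
    calc 405 * (A ^ 5) ^ 3 * (2 ^ 103 * A ^ 100) * (A ^ 500 * 2) = 405 * 2 ^ 104 * A ^ 615 := by ring
      _ ≤ 1 * A ^ 1000 := by rw [one_mul]; exact h.cA _ (by norm_num) (by norm_num)
  have hc22 : (((5 * b : ℕ):ℝ) + 22) = 5 * b + 22 := by push_cast; ring
  rw [h.hR]
  have main := QS_exists (5 * b) (2 ^ b) (2 ^ (1000 * b)) x (2 ^ (100 * b + 103)) (L / 200) (1 / A ^ 500) P1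
    h2b hww ?_ ?_ ?_ ?_ ?_ ?_ ?_ Nat.one_le_two_pow ?_ hεr ?_
  · obtain ⟨Q, q1, q2, q3, q4, q5, q6, q7⟩ := main
    refine ⟨Q, q1, q2, q3, q4, q5, q6, ?_⟩
    rw [q2]; push_cast
    rw [hlw, hκ22, hc22] at q7
    rw [hκ]
    refine le_trans ?_ (mul_le_mul_of_nonneg_left q7 (by positivity))
    have e : A ^ 5 * ((5 * b + 22) ^ 2 * (L / 200 / (2 ^ 22 * A ^ 5)) / (2 ^ 24 * (1000 * Real.log A)))
        = (5 * b + 22) ^ 2 * L / (200 * 2 ^ 22 * 2 ^ 24 * 1000 * Real.log A) := by field_simp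
    rw [e, div_le_div_iff₀ (by norm_num) (by positivity)]
    have : b * Real.log A ≤ 2 ^ 59 / (200 * 2 ^ 22 * 2 ^ 24 * 1000) * (5 * (b:ℝ) + 22) ^ 2 := by norm_num; nlinarith
    have := mul_le_mul_of_nonneg_right this (show 0 ≤ L by linarith)
    linarith
  · refine le_trans (by norm_num : 3 ≤ 2 ^ 2) (Nat.pow_le_pow_right (by norm_num) ?_)
    have := h.hb; omega
  · rw [hw1, hκ, hκ22, hc22]
    have e1 : 2 * A ^ 5 / Real.log A * (5 * b + 22) ≤ 24 * A ^ 5 := by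
      rw [div_mul_eq_mul_div, div_le_iff₀ hl0]
      have : 0 < A ^ 5 := by positivity
      nlinarith
    have e2 : 2 * A ^ 4 * (5 * b + 22) ≤ 12 * A ^ 5 := by
      have : 0 < A ^ 4 := by positivity
      nlinarith
    have : 0 < A ^ 5 := by positivity
    nlinarith
  · rw [hlw, hκ22]; linarith
  · have := h.hL1
    have := h.cA' (c := 200) (n := 100) (by norm_num) (by norm_num)
    linarith
  · rw [hw, hκ]
    calc 2 ^ 24 * A ^ 5 * (L / 200) ≤ 2 ^ 24 * A ^ 5 * A ^ 101 := by have := h.LA; gcongr; linarith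
      _ = 2 ^ 24 * A ^ 106 := by ring
      _ ≤ A ^ 1000 := h.cA _ (by norm_num) (by norm_num)
  · intro p hp
    obtain ⟨p1, p2, p3⟩ := hP p hp
    have p2' : (x:ℝ) < 16 * p := by exact_mod_cast p2
    have hpR : R < p := by linarith
    have h5 := h.ApR (n := 5) (by norm_num)
    have h6 := h.ApR (n := 1) (by norm_num)
    refine ⟨p1, ?_, ?_, ?_, p3⟩
    · have : (2:ℝ) ^ (5 * b) < p := by rw [hκ]; linarith
      exact_mod_cast this
    · have : (((2 ^ b : ℕ)):ℝ) < p := by rw [hw1]; linarith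
      exact_mod_cast this
    · rw [← h.hR]; exact (Nat.floor_lt (by linarith)).2 hpR
  · have : 2 * 2 ^ (5 * b) * (x:ℝ) ≤ 2 ^ (2 ^ (100 * b + 103)) := by
      refine le_trans ?_ h.exp4
      rw [hκ]
      have := h.ApR (n := 5) (by norm_num)
      have := h.cR (c := 2) (by norm_num)
      calc 2 * A ^ 5 * (x:ℝ) ≤ R * R * R ^ 200 := by rw [h.hx]; gcongr
        _ = _ := by ring
    exact_mod_cast this
  · rw [div_le_one (by positivity)]; exact one_le_pow₀ hA
  · rw [hlw, hκ22, hc22]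
    refine hbig.trans ?_
    have : 0 ≤ L / 200 / (2 ^ 22 * A ^ 5) := by positivity
    exact le_mul_of_one_le_left this (by nlinarith)

lemma split_P {x : ℕ} {L : ℝ} (hL : 1 ≤ L) (hx : 8 * L ≤ x) (h : (x:ℝ) / (2 * L) ≤ #{p ∈ PP x | x < 16 * p}) :
    ∃ P1 P2 : Finset ℕ, (∀ p ∈ P1, p.Prime ∧ x < 16 * p ∧ p ≤ x) ∧ (∀ p ∈ P2, p.Prime ∧ x < 16 * p ∧ p ≤ x) ∧
      Disjoint P1 P2 ∧ x / (8 * L) ≤ #P1 ∧ x / (8 * L) ≤ #P2 := by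
  set P : Finset ℕ := {p ∈ PP x | x < 16 * p} with hP
  have hm : ∀ p ∈ P, p.Prime ∧ x < 16 * p ∧ p ≤ x := fun p hp => by
    have := mem_filter.1 hp; have h2 := mem_PP.1 this.1; exact ⟨h2.1, this.2, h2.2⟩
  obtain ⟨P1, h1, h2⟩ := exists_subset_card_eq (s := P) (n := #P / 2) (Nat.div_le_self _ _)
  have h3 : (#P:ℝ) ≤ 2 * ((#P / 2 : ℕ):ℝ) + 1 := by exact_mod_cast (by omega : #P ≤ 2 * (#P / 2) + 1)
  have h4 : (1:ℝ) ≤ x / (8 * L) := by rw [le_div_iff₀ (by positivity)]; linarith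
  have h5 : (x:ℝ) / (2 * L) = 4 * (x / (8 * L)) := by field_simp; ring
  refine ⟨P1, P \ P1, fun p hp => hm p (h1 hp), fun p hp => hm p (mem_sdiff.1 hp).1, disjoint_sdiff, ?_, ?_⟩
  · rw [h2]; linarith
  · rw [card_sdiff_of_subset h1, h2]
    have : ((#P / 2 : ℕ):ℝ) ≤ ((#P - #P / 2 : ℕ):ℝ) := by exact_mod_cast (by omega : #P / 2 ≤ #P - #P / 2)
    linarith

set_option maxHeartbeats 1000000 in
theorem core_cover {b x y : ℕ} {A L R : ℝ} (h : Pm b A x L R) (hxL : Real.log x = L)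
    (hPl : (x:ℝ) / (2 * L) ≤ #{p ∈ PP x | x < 16 * p}) (hPu : (#(PP y):ℝ) ≤ 4 * y / Real.log y)
    (hy1 : x * L / (2 ^ 97 * b) ≤ y) (hy2 : y ≤ x * L / (2 ^ 96 * b)) :
    ∃ r : ℕ → ℤ, ∀ n ∈ Icc 1 y, ∃ p ∈ PP x, (p:ℤ) ∣ (n:ℤ) - r p := by
  classical
  have hA := h.A0
  have hL := h.L0
  have hb := h.b1
  have hR := h.R0
  have hx := h.x0
  have hbA := h.bA
  have hla := h.logA
  have hlb := h.logb
  have hLA := h.LA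
  have hlb0 : Real.log b ≠ 0 := (by linarith [hlb.1] : 0 < Real.log b).ne'
  have hLR := hLA.trans (h.ApR (n := 101) (by norm_num))
  obtain ⟨y1, y2⟩ := h.yy hy1 hy2
  have hxy : (x:ℝ) ≤ y := le_trans (le_mul_of_one_le_right (by linarith) (one_le_pow₀ hA)) y1
  have hRn : ∀ n : ℕ, 0 ≤ R ^ n := fun n => by positivity
  have hR2 : R * R ≤ x := by have := h.Rx (n := 2) (by norm_num); rwa [pow_two] at this
  have hR16 := h.cR (c := 16) (by norm_num)
  have hRx16 : 16 * R ≤ x := (mul_le_mul_of_nonneg_right hR16 (by linarith)).trans hR2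
  obtain ⟨P1, P2, hP1, hP2, hd, c1, c2⟩ := split_P hL (by linarith) hPl
  obtain ⟨w, hwd⟩ : ∃ w : ℕ, w = 2 ^ (1000 * b) := ⟨_, rfl⟩
  obtain ⟨κ, hκd⟩ : ∃ w : ℕ, w = 2 ^ (5 * b) := ⟨_, rfl⟩
  obtain ⟨T, hT⟩ : ∃ T, T = L * Real.log b / (1024 * b) := ⟨_, rfl⟩
  have hgQ := h.getQ P1 hP1
  rw [← hwd, ← hκd] at hgQ
  obtain ⟨Q, q1, q2, q3, q4, q5, q6, q7⟩ := hgQ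
  have hzz := h.zz hT
  generalize ⌊Real.exp T⌋₊ = z at hzz
  obtain ⟨z1, z2, z3, z4, z5, z6⟩ := hzz
  have hw : ((w:ℕ):ℝ) = A ^ 1000 := by rw [h.hA, ← pow_mul, mul_comm, hwd]; push_cast; rfl
  have hκ : ((κ:ℕ):ℝ) = A ^ 5 := by rw [h.hA, ← pow_mul, mul_comm, hκd]; push_cast; rfl
  have hlw : Real.log w = 1000 * Real.log A := by rw [hw, Real.log_pow]; norm_num
  clear hwd hκd
  have hw3 : 3 ≤ w := by
    have : (3:ℝ) ≤ w := by rw [hw]; exact h.cA' (by norm_num) (by norm_num)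
    exact_mod_cast this
  have hwz : w ≤ z := by
    have : (w:ℝ) ≤ z := by rw [hw]; exact z6
    exact_mod_cast this
  have hWT0 : (0:ℝ) < Q.WT := by exact_mod_cast Q.hWT
  have hWT : (Q.WT:ℝ) ≤ R := by
    rw [q4]
    refine (WT_le _).trans (h.expR ?_)
    have := h.cA (c := 400) 1 (n := 100) (by norm_num) (by norm_num)
    have := h.hL1
    push_cast; rw [← h.hA]; linarith
  have hε : Q.ε * A ^ 500 = 1 := by rw [q6]; field_simp
  have hε0 : 0 < Q.ε := by rw [q6]; positivity
  have hT0 : 4 ≤ T := le_trans (h.cA' (by norm_num) (by norm_num)) z1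
  have hEl := prod_PI_ge hw3 hwz
  have hEu := prod_PI_le hw3 hwz
  have hE0 : 0 ≤ ∏ s ∈ PI w z, (1 + 1 / (s:ℝ)) := prod_nonneg fun p _ => add_nonneg zero_le_one (one_div_nonneg.2 (Nat.cast_nonneg p))
  set E := ∏ s ∈ PI w z, (1 + 1 / (s:ℝ)) with hE
  rw [hlw] at hEl hEu
  have hl0 : 0 < Real.log A := by linarith
  have hEA : E ≤ A ^ 102 := by
    refine hEu.trans ?_
    have e1 : Real.log z / (1000 * Real.log A) ≤ L := by
      rw [div_le_iff₀ (by positivity)]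
      exact le_trans (by linarith : _ ≤ L) (le_mul_of_one_le_right (by linarith) (by linarith))
    have := h.cA (c := 32) 101 (n := 102) (by norm_num) (by norm_num)
    linarith
  obtain ⟨S, hS⟩ : ∃ S, S = (A ^ 102) ^ (2 * κ) := ⟨_, rfl⟩
  have hSR : S ≤ R := by
    have e : S = Real.exp (204 * A ^ 5 * Real.log A) := by
      rw [hS, ← Real.exp_log (show 0 < A by linarith), ← Real.exp_nat_mul, ← Real.exp_nat_mul, Real.log_exp]
      congr 1; push_cast; rw [hκ, Real.exp_log (by linarith)]; ring
    rw [e]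
    refine h.expR ?_
    have := h.hL1
    calc 200 * (204 * A ^ 5 * Real.log A) ≤ 200 * (204 * A ^ 5 * A) := by gcongr; linarith
      _ = 40800 * A ^ 6 := by ring
      _ ≤ A ^ 100 := h.cA _ (by norm_num) (by norm_num)
      _ ≤ L := this
  have hS0 : 0 ≤ S := by rw [hS]; positivity
  have hκR : A ^ 5 ≤ R := h.ApR (by norm_num)
  have hmm : b * (x:ℝ) / 2 ^ 62 ≤ Q.mm := by
    rw [QS.mm, q5, mul_assoc]
    calc b * (x:ℝ) / 2 ^ 62 = x / (8 * L) * (b * L / 2 ^ 59) := by field_simp; norm_num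
      _ ≤ _ := by gcongr
  have hcx : (0:ℝ) < x / (8 * L) := by positivity
  have hεR : ∀ t : ℝ, R ^ 9 * A ^ 500 ≤ t → R ^ 9 ≤ Q.ε * t := fun t ht => by
    calc R ^ 9 = Q.ε * (R ^ 9 * A ^ 500) := by rw [mul_left_comm, hε, mul_one]
      _ ≤ Q.ε * t := by gcongr
  have hA5R := h.ApR (n := 500) (by norm_num)
  have hlA : Real.log A ≠ 0 := hl0.ne'
  have hR9 : R ^ 9 * A ^ 500 ≤ x :=
    calc R ^ 9 * A ^ 500 ≤ R ^ 9 * R := by gcongr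
      _ = R ^ 10 := by ring
      _ ≤ x := h.Rx (by norm_num)
  have h500 := h.cR (c := 500) (by norm_num)
  obtain ⟨r0, hr0⟩ := cover_primes Q w z x y (2 ^ (100 * b + 103)) κ S (2 ^ 26 * (b:ℝ) ^ 2 / (L * Real.log b)) q2
    (by
      have : 2 * (κ:ℝ) < w := by
        rw [hw, hκ]
        have h1 := h.cA (c := 3) 5 (n := 1000) (by norm_num) (by norm_num)
        have : 0 < A ^ 5 := by positivity
        linarith
      exact_mod_cast this)
    (by exact_mod_cast (by linarith : (0:ℝ) < x))
    (fun p hp => by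
      rw [q5] at hp
      obtain ⟨p1, p2, p3⟩ := hP1 p hp
      have p2' : (x:ℝ) < 16 * p := by exact_mod_cast p2
      exact ⟨p2, p3, by exact_mod_cast (by linarith : (z:ℝ) < p)⟩)
    (fun s => by
      rw [q1]
      have := (mem_PI.1 s.2).2.1
      have h1 : ((s:ℕ):ℝ) ≤ R := le_trans (by exact_mod_cast this) (Nat.floor_le (by linarith))
      exact_mod_cast (by linarith : ((s:ℕ):ℝ) * 16 ≤ x))
    (fun p hp hpW => by
      have : (p:ℝ) ≤ Q.WT := by exact_mod_cast Nat.le_of_dvd Q.hWT hpW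
      exact_mod_cast (by linarith : (p:ℝ) * 16 ≤ x))
    (by
      rw [hκ, q3]
      have e1 : Q.WT * (1 + 18 * R ^ 6) ≤ x := by
        calc Q.WT * (1 + 18 * R ^ 6) ≤ R * (R * R ^ 6) := by gcongr; have := one_le_pow₀ (n := 6) hR; have := mul_le_mul_of_nonneg_right h500 (hRn 6); linarith
          _ = R ^ 8 := by ring
          _ ≤ x := h.Rx (by norm_num)
      have e2 : 2 * A ^ 5 ≤ A ^ 98 := h.cA _ (by norm_num) (by norm_num)
      have e3 := one_le_pow₀ (n := 5) hA
      have e4 := mul_le_mul_of_nonneg_left e2 (show (0:ℝ) ≤ x by linarith)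
      have e5 := mul_le_mul_of_nonneg_left e3 (show (0:ℝ) ≤ x by linarith)
      linarith)
    (by
      have : (y:ℝ) + 2 * κ * x + Q.WT ≤ 2 ^ (2 ^ (100 * b + 103)) := by
        refine le_trans ?_ h.exp4
        rw [hκ]
        have : R ^ 202 = R * R * x := by rw [h.hx]; ring
        have : (x:ℝ) * L ≤ x * R := by gcongr
        have : A ^ 5 * (x:ℝ) ≤ R * x := by gcongr
        have : 16 * (R * x) ≤ R * (R * x) := by gcongr
        have : R * 1 ≤ R * (x:ℝ) := by gcongr
        linarith
      exact_mod_cast this)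
    hε0.le
    (by rw [q6, div_le_one (by positivity)]; exact one_le_pow₀ hA)
    (by
      have hΛ : ((2 ^ (100 * b + 103) : ℕ):ℝ) = 2 ^ 103 * A ^ 100 := by
        rw [h.hA, ← pow_mul, ← pow_add]; push_cast; congr 1; ring
      rw [q6, hκ, hΛ, hw]; clear hΛ
      rw [div_div, div_le_div_iff₀ (by positivity) (by positivity)]
      calc 405 * (A ^ 5) ^ 3 * (2 ^ 103 * A ^ 100) * (A ^ 500 * 2) = 405 * 2 ^ 104 * A ^ 615 := by ring
        _ ≤ 1 * A ^ 1000 := by rw [one_mul]; exact h.cA _ (by norm_num) (by norm_num))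
    (by rw [hS]; gcongr)
    (by rw [q5]; exact_mod_cast lt_of_lt_of_le hcx c1)
    (by
      refine le_trans ?_ (mul_le_mul_of_nonneg_left hEl (by positivity))
      refine le_trans ?_ (mul_le_mul_of_nonneg_left (div_le_div_of_nonneg_right z4 (by positivity)) (by positivity))
      have e : 2 ^ 26 * (b:ℝ) ^ 2 / (L * Real.log b) * (T / 2 / (32 * (1000 * Real.log A))) = 1024 * b / (1000 * Real.log A) := by
        rw [hT]; field_simp; ring
      rw [e, le_div_iff₀ (by positivity)]; linarith)
    (by
      rw [q3]
      refine le_trans ?_ (hεR y (hR9.trans hxy))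
      have e1 : (y:ℝ) / x ≤ R := by rw [div_le_iff₀ (by linarith), mul_comm]; exact y2.trans (by gcongr)
      have e2 : 32 * (y:ℝ) / x + 1 ≤ 33 * R := by rw [mul_div_assoc]; linarith
      calc S * (32 * y / x + 1) * (9 * R ^ 6) ≤ R * (33 * R) * (9 * R ^ 6) := by gcongr
        _ = 297 * R ^ 8 := by ring
        _ ≤ R * R ^ 8 := by gcongr; linarith
        _ = R ^ 9 := by ring)
    (by
      rw [q3, hκ]
      refine le_trans ?_ (hεR _ ?_)
      · calc A ^ 5 * (9 * R ^ 6) * S ≤ R * (R * R ^ 6) * R := by gcongr; linarith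
          _ = R ^ 9 := by ring
      · have e1 : 2 ^ 63 * (R ^ 9 * A ^ 500) ≤ x :=
          calc 2 ^ 63 * (R ^ 9 * A ^ 500) ≤ R * (R ^ 9 * R) := by have := h.cR (c := 2 ^ 63) (by norm_num); gcongr
            _ = R ^ 11 := by ring
            _ ≤ x := h.Rx (by norm_num)
        have : 1 * (x:ℝ) ≤ b * x := by gcongr; linarith
        linarith)
  rw [q3, q5] at hr0
  refine cover_all x y w z P1 P2 r0 hP1 hP2 hd hwz ?_ ?_ ?_
  · exact_mod_cast (by linarith : 16 * (z:ℝ) ≤ x)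
  · have : 16 * (y:ℝ) ≤ w * x := by
      rw [hw]
      have e1 : 16 * L ≤ A ^ 1000 := by
        have := h.cA (c := 16) 101 (n := 1000) (by norm_num) (by norm_num)
        linarith
      have := mul_le_mul_of_nonneg_left e1 (show (0:ℝ) ≤ x by linarith)
      linarith
    exact_mod_cast this
  · have hly : L ≤ Real.log y := by rw [← hxL]; exact Real.log_le_log (by linarith) hxy
    have hN : (#(PP y):ℝ) ≤ 4 * y / L := hPu.trans (by gcongr)
    have hNy : (#(PP y):ℝ) ≤ y := by
      refine hN.trans ?_
      rw [div_le_iff₀ (by linarith), mul_comm]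
      have := (h.cA' (c := 4) (n := 100) (by norm_num) (by norm_num)).trans h.hL1
      gcongr
    have t1 := h.main (by linarith) hy2 rfl hN hmm
    have t2 := h.errs y1 y2 hWT hWT0.le c1 hNy q6
    have t3 := h.smooth hxy y2 hxL hT z5 (by linarith) (by linarith)
    have t4 := rankin z y (by omega) (by exact_mod_cast (by linarith : (1:ℝ) ≤ y)) (1024 * b / L) (by positivity) (by
      rw [div_le_div_iff₀ (by linarith) (by norm_num)]
      have := h.cA (c := 2048) 1 (n := 100) (by norm_num) (by norm_num)
      have := h.hL1
      linarith)
    have e : (x:ℝ) / (8 * L) = 8 * (x / (64 * L)) := by field_simp; norm_num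
    have e0 : (0:ℝ) < x / (64 * L) := by positivity
    rw [← Nat.cast_le (α := ℝ)]
    push_cast
    have := hr0.trans (show _ ≤ 4 * ((x:ℝ) / (64 * L)) by linarith)
    linarith

open Real Filter

lemma choose_b (N : ℕ) : ∃ K : ℝ, ∀ L ≥ K, ∃ b : ℕ, N ≤ b ∧ ((2:ℝ) ^ b) ^ 100 ≤ L ∧ L ≤ 2 ^ 100 * ((2:ℝ) ^ b) ^ 100 := by
  refine ⟨2 ^ (100 * N + 100), fun L hL => ?_⟩
  have h1L : (1:ℝ) ≤ L := le_trans (one_le_pow₀ (by norm_num)) hL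
  have hf : ⌊L⌋₊ ≠ 0 := (Nat.floor_pos.2 h1L).ne'
  set m := Nat.log 2 ⌊L⌋₊ with hm
  have h1 : 2 ^ m ≤ ⌊L⌋₊ := Nat.pow_log_le_self 2 hf
  have h2 : ⌊L⌋₊ + 1 ≤ 2 ^ (m + 1) := Nat.lt_pow_succ_log_self (by norm_num) _
  have h3 : (2:ℝ) ^ m ≤ L := le_trans (by exact_mod_cast h1) (Nat.floor_le (by linarith))
  have h4 : L ≤ (2:ℝ) ^ (m + 1) := (Nat.lt_floor_add_one L).le.trans (by exact_mod_cast h2)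
  have e : ∀ b : ℕ, ((2:ℝ) ^ b) ^ 100 = 2 ^ (100 * b) := fun b => by rw [← pow_mul, mul_comm]
  refine ⟨m / 100, ?_, ?_, ?_⟩
  · by_contra! h
    have h5 : m + 1 < 100 * N + 100 := by omega
    have : (2:ℝ) ^ (m + 1) < 2 ^ (100 * N + 100) := pow_lt_pow_right₀ (by norm_num) h5
    linarith
  · rw [e]; exact le_trans (pow_le_pow_right₀ (by norm_num) (by omega)) h3
  · rw [e, ← pow_add]; exact h4.trans (pow_le_pow_right₀ (by norm_num) (by omega))

lemma final_cover : ∃ x0 : ℕ, ∀ x ≥ x0, ∃ y b : ℕ, 0 < b ∧ b ≤ Real.log (Real.log x) ∧ x * Real.log x / (2 ^ 97 * b) ≤ y ∧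
    ∃ r : ℕ → ℤ, ∀ n ∈ Icc 1 y, ∃ p ∈ PP x, (p:ℤ) ∣ (n:ℤ) - r p := by
  obtain ⟨K, hK⟩ := choose_b 1000
  obtain ⟨N1, hN1⟩ := eventually_atTop.1 PP_upper
  have hl : ∀ᶠ x : ℕ in atTop, K ≤ Real.log x :=
    (Real.tendsto_log_atTop.comp tendsto_natCast_atTop_atTop).eventually_ge_atTop K
  obtain ⟨x0, hx0⟩ := eventually_atTop.1 (hl.and (P_lower.and (eventually_ge_atTop (N1 + 1))))
  refine ⟨x0, fun x hx => ?_⟩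
  obtain ⟨h1, h2, h3⟩ := hx0 x hx
  obtain ⟨b, hb, hL1, hL2⟩ := hK _ h1
  have hxp : (0:ℝ) < x := by exact_mod_cast (by omega : 0 < x)
  have h : Pm b (2 ^ b) x (Real.log x) (Real.exp (Real.log x / 200)) := ⟨hb, rfl, hL1, hL2, rfl, by
    rw [← Real.exp_nat_mul]; push_cast; rw [mul_div_cancel₀ _ (by norm_num), Real.exp_log hxp]⟩
  have hb0 : (0:ℝ) < b := by linarith [h.b1]
  have hL := h.L0
  have e : x * Real.log x / (2 ^ 96 * b) = 2 * (x * Real.log x / (2 ^ 97 * b)) := by field_simp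
  have hv := (h.yy (y := x * Real.log x / (2 ^ 97 * b)) le_rfl (by rw [e]; linarith [show 0 ≤ x * Real.log x / (2 ^ 97 * b) by positivity])).1
  have hv1 : (1:ℝ) * 1 ≤ x * (2 ^ b) ^ 98 := by
    have := h.x0
    have := one_le_pow₀ (n := 98) h.A0
    gcongr
  have hf := Nat.lt_floor_add_one (x * Real.log x / (2 ^ 96 * b))
  have hy1 : x * Real.log x / (2 ^ 97 * b) ≤ (⌊x * Real.log x / (2 ^ 96 * b)⌋₊ : ℝ) := by linarith
  have hy2 : (⌊x * Real.log x / (2 ^ 96 * b)⌋₊ : ℝ) ≤ x * Real.log x / (2 ^ 96 * b) := Nat.floor_le (by positivity)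
  generalize ⌊x * Real.log x / (2 ^ 96 * b)⌋₊ = y at hy1 hy2
  have hxy : x ≤ y := by
    have : (x:ℝ) * 1 ≤ x * (2 ^ b) ^ 98 := by gcongr; exact one_le_pow₀ h.A0
    exact_mod_cast (by linarith : (x:ℝ) ≤ y)
  refine ⟨y, b, by omega, ?_, hy1, core_cover h rfl h2 (hN1 y (by omega)) hy1 hy2⟩
  have := Real.log_le_log (by positivity) hL1
  rw [Real.log_pow] at this
  push_cast at this
  linarith [h.logA.2]

/-- (Westzynthius, 1931) `G(X) ≫ log X · log₂ X / log₃ X`. -/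
theorem westzynthius_large_gaps :
    ∃ C > (0 : ℝ), ∀ᶠ X : ℝ in atTop,
      G X ≥ C * (Real.log X * iterlog 2 X) / iterlog 3 X := by
  obtain ⟨x0, hx0⟩ := final_cover
  refine ⟨1 / 2 ^ 100, by positivity, ?_⟩
  filter_upwards [Real.tendsto_log_atTop.eventually_ge_atTop (2 * x0 + 1000), eventually_gt_atTop 0] with X hU hX
  have e2 : iterlog 2 X = Real.log (Real.log X) := rfl
  have e3 : iterlog 3 X = Real.log (Real.log (Real.log X)) := rfl
  rw [e2, e3]
  have hXe : X = Real.exp (Real.log X) := (Real.exp_log hX).symm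
  set U := Real.log X with hUd
  have hx00 : (0:ℝ) ≤ x0 := Nat.cast_nonneg _
  obtain ⟨y, b, hb, hbl, hy, r, hr⟩ := hx0 ⌊U / 2⌋₊ (Nat.le_floor (by linarith))
  have f1 : (⌊U / 2⌋₊ : ℝ) ≤ U / 2 := Nat.floor_le (by linarith)
  have f2 : U / 3 ≤ (⌊U / 2⌋₊ : ℝ) := by have := Nat.lt_floor_add_one (U / 2); linarith
  generalize ⌊U / 2⌋₊ = x at hbl hy hr f1 f2
  have hb1 : (1:ℝ) ≤ b := by exact_mod_cast hb
  have g1 : (y:ℝ) ≤ G X := by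
    refine gap_of_cover x y X r hr ?_
    have h4 : (4:ℝ) ^ x ≤ Real.exp (7 / 10 * U) := by
      have : (4:ℝ) = Real.exp (2 * Real.log 2) := by
        rw [two_mul, Real.exp_add, Real.exp_log two_pos]; norm_num
      rw [this, ← Real.exp_nat_mul, Real.exp_le_exp]
      have := Real.log_two_lt_d9
      nlinarith
    have h5 : 2 * ((x:ℝ) + 3) ≤ Real.exp (3 / 10 * U) := by
      have := Real.quadratic_le_exp_of_nonneg (show 0 ≤ 3 / 10 * U by linarith)
      nlinarith
    calc 2 * ((x:ℝ) + 3) * 4 ^ x ≤ Real.exp (3 / 10 * U) * Real.exp (7 / 10 * U) := by gcongr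
      _ = X := by rw [← Real.exp_add, hXe]; congr 1; ring
  refine ge_iff_le.2 (le_trans ?_ (hy.trans g1))
  have hx1 : (1:ℝ) < x := by linarith
  have k1 : Real.log x ≤ Real.log U := Real.log_le_log (by linarith) (by linarith)
  have k0 : 0 < Real.log x := Real.log_pos hx1
  have k2 : (b:ℝ) ≤ Real.log (Real.log U) := hbl.trans (Real.log_le_log k0 k1)
  have k3 : Real.log U ≤ 2 * Real.log x := by
    have : Real.log U ≤ Real.log ((x:ℝ) ^ 2) := Real.log_le_log (by linarith) (by nlinarith)
    rwa [Real.log_pow] at this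
  have k4 : U * Real.log U ≤ (3 * x) * (2 * Real.log x) := by
    have : 0 ≤ Real.log U := by linarith
    gcongr; linarith
  have k5 : 0 < x * Real.log x := by positivity
  calc 1 / 2 ^ 100 * (U * Real.log U) / Real.log (Real.log U) ≤ 1 / 2 ^ 100 * ((3 * x) * (2 * Real.log x)) / b := by gcongr
    _ = (3 / 4) * (x * Real.log x / (2 ^ 97 * b)) := by field_simp; norm_num
    _ ≤ _ := by have : 0 < x * Real.log x / (2 ^ 97 * b) := by positivity
                linarith
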